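/- There exists a constant C > 0 with the following property. Let n ≥ 2, T > 0, and let u : [0,T]×S¹ → S^{n−1} ⊂ ℝⁿ be measurable such that: u(t,·) ∈ H¹(S¹) for a.e. t with ∫₀^T ‖u(t,·)‖²_{H¹} dt < ∞; there is w ∈ L²([0,T]×S¹;ℝⁿ) which is the weak time derivative of u (∫₀^T∫_{S¹}u·∂ₜφ dx dt = −∫₀^T∫_{S¹}w·φ dx dt for all φ ∈ C_c^∞((0,T)×S¹;ℝⁿ)); u solves the half-harmonic gradient flow weakly (for all φ ∈ C_c^∞((0,T)×S¹;ℝⁿ): ∫₀^T∫_{S¹}w·φ dx dt + ∫₀^T∫_{S¹}∫_{S¹}d_{1/2}u(t,·)(x,y)·d_{1/2}φ(t,·)(x,y) (dy dx/|x−y|) dt = ∫₀^T∫_{S¹}|d_{1/2}u(t,·)|²(x)u(t,x)·φ(t,x) dx dt); ‖u(t,·)−u₀‖_{L²(S¹)} → 0 as t → 0⁺ for some u₀ with E(u₀) := (1/2)Σ_{k}|k||û₀(k)|² < ∞; and the energy decreases: ‖u(t,·)‖²_{Ḣ^{1/2}} ≤ ‖u₀‖²_{Ḣ^{1/2}} for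 a.e. t ∈ [0,T]. Then for a.e. t ∈ [0,T], every 0 < R < 1/2 and every x₀ ∈ S¹: (1/2)∫_{B_R(x₀)} |(−Δ)^{1/4}u(t,·)(x)|² dx ≤ (1/2)∫_{B_{2R}(x₀)} |(−Δ)^{1/4}u₀(x)|² dx + C·( t/R² + √t/R )·E(u₀). -/

import Mathlib

open MeasureTheory Real Filter
open scoped BigOperators ENNReal Real Topology

noncomputable section

/-- Chord distance on `S¹ ≃ ℝ/2πℤ`: `|x-y| = 2|sin((x-y)/2)|`. -/
def cd (x y : ℝ) : ℝ := 2 * |Real.sin ((x - y) / 2)|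

/-- Fundamental domain for the circle `S¹ ≃ ℝ/2πℤ`. -/
def circ : Set ℝ := Set.Ioc (-π) π

/-- `k`-th Fourier coefficient of a `2π`-periodic function `ℝ → ℂ`. -/
def fc (f : ℝ → ℂ) (k : ℤ) : ℂ :=
  ((1 / (2 * π) : ℝ) : ℂ) * ∫ x in circ, f x * Complex.exp (-(Complex.I * (k : ℂ) * (x : ℂ)))

/-- Fourier coefficient of a real-valued function. -/
def fcR (f : ℝ → ℝ) (k : ℤ) : ℂ := fc (fun x => (f x : ℂ)) k

/-- `ℝⁿ` as a Euclidean space. -/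
abbrev E (n : ℕ) := EuclideanSpace ℝ (Fin n)

/-- Componentwise Fourier coefficients of a vector-valued map. -/
def fcV {n : ℕ} (u : ℝ → E n) (k : ℤ) (i : Fin n) : ℂ := fcR (fun x => u x i) k

/-- Squared homogeneous `Ḣ^{1/2}` seminorm: `∑_k |k| |û(k)|²` (valued in `[0,∞]`). -/
def hHalf {n : ℕ} (u : ℝ → E n) : ℝ≥0∞ :=
  ∑' k : ℤ, (k.natAbs : ℝ≥0∞) * ∑ i, (‖fcV u k i‖₊ : ℝ≥0∞) ^ 2

/-- Squared inhomogeneous `H^s` norm: `∑_k (1+k²)^s |û(k)|²` (valued in `[0,∞]`). -/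
def hSob {n : ℕ} (s : ℝ) (u : ℝ → E n) : ℝ≥0∞ :=
  ∑' k : ℤ, ENNReal.ofReal ((1 + (k : ℝ) ^ 2) ^ s) * ∑ i, (‖fcV u k i‖₊ : ℝ≥0∞) ^ 2

/-- Squared homogeneous `Ḣ^{1/2}` seminorm of a scalar function. -/
def hHalfR (f : ℝ → ℝ) : ℝ≥0∞ :=
  ∑' k : ℤ, (k.natAbs : ℝ≥0∞) * (‖fcR f k‖₊ : ℝ≥0∞) ^ 2

/-- Squared inhomogeneous `H^s` norm of a scalar function. -/
def hSobR (s : ℝ) (f : ℝ → ℝ) : ℝ≥0∞ :=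
  ∑' k : ℤ, ENNReal.ofReal ((1 + (k : ℝ) ^ 2) ^ s) * (‖fcR f k‖₊ : ℝ≥0∞) ^ 2

/-- `|d_{1/2}u|²(x) = ∫_{S¹} |u(x)-u(y)|²/|x-y|² dy`. -/
def gagl {n : ℕ} (u : ℝ → E n) (x : ℝ) : ℝ :=
  ∫ y in circ, (∑ i, (u x i - u y i) ^ 2) / cd x y ^ 2

/-- `∫_{S¹}∫_{S¹} d_{1/2}u(x,y)·d_{1/2}φ(x,y) dy dx/|x-y|`. -/
def pairing {n : ℕ} (u φ : ℝ → E n) : ℝ :=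
  ∫ x in circ, ∫ y in circ, (∑ i, (u x i - u y i) * (φ x i - φ y i)) / cd x y ^ 2

/-- The product measure on `(0,∞) × S¹`. -/
def STmeasure : Measure (ℝ × ℝ) :=
  (volume.restrict (Set.Ioi (0 : ℝ))).prod (volume.restrict circ)

/-- Smooth test functions on `(0,∞) × S¹`, compactly supported in time. -/
structure IsSTTest (n : ℕ) (φ : ℝ → ℝ → E n) : Prop where
  smooth : ContDiff ℝ (⊤ : ℕ∞) (fun p : ℝ × ℝ => φ p.1 p.2)
  periodic : ∀ t, Function.Periodic (φ t) (2 * π)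
  suppTime : ∃ a b : ℝ, 0 < a ∧ ∀ t, t ∉ Set.Icc a b → ∀ x, φ t x = 0

/-- Energy-class solution of the half-harmonic gradient flow, with explicit
weak time derivative `w`. -/
structure IsEnergySolAux (n : ℕ) (u₀ : ℝ → E n) (u w : ℝ → ℝ → E n) : Prop where
  meas : Measurable (Function.uncurry u)
  periodic : ∀ t, Function.Periodic (u t) (2 * π)
  sphere : ∀ᵐ p ∂STmeasure, ‖u p.1 p.2‖ = 1
  energyBdd : ∃ M : ℝ≥0∞, M < ⊤ ∧
    ∀ᵐ t ∂(volume.restrict (Set.Ioi (0 : ℝ))), hHalf (u t) ≤ M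
  wMeas : Measurable (Function.uncurry w)
  wL2 : (∫⁻ t in Set.Ioi (0 : ℝ), ∫⁻ x in circ, (‖w t x‖₊ : ℝ≥0∞) ^ 2) < ⊤
  weakDeriv : ∀ φ : ℝ → ℝ → E n, IsSTTest n φ →
    (∫ t in Set.Ioi (0 : ℝ), ∫ x in circ, ∑ i, u t x i * deriv (fun s => φ s x i) t)
      = - ∫ t in Set.Ioi (0 : ℝ), ∫ x in circ, ∑ i, w t x i * φ t x i
  flow : ∀ φ : ℝ → ℝ → E n, IsSTTest n φ →
    (∫ t in Set.Ioi (0 : ℝ), ∫ x in circ, ∑ i, w t x i * φ t x i)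
      + (∫ t in Set.Ioi (0 : ℝ), pairing (u t) (φ t))
      = ∫ t in Set.Ioi (0 : ℝ), ∫ x in circ, gagl (u t) x * ∑ i, u t x i * φ t x i
  init : Tendsto (fun t => ∫⁻ x in circ, (‖u t x - u₀ x‖₊ : ℝ≥0∞) ^ 2)
      (nhdsWithin 0 (Set.Ioi 0)) (nhds 0)

/-- Energy-class solution of the half-harmonic gradient flow. -/
def IsEnergySol (n : ℕ) (u₀ : ℝ → E n) (u : ℝ → ℝ → E n) : Prop :=
  ∃ w, IsEnergySolAux n u₀ u w

/-- Energy decay: `‖u(t,·)‖_{Ḣ^{1/2}} ≤ ‖u₀‖_{Ḣ^{1/2}}` for a.e. `t ≥ 0`. -/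
def EnergyDecay {n : ℕ} (u₀ : ℝ → E n) (u : ℝ → ℝ → E n) : Prop :=
  ∀ᵐ t ∂(volume.restrict (Set.Ioi (0 : ℝ))), hHalf (u t) ≤ hHalf u₀

/-- Fractional Laplacian `(-Δ)^s` of a `2π`-periodic function, via Fourier series. -/
def fracLapC (s : ℝ) (f : ℝ → ℂ) (x : ℝ) : ℂ :=
  ∑' k : ℤ, (((k.natAbs : ℝ) ^ s : ℝ) : ℂ) * fc f k * Complex.exp (Complex.I * (k : ℂ) * (x : ℂ))

/-- Fractional Laplacian of a real-valued function. -/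
def fracLapR (s : ℝ) (f : ℝ → ℝ) (x : ℝ) : ℝ := (fracLapC s (fun y => (f y : ℂ)) x).re

/-- Half-Laplacian of a vector-valued map. -/
def halfLap {n : ℕ} (u : ℝ → E n) (x : ℝ) : E n :=
  (EuclideanSpace.equiv (Fin n) ℝ).symm fun i => fracLapR 1 (fun y => u y i) x

/-- The integral `C(j,k) = ∫_{-π}^{π} (e^{ijh}-1)(e^{ikh}-1)/(4sin²(h/2)) dh`. -/
def Cjk (j k : ℤ) : ℂ :=
  ∫ h in circ, (Complex.exp (Complex.I * (j : ℂ) * (h : ℂ)) - 1)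
      * (Complex.exp (Complex.I * (k : ℂ) * (h : ℂ)) - 1)
      / ((4 * Real.sin (h / 2) ^ 2 : ℝ) : ℂ)

/-- A real trigonometric polynomial: the function equals a finite Fourier sum. -/
def IsTrigPoly (u : ℝ → ℝ) : Prop :=
  ∃ s : Finset ℤ, ∀ x : ℝ,
    (u x : ℂ) = ∑ k ∈ s, fcR u k * Complex.exp (Complex.I * (k : ℂ) * (x : ℂ))

/-- `d_{1/2}u · d_{1/2}v` as a (complex-valued) function on the circle. -/
def d12prod (u v : ℝ → ℝ) (x : ℝ) : ℂ :=
  ((∫ y in circ, (u x - u y) * (v x - v y) / cd x y ^ 2 : ℝ) : ℂ)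

/-- Stereographic projection of `S¹ ∖ {-i}`. -/
def stproj (θ : ℝ) : ℝ := Real.cos θ / (1 + Real.sin θ)


/-- Smooth test functions on `(0,T) × S¹`, compactly supported in time inside `(0,T)`. -/
def IsSTTestOn (n : ℕ) (T : ℝ) (φ : ℝ → ℝ → E n) : Prop :=
  ContDiff ℝ (⊤ : ℕ∞) (fun p : ℝ × ℝ => φ p.1 p.2) ∧
  (∀ t, Function.Periodic (φ t) (2 * π)) ∧
  ∃ a b : ℝ, 0 < a ∧ b < T ∧ ∀ t, t ∉ Set.Icc a b → ∀ x, φ t x = 0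

/-- A representative of `(-Δ)^{1/4}v`: an `L²` function whose Fourier coefficients are
`|k|^{1/2} v̂(k)`. -/
def IsQuarterLapRep {n : ℕ} (v g : ℝ → E n) : Prop :=
  Measurable g ∧ Function.Periodic g (2 * π) ∧
  (∫⁻ x in circ, (‖g x‖₊ : ℝ≥0∞) ^ 2) < ⊤ ∧
  ∀ (k : ℤ) (i : Fin n), fcV g k i = (((k.natAbs : ℝ) ^ ((1 : ℝ) / 2) : ℝ) : ℂ) * fcV v k i

section

open ComplexConjugate

instance fact_two_pi_pos : Fact (0 < 2 * π) := ⟨two_pi_pos⟩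

lemma circ_eq : circ = Set.Ioc (-π) (-π + 2 * π) := by
  rw [circ]; congr 1; ring

lemma measurableSet_circ : MeasurableSet circ := measurableSet_Ioc

instance : IsFiniteMeasure (volume.restrict circ) := by
  rw [circ]; infer_instance

lemma volume_circ : volume circ = ENNReal.ofReal (2 * π) := by
  rw [circ, Real.volume_Ioc]; congr 1; ring

lemma continuous_exp_neg (k : ℤ) :
    Continuous (fun x : ℝ => Complex.exp (-(Complex.I * (k : ℂ) * (x : ℂ)))) := by fun_prop

lemma norm_exp_neg (k : ℤ) (x : ℝ) : ‖Complex.exp (-(Complex.I * (k : ℂ) * (x : ℂ)))‖ = 1 := by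
  rw [Complex.norm_exp]; simp

lemma norm_exp_pos (k : ℤ) (x : ℝ) : ‖Complex.exp (Complex.I * (k : ℂ) * (x : ℂ))‖ = 1 := by
  rw [Complex.norm_exp]; simp

lemma fourier_two_pi_coe (k : ℤ) (x : ℝ) :
    fourier k (x : AddCircle (2 * π)) = Complex.exp (Complex.I * (k : ℂ) * (x : ℂ)) := by
  rw [fourier_coe_apply]
  congr 1
  have : (π : ℂ) ≠ 0 := by exact_mod_cast pi_ne_zero
  push_cast
  field_simp

lemma fourier_two_pi_neg_coe (k : ℤ) (x : ℝ) :
    fourier (-k) (x : AddCircle (2 * π)) = Complex.exp (-(Complex.I * (k : ℂ) * (x : ℂ))) := by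
  rw [fourier_two_pi_coe]; congr 1; push_cast; ring

lemma integral_addCircle (G : AddCircle (2 * π) → ℂ) :
    ∫ y, G y ∂AddCircle.haarAddCircle = ((1 / (2 * π) : ℝ) : ℂ) * ∫ x in circ, G (x : AddCircle (2 * π)) := by
  rw [AddCircle.integral_haarAddCircle, ← AddCircle.integral_preimage (2 * π) (-π) G, ← circ_eq,
    Complex.real_smul]
  simp

lemma fourierCoeff_eq_fc (G : AddCircle (2 * π) → ℂ) (k : ℤ) :
    fourierCoeff G k = fc (fun x => G (x : AddCircle (2 * π))) k := by
  rw [fourierCoeff, fc, integral_addCircle]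
  congr 2
  ext x
  rw [fourier_two_pi_neg_coe, smul_eq_mul, mul_comm]

lemma fc_congr {f g : ℝ → ℂ} (h : f =ᵐ[volume.restrict circ] g) (k : ℤ) : fc f k = fc g k := by
  unfold fc
  congr 1
  apply integral_congr_ae
  filter_upwards [h] with x hx
  rw [hx]

lemma liftIoc_ae (f : ℝ → ℂ) :
    (fun x : ℝ => AddCircle.liftIoc (2 * π) (-π) f (x : AddCircle (2 * π)))
      =ᵐ[volume.restrict circ] f := by
  filter_upwards [ae_restrict_mem measurableSet_circ] with x hx
  rw [AddCircle.liftIoc_coe_apply (by rwa [← circ_eq])]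

lemma fc_repr_toLp {f : ℝ → ℂ}
    (hf : MemLp (AddCircle.liftIoc (2 * π) (-π) f) 2 AddCircle.haarAddCircle) (k : ℤ) :
    (fourierBasis (T := 2 * π)).repr (hf.toLp _) k = fc f k := by
  rw [fourierBasis_repr, fourierCoeff_congr_ae hf.coeFn_toLp, fourierCoeff_eq_fc]
  exact fc_congr (liftIoc_ae f) k

lemma memLp_lift {f : ℝ → ℂ} (hf : MemLp f 2 (volume.restrict circ)) :
    MemLp (AddCircle.liftIoc (2 * π) (-π) f) 2 AddCircle.haarAddCircle := by
  rw [circ_eq] at hf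
  exact hf.memLp_liftIoc.haarAddCircle

/-- Parseval's identity for two square integrable functions on the circle. -/
lemma hasSum_parseval {f g : ℝ → ℂ} (hf : MemLp f 2 (volume.restrict circ))
    (hg : MemLp g 2 (volume.restrict circ)) :
    HasSum (fun k => fc f k * conj (fc g k))
      (((1 / (2 * π) : ℝ) : ℂ) * ∫ x in circ, f x * conj (g x)) := by
  have hF := memLp_lift hf
  have hG := memLp_lift hg
  have h := (fourierBasis (T := 2 * π)).hasSum_inner_mul_inner (hG.toLp _) (hF.toLp _)
  have e : inner ℂ (hG.toLp _) (hF.toLp _)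
      = ((1 / (2 * π) : ℝ) : ℂ) * ∫ x in circ, f x * conj (g x) := by
    rw [MeasureTheory.L2.inner_def]
    have : ∀ᵐ y ∂(AddCircle.haarAddCircle (T := 2 * π)),
        inner ℂ ((hG.toLp _) y) ((hF.toLp _) y)
          = AddCircle.liftIoc (2 * π) (-π) f y * conj (AddCircle.liftIoc (2 * π) (-π) g y) := by
      filter_upwards [hF.coeFn_toLp, hG.coeFn_toLp] with y h1 h2
      rw [h1, h2, RCLike.inner_apply]
    rw [integral_congr_ae this, integral_addCircle]
    congr 1
    apply integral_congr_ae
    filter_upwards [liftIoc_ae f, liftIoc_ae g] with x h1 h2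
    rw [h1, h2]
  rw [e] at h
  have hk : ∀ k, fc f k * conj (fc g k) = inner ℂ (hG.toLp _) (fourierBasis k) *
      inner ℂ (fourierBasis k) (hF.toLp _) := ?_
  · rw [funext hk]; exact h
  intro k
  have e1 := fc_repr_toLp hF k
  have e2 := fc_repr_toLp hG k
  rw [HilbertBasis.repr_apply_apply] at e1 e2
  rw [← e1, ← e2, inner_conj_symm, mul_comm]

lemma hasSum_parseval_norm {f : ℝ → ℂ} (hf : MemLp f 2 (volume.restrict circ)) :
    HasSum (fun k => ‖fc f k‖ ^ 2) (1 / (2 * π) * ∫ x in circ, ‖f x‖ ^ 2) := by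
  have h := hasSum_parseval hf hf
  have h2 := Complex.hasSum_re h
  convert h2 using 1
  · ext k
    rw [Complex.mul_conj, Complex.ofReal_re, Complex.normSq_eq_norm_sq]
  · simp_rw [Complex.mul_conj, Complex.normSq_eq_norm_sq]
    rw [integral_complex_ofReal, ← Complex.ofReal_mul, Complex.ofReal_re]

/-- Uniqueness of Fourier coefficients of integrable functions. -/
lemma ae_eq_zero_of_fc_eq_zero {f : ℝ → ℂ} (hf : IntegrableOn f circ)
    (h : ∀ k, fc f k = 0) : f =ᵐ[volume.restrict circ] 0 := by
  have hint : ∀ ψ : C(AddCircle (2 * π), ℂ),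
      Integrable (fun x : ℝ => ψ (x : AddCircle (2 * π)) * f x) (volume.restrict circ) := by
    intro ψ
    refine Integrable.bdd_mul (c := ‖ψ‖) hf ?_ ?_
    · exact (ψ.continuous.comp (AddCircle.continuous_mk' _)).aestronglyMeasurable
    · exact ae_of_all _ fun x => ψ.norm_coe_le_norm _
  have hspan : ∀ ψ ∈ Submodule.span ℂ (Set.range (@fourier (2 * π))),
      ∫ x in circ, ψ (x : AddCircle (2 * π)) * f x = 0 := by
    intro ψ hψ
    induction hψ using Submodule.span_induction with
    | mem ψ hψ =>
      obtain ⟨k, rfl⟩ := hψ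
      have := h (-k)
      rw [fc, mul_eq_zero] at this
      rcases this with h0 | h0
      · exfalso; have := pi_ne_zero; simp at h0
      · rw [← h0]; congr 1; ext x
        rw [fourier_two_pi_coe, mul_comm]; congr 2; push_cast; ring
    | zero => simp
    | add a b _ _ ha hb =>
      simp only [ContinuousMap.add_apply, add_mul]
      rw [integral_add (hint a) (hint b), ha, hb, add_zero]
    | smul c a _ ha =>
      simp only [ContinuousMap.smul_apply, smul_eq_mul, mul_assoc]
      rw [integral_const_mul, ha, mul_zero]
  have hall : ∀ ψ : C(AddCircle (2 * π), ℂ),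
      ∫ x in circ, ψ (x : AddCircle (2 * π)) * f x = 0 := by
    intro ψ
    have hmem : ψ ∈ closure (Submodule.span ℂ (Set.range (@fourier (2 * π))) :
        Set C(AddCircle (2 * π), ℂ)) := by
      rw [← Submodule.topologicalClosure_coe, span_fourier_closure_eq_top]; trivial
    rw [Metric.mem_closure_iff] at hmem
    rw [← norm_le_zero_iff]
    set A := ∫ x in circ, ‖f x‖ with hA
    have hA0 : 0 ≤ A := integral_nonneg fun _ => norm_nonneg _
    refine le_of_forall_pos_le_add fun ε hε => ?_
    obtain ⟨p, hp, hd⟩ := hmem (ε / (A + 1)) (by positivity)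
    have e : ∫ x in circ, ψ (x : AddCircle (2 * π)) * f x
        = ∫ x in circ, (ψ - p) (x : AddCircle (2 * π)) * f x := by
      simp only [ContinuousMap.sub_apply, sub_mul]
      rw [integral_sub (hint ψ) (hint p), hspan p hp, sub_zero]
    rw [e, zero_add]
    calc _ ≤ ∫ x in circ, ε / (A + 1) * ‖f x‖ := by
          refine norm_integral_le_of_norm_le (hf.norm.const_mul _) (ae_of_all _ fun x => ?_)
          rw [norm_mul]
          gcongr
          refine ((ψ - p).norm_coe_le_norm _).trans ?_
          rw [← dist_eq_norm]; exact hd.le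
      _ = ε / (A + 1) * A := by rw [integral_const_mul]
      _ ≤ ε := by
          rw [div_mul_eq_mul_div, div_le_iff₀ (by positivity)]; nlinarith
  have hae : ∀ᵐ x, x ∈ Set.Ioo (-π) π → f x = 0 := by
    refine isOpen_Ioo.ae_eq_zero_of_integral_contDiff_smul_eq_zero ?_ ?_
    · exact (hf.mono_set Set.Ioo_subset_Ioc_self).locallyIntegrableOn
    · intro g hg _ hsupp
      have hz : ∀ x, x ∉ Set.Ioo (-π) π → g x = 0 := fun x hx =>
        image_eq_zero_of_notMem_tsupport fun h => hx (hsupp h)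
      have hcont : Continuous (AddCircle.liftIoc (2 * π) (-π) fun x => (g x : ℂ)) := by
        refine AddCircle.liftIoc_continuous ?_ ?_
        · rw [hz _ (by simp), hz _ (by simp; intro; linarith)]
        · have := hg.continuous
          exact (Complex.continuous_ofReal.comp this).continuousOn
      have := hall ⟨_, hcont⟩
      rw [← integral_indicator measurableSet_circ] at this
      rw [← this]
      congr 1; ext x
      by_cases hx : x ∈ circ
      · rw [Set.indicator_of_mem hx, ContinuousMap.coe_mk,
          AddCircle.liftIoc_coe_apply (by rwa [← circ_eq]), Complex.real_smul]
      · rw [Set.indicator_of_notMem hx, hz x fun h => hx ⟨h.1, h.2.le⟩, zero_smul]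
  rw [Filter.EventuallyEq, circ, ← MeasureTheory.restrict_Ioo_eq_restrict_Ioc,
    ae_restrict_iff' measurableSet_Ioo]
  exact hae

lemma fc_sub {f g : ℝ → ℂ} (hf : IntegrableOn f circ) (hg : IntegrableOn g circ) (k : ℤ) :
    fc (fun x => f x - g x) k = fc f k - fc g k := by
  have hb : ∀ {f : ℝ → ℂ}, IntegrableOn f circ →
      IntegrableOn (fun x => f x * Complex.exp (-(Complex.I * (k : ℂ) * (x : ℂ)))) circ :=
    fun hf => hf.mul_bdd (c := 1) (continuous_exp_neg k).aestronglyMeasurable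
      (ae_of_all _ fun x => (norm_exp_neg k x).le)
  unfold fc
  simp_rw [sub_mul]
  rw [integral_sub (hb hf) (hb hg), mul_sub]

lemma ae_eq_of_fc_eq {f g : ℝ → ℂ} (hf : IntegrableOn f circ) (hg : IntegrableOn g circ)
    (h : ∀ k, fc f k = fc g k) : f =ᵐ[volume.restrict circ] g := by
  have := ae_eq_zero_of_fc_eq_zero (hf.sub hg) fun k => by
    have := fc_sub hf hg k
    rw [h k, sub_self] at this
    exact this
  filter_upwards [this] with x hx
  exact sub_eq_zero.1 hx

/-- An integrable function with square summable Fourier coefficients is square integrable. -/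
lemma memLp_two_of_summable_fc {f : ℝ → ℂ} (hf : IntegrableOn f circ)
    (h : Summable fun k => ‖fc f k‖ ^ 2) : MemLp f 2 (volume.restrict circ) := by
  have hm : Memℓp (fc f) 2 := by
    apply memℓp_gen
    simpa using h
  set F := (fourierBasis (T := 2 * π)).repr.symm ⟨fc f, hm⟩ with hFdef
  have hF : MemLp (F : AddCircle (2 * π) → ℂ) 2 volume :=
    memLp_haarAddCircle_iff.1 (Lp.memLp F)
  set G : ℝ → ℂ := fun x => F (x : AddCircle (2 * π)) with hG
  have hGm : MemLp G 2 (volume.restrict circ) := by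
    rw [circ_eq]
    exact hF.comp_measurePreserving (AddCircle.measurePreserving_mk (2 * π) (-π))
  refine hGm.ae_eq (ae_eq_of_fc_eq (hGm.integrable (by norm_num)) hf fun k => ?_)
  rw [hG, ← fourierCoeff_eq_fc, ← fourierBasis_repr, hFdef]
  simp

lemma fc_mul_exp_neg (f : ℝ → ℂ) (j k : ℤ) :
    fc (fun x => f x * Complex.exp (-(Complex.I * (j : ℂ) * (x : ℂ)))) k = fc f (k + j) := by
  unfold fc
  congr 2; ext x
  rw [mul_assoc, ← Complex.exp_add]
  congr 2; push_cast; ring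

lemma intervalIntegral_eq_indicator {𝕜 : Type*} [RCLike 𝕜] (g : ℝ → 𝕜) {t r : ℝ}
    (hr : r ∈ Set.Ioc 0 t) :
    ∫ x in (0 : ℝ)..r, g x = ∫ s in Set.Ioc 0 t, if s ≤ r then g s else 0 := by
  have e : (fun s => if s ≤ r then g s else 0) = Set.indicator (Set.Iic r) g := by
    ext s; simp [Set.indicator_apply]
  rw [intervalIntegral.integral_of_le hr.1.le, e, setIntegral_indicator measurableSet_Iic]
  congr 2
  ext s
  simp only [Set.mem_Ioc, Set.mem_inter_iff, Set.mem_Iic]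
  constructor
  · rintro ⟨h1, h2⟩; exact ⟨⟨h1, h2.trans hr.2⟩, h2⟩
  · rintro ⟨⟨h1, _⟩, h2⟩; exact ⟨h1, h2⟩

lemma intervalIntegral_eq_indicator_lt {𝕜 : Type*} [RCLike 𝕜] (g : ℝ → 𝕜) {t r : ℝ}
    (hr : r ∈ Set.Ioc 0 t) :
    ∫ x in (0 : ℝ)..r, g x = ∫ s in Set.Ioc 0 t, if s < r then g s else 0 := by
  rw [intervalIntegral_eq_indicator g hr]
  apply integral_congr_ae
  have : ∀ᵐ s ∂(volume.restrict (Set.Ioc 0 t)), s ≠ r :=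
    ae_restrict_of_ae (by simp [ae_iff, measure_singleton])
  filter_upwards [this] with s hs
  simp [le_iff_lt_or_eq, hs]

lemma integral_mul_integral_triangle {𝕜 : Type*} [RCLike 𝕜] {f g : ℝ → 𝕜} {t : ℝ}
    (hf : IntegrableOn f (Set.Ioc 0 t)) (hg : IntegrableOn g (Set.Ioc 0 t)) :
    IntegrableOn (fun r => f r * ∫ x in (0 : ℝ)..r, g x) (Set.Ioc 0 t) ∧
    IntegrableOn (fun r => (∫ x in (0 : ℝ)..r, f x) * g r) (Set.Ioc 0 t) ∧
    (∫ r in Set.Ioc 0 t, f r) * (∫ r in Set.Ioc 0 t, g r)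
      = (∫ r in Set.Ioc 0 t, f r * ∫ x in (0 : ℝ)..r, g x)
        + ∫ r in Set.Ioc 0 t, (∫ x in (0 : ℝ)..r, f x) * g r := by
  set ν := volume.restrict (Set.Ioc 0 t) with hν
  have hh : Integrable (fun p : ℝ × ℝ => f p.1 * g p.2) (ν.prod ν) := Integrable.mul_prod hf hg
  set S : Set (ℝ × ℝ) := {p | p.2 ≤ p.1} with hS
  have hSm : MeasurableSet S := measurableSet_le measurable_snd measurable_fst
  have h1 := hh.indicator hSm
  have h2 := hh.indicator hSm.compl
  have e1 : ∀ r ∈ Set.Ioc 0 t, ∫ s, S.indicator (fun p : ℝ × ℝ => f p.1 * g p.2) (r, s) ∂ν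
      = f r * ∫ x in (0 : ℝ)..r, g x := by
    intro r hr
    rw [intervalIntegral_eq_indicator g hr, ← hν, ← integral_const_mul]
    congr 1; ext s
    simp only [Set.indicator_apply, hS, Set.mem_ofPred_eq]
    split_ifs <;> simp
  have e2 : ∀ s ∈ Set.Ioc 0 t, ∫ r, Sᶜ.indicator (fun p : ℝ × ℝ => f p.1 * g p.2) (r, s) ∂ν
      = (∫ x in (0 : ℝ)..s, f x) * g s := by
    intro s hs
    rw [intervalIntegral_eq_indicator_lt f hs, ← hν, ← integral_mul_const]
    congr 1; ext r
    simp only [Set.indicator_apply, hS, Set.mem_compl_iff, Set.mem_ofPred_eq, not_le]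
    split_ifs <;> simp
  refine ⟨?_, ?_, ?_⟩
  · refine h1.integral_prod_left.congr ?_
    filter_upwards [ae_restrict_mem measurableSet_Ioc] with r hr using e1 r hr
  · refine h2.integral_prod_right.congr ?_
    filter_upwards [ae_restrict_mem measurableSet_Ioc] with r hr using e2 r hr
  · rw [← integral_prod_mul f g]
    have : (fun p : ℝ × ℝ => f p.1 * g p.2)
        = fun p => S.indicator (fun p : ℝ × ℝ => f p.1 * g p.2) p
          + Sᶜ.indicator (fun p : ℝ × ℝ => f p.1 * g p.2) p := by
      ext p; exact (congrFun (Set.indicator_self_add_compl S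
        (fun p : ℝ × ℝ => f p.1 * g p.2)) p).symm
    rw [this, integral_add h1 h2, integral_prod _ h1, integral_prod_symm _ h2]
    congr 1
    · exact setIntegral_congr_fun measurableSet_Ioc e1
    · exact setIntegral_congr_fun measurableSet_Ioc e2

/-- Product rule for primitives of integrable functions. -/
lemma primitive_mul_primitive {𝕜 : Type*} [RCLike 𝕜] {f g : ℝ → 𝕜} {t : ℝ} (ht : 0 ≤ t)
    (hf : IntegrableOn f (Set.Ioc 0 t)) (hg : IntegrableOn g (Set.Ioc 0 t)) (α β : 𝕜) :
    IntegrableOn (fun r => f r * (β + ∫ x in (0 : ℝ)..r, g x)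
        + (α + ∫ x in (0 : ℝ)..r, f x) * g r) (Set.Ioc 0 t) ∧
    (α + ∫ r in (0 : ℝ)..t, f r) * (β + ∫ r in (0 : ℝ)..t, g r) - α * β
      = ∫ r in Set.Ioc 0 t, (f r * (β + ∫ x in (0 : ℝ)..r, g x)
        + (α + ∫ x in (0 : ℝ)..r, f x) * g r) := by
  obtain ⟨h1, h2, h3⟩ := integral_mul_integral_triangle hf hg
  have e : (fun r => f r * (β + ∫ x in (0 : ℝ)..r, g x) + (α + ∫ x in (0 : ℝ)..r, f x) * g r)
      = fun r => (f r * β + α * g r) + ((f r * ∫ x in (0 : ℝ)..r, g x)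
        + (∫ x in (0 : ℝ)..r, f x) * g r) := by
    ext r; ring
  rw [e]
  have i1 : IntegrableOn (fun r => f r * β) (Set.Ioc 0 t) := hf.mul_const β
  have i2 : IntegrableOn (fun r => α * g r) (Set.Ioc 0 t) := hg.const_mul α
  refine ⟨(i1.add i2).add (h1.add h2), ?_⟩
  have s1 := integral_add (i1.add i2) (h1.add h2)
  have s2 := integral_add i1 i2
  have s3 := integral_add h1 h2
  simp only [Pi.add_apply] at s1 s2 s3
  rw [s1, s2, s3, integral_mul_const, integral_const_mul, intervalIntegral.integral_of_le ht,
    intervalIntegral.integral_of_le ht, ← h3]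
  ring

/-- The symbol `|k|^{1/2}` of `(-Δ)^{1/4}`. -/
def qs (k : ℤ) : ℝ := (k.natAbs : ℝ) ^ ((1 : ℝ) / 2)

lemma qs_nonneg (k : ℤ) : 0 ≤ qs k := by unfold qs; positivity

lemma qs_sq (k : ℤ) : qs k ^ 2 = k.natAbs := by
  rw [qs, ← Real.rpow_natCast, ← Real.rpow_mul (by positivity)]; norm_num

lemma qs_add_le (k j : ℤ) : qs (k + j) ≤ qs k + qs j := by
  have h1 := qs_nonneg k
  have h2 := qs_nonneg j
  refine abs_le_of_sq_le_sq' ?_ (by positivity) |>.2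
  have : ((k + j).natAbs : ℝ) ≤ k.natAbs + j.natAbs := by exact_mod_cast Int.natAbs_add_le k j
  nlinarith [qs_sq k, qs_sq j, qs_sq (k + j), mul_nonneg h1 h2]

lemma qs_neg (k : ℤ) : qs (-k) = qs k := by simp [qs]

lemma abs_qs_sub_le (k j : ℤ) : |qs k - qs (k + j)| ≤ qs j := by
  rw [abs_le]
  constructor
  · linarith [qs_add_le k j]
  · have := qs_add_le (k + j) (-j)
    rw [qs_neg, add_neg_cancel_right] at this
    linarith

lemma ENNReal.mul_le_weighted_sq (a b : ℝ≥0∞) {e : ℝ≥0∞} (h0 : e ≠ 0) (ht : e ≠ ⊤) :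
    a * b ≤ e * a ^ 2 + e⁻¹ * b ^ 2 := by
  rcases le_total (e * a) b with h | h
  · refine le_add_left ?_
    have : a ≤ e⁻¹ * b := by
      calc a = e⁻¹ * (e * a) := by rw [← mul_assoc, ENNReal.inv_mul_cancel h0 ht, one_mul]
        _ ≤ _ := by gcongr
    calc a * b ≤ e⁻¹ * b * b := by gcongr
      _ = _ := by ring
  · refine le_add_right ?_
    calc a * b ≤ a * (e * a) := by gcongr
      _ = _ := by ring

/-- Young's inequality for Toeplitz sums. -/
lemma tsum_toeplitz_le (c α β : ℤ → ℝ≥0∞) {e : ℝ≥0∞} (h0 : e ≠ 0) (ht : e ≠ ⊤) :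
    ∑' p : ℤ × ℤ, c p.1 * (α p.2 * β (p.2 + p.1))
      ≤ (∑' j, c j) * (e * ∑' k, α k ^ 2 + e⁻¹ * ∑' k, β k ^ 2) := by
  rw [ENNReal.tsum_prod', ← ENNReal.tsum_mul_right]
  refine ENNReal.tsum_le_tsum fun j => ?_
  dsimp only
  rw [ENNReal.tsum_mul_left]
  gcongr
  calc ∑' k, α k * β (k + j) ≤ ∑' k, (e * α k ^ 2 + e⁻¹ * β (k + j) ^ 2) :=
        ENNReal.tsum_le_tsum fun k => ENNReal.mul_le_weighted_sq _ _ h0 ht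
    _ = e * ∑' k, α k ^ 2 + e⁻¹ * ∑' k, β (k + j) ^ 2 := by
        rw [ENNReal.tsum_add, ENNReal.tsum_mul_left, ENNReal.tsum_mul_left]
    _ = _ := by
        congr 2
        exact (Equiv.addRight j).tsum_eq (fun k => β k ^ 2)

/-- Summand of the Toeplitz form with symbol coefficients `c`. -/
def toep (c α β : ℤ → ℂ) (p : ℤ × ℤ) : ℂ := c p.1 * (α p.2 * conj (β (p.2 + p.1)))

lemma enorm_toep (c α β : ℤ → ℂ) (p : ℤ × ℤ) :
    ‖toep c α β p‖ₑ = ‖c p.1‖ₑ * (‖α p.2‖ₑ * ‖β (p.2 + p.1)‖ₑ) := by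
  rw [toep, enorm_mul, enorm_mul]
  congr 2
  rw [← ofReal_norm, ← ofReal_norm, RCLike.norm_conj]

lemma tsum_enorm_toep_le (c α β : ℤ → ℂ) {e : ℝ≥0∞} (h0 : e ≠ 0) (ht : e ≠ ⊤) :
    ∑' p, ‖toep c α β p‖ₑ
      ≤ (∑' j, ‖c j‖ₑ) * (e * ∑' k, ‖α k‖ₑ ^ 2 + e⁻¹ * ∑' k, ‖β k‖ₑ ^ 2) := by
  simp_rw [enorm_toep]
  exact tsum_toeplitz_le (fun j => ‖c j‖ₑ) (fun j => ‖α j‖ₑ) (fun j => ‖β j‖ₑ) h0 ht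

lemma summable_toep {c α β : ℤ → ℂ} (hc : ∑' j, ‖c j‖ₑ ≠ ⊤) (hα : ∑' k, ‖α k‖ₑ ^ 2 ≠ ⊤)
    (hβ : ∑' k, ‖β k‖ₑ ^ 2 ≠ ⊤) : Summable (toep c α β) := by
  refine Summable.of_enorm (ne_top_of_le_ne_top ?_
    (tsum_enorm_toep_le c α β one_ne_zero ENNReal.one_ne_top))
  simp only [inv_one, one_mul]
  finiteness

lemma HasSum.trans_eq {ι : Type*} {f : ι → ℂ} {a b : ℂ} (h : HasSum f a) (e : a = b) :
    HasSum f b := e ▸ h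

lemma tsum_enorm_sq_fc_ne_top {f : ℝ → ℂ} (hf : MemLp f 2 (volume.restrict circ)) :
    ∑' k, ‖fc f k‖ₑ ^ 2 ≠ ⊤ := by
  have h := (hasSum_parseval_norm hf).summable
  have e : ∀ k, ‖fc f k‖ₑ ^ 2 = ENNReal.ofReal (‖fc f k‖ ^ 2) := fun k => by
    rw [ENNReal.ofReal_pow (norm_nonneg _), ofReal_norm]
  simp_rw [e]
  exact h.tsum_ofReal_ne_top

/-- Parseval identity with a multiplier given by an absolutely convergent Fourier series. -/
lemma hasSum_toep_fc {c : ℤ → ℂ} (hc : ∑' j, ‖c j‖ₑ ≠ ⊤) {m : ℝ → ℂ}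
    (hm : ∀ x : ℝ, HasSum (fun j : ℤ => c j * Complex.exp (Complex.I * (j : ℂ) * (x : ℂ))) (m x))
    {f g : ℝ → ℂ} (hf : MemLp f 2 (volume.restrict circ))
    (hg : MemLp g 2 (volume.restrict circ)) :
    HasSum (toep c (fc f) (fc g))
      (((1 / (2 * π) : ℝ) : ℂ) * ∫ x in circ, m x * (f x * conj (g x))) := by
  have hcs : Summable fun j => ‖c j‖ := tsum_enorm_ne_top_iff_summable_norm.1 hc
  have hs := summable_toep hc (tsum_enorm_sq_fc_ne_top hf) (tsum_enorm_sq_fc_ne_top hg)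
  have hfg : Integrable (fun x => f x * conj (g x)) (volume.restrict circ) := by
    have hg' : MemLp (fun x => conj (g x)) 2 (volume.restrict circ) := hg.star
    exact hf.integrable_mul hg'
  have hrow : ∀ j, HasSum (fun k => toep c (fc f) (fc g) (j, k))
      (((1 / (2 * π) : ℝ) : ℂ) * ∫ x in circ,
        (c j * Complex.exp (Complex.I * (j : ℂ) * (x : ℂ))) * (f x * conj (g x))) := by
    intro j
    have hg' : MemLp (fun x => g x * Complex.exp (-(Complex.I * (j : ℂ) * (x : ℂ)))) 2
        (volume.restrict circ) := by
      refine hg.of_le (hg.1.mul (continuous_exp_neg j).aestronglyMeasurable) (ae_of_all _ fun x => ?_)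
      rw [norm_mul, norm_exp_neg, mul_one]
    have h := (hasSum_parseval hf hg').mul_left (c j)
    simp_rw [fc_mul_exp_neg] at h
    refine HasSum.trans_eq h ?_
    rw [mul_left_comm, ← integral_const_mul]
    congr 2; ext x
    rw [map_mul, ← Complex.exp_conj]
    simp only [map_neg, map_mul, Complex.conj_I, Complex.conj_ofReal, map_intCast]
    ring_nf
  have hcol : HasSum (fun j => (((1 / (2 * π) : ℝ) : ℂ) * ∫ x in circ,
        (c j * Complex.exp (Complex.I * (j : ℂ) * (x : ℂ))) * (f x * conj (g x))))
      (((1 / (2 * π) : ℝ) : ℂ) * ∫ x in circ, m x * (f x * conj (g x))) := by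
    apply HasSum.mul_left
    have hnorm : ∀ j (x : ℝ), ‖(c j * Complex.exp (Complex.I * (j : ℂ) * (x : ℂ)))
        * (f x * conj (g x))‖ = ‖c j‖ * ‖f x * conj (g x)‖ := fun j x => by
      rw [norm_mul, norm_mul, norm_exp_pos, mul_one]
    have := hasSum_integral_of_summable_integral_norm (μ := volume.restrict circ)
      (F := fun (j : ℤ) (x : ℝ) => (c j * Complex.exp (Complex.I * (j : ℂ) * (x : ℂ)))
        * (f x * conj (g x))) (fun j => ?_) ?_
    · refine HasSum.trans_eq this (integral_congr_ae (ae_of_all _ fun x => ?_))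
      simp only
      rw [tsum_mul_right, (hm x).tsum_eq]
    · refine hfg.bdd_mul (c := ‖c j‖) (Continuous.aestronglyMeasurable (by fun_prop))
        (ae_of_all _ fun x => ?_)
      rw [norm_mul, norm_exp_pos, mul_one]
    · simp_rw [hnorm, integral_const_mul]
      exact hcs.mul_right _
  have := hs.hasSum.prod_fiberwise hrow
  rw [← this.unique hcol]
  exact hs.hasSum

/-- Multiplication of a coefficient sequence by `|k|^{1/2}`. -/
def qsMul (α : ℤ → ℂ) (k : ℤ) : ℂ := (qs k : ℂ) * α k

/-- Multiplication of a coefficient sequence by `|k|`. -/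
def absMul (α : ℤ → ℂ) (k : ℤ) : ℂ := ((k.natAbs : ℝ) : ℂ) * α k

lemma qs_mul_self (k : ℤ) : (qs k : ℂ) * (qs k : ℂ) = ((k.natAbs : ℝ) : ℂ) := by
  rw [← Complex.ofReal_mul, ← sq, qs_sq]

lemma enorm_qs_sub_le (k j : ℤ) : ‖((qs k - qs (k + j) : ℝ) : ℂ)‖ₑ ≤ ENNReal.ofReal (qs j) := by
  rw [← ofReal_norm, Complex.norm_real, Real.norm_eq_abs]
  exact ENNReal.ofReal_le_ofReal (abs_qs_sub_le k j)

lemma enorm_qsMul_sq (α : ℤ → ℂ) (k : ℤ) :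
    ‖qsMul α k‖ₑ ^ 2 = (k.natAbs : ℝ≥0∞) * ‖α k‖ₑ ^ 2 := by
  rw [qsMul, enorm_mul, mul_pow, ← ofReal_norm, Complex.norm_real, Real.norm_of_nonneg (qs_nonneg k),
    ← ENNReal.ofReal_pow (qs_nonneg k), qs_sq, ENNReal.ofReal_natCast]

lemma enorm_absMul_sq (α : ℤ → ℂ) (k : ℤ) :
    ‖absMul α k‖ₑ ^ 2 = (k.natAbs : ℝ≥0∞) ^ 2 * ‖α k‖ₑ ^ 2 := by
  rw [absMul, enorm_mul, mul_pow, ← ofReal_norm, Complex.norm_real,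
    Real.norm_of_nonneg (by positivity), ENNReal.ofReal_natCast]

lemma tsum_qsMul_le_absMul (α : ℤ → ℂ) :
    ∑' k, ‖qsMul α k‖ₑ ^ 2 ≤ ∑' k, ‖absMul α k‖ₑ ^ 2 := by
  refine ENNReal.tsum_le_tsum fun k => ?_
  rw [enorm_qsMul_sq, enorm_absMul_sq]
  gcongr
  exact_mod_cast Nat.le_self_pow two_ne_zero _

/-- Commutator of the Toeplitz form with `|k|^{1/2}`, acting on the right factor. -/
def toepErrR (c α β : ℤ → ℂ) (p : ℤ × ℤ) : ℂ :=
  ((qs p.2 - qs (p.2 + p.1) : ℝ) : ℂ) * toep c α (qsMul β) p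

/-- Commutator of the Toeplitz form with `|k|^{1/2}`, acting on the left factor. -/
def toepErrL (c α β : ℤ → ℂ) (p : ℤ × ℤ) : ℂ :=
  -(((qs p.2 - qs (p.2 + p.1) : ℝ) : ℂ) * toep c (qsMul α) β p)

lemma toep_qsMul_eq_right (c α β : ℤ → ℂ) (p : ℤ × ℤ) :
    toep c (qsMul α) (qsMul β) p = toep c α (absMul β) p + toepErrR c α β p := by
  simp only [toepErrR, toep, qsMul, absMul, map_mul, Complex.conj_ofReal, ← qs_mul_self]
  push_cast; ring

lemma toep_qsMul_eq_left (c α β : ℤ → ℂ) (p : ℤ × ℤ) :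
    toep c (qsMul α) (qsMul β) p = toep c (absMul α) β p + toepErrL c α β p := by
  simp only [toepErrL, toep, qsMul, absMul, map_mul, Complex.conj_ofReal, ← qs_mul_self]
  push_cast; ring

lemma tsum_enorm_toepErrR_le (c α β : ℤ → ℂ) {e : ℝ≥0∞} (h0 : e ≠ 0) (ht : e ≠ ⊤) :
    ∑' p, ‖toepErrR c α β p‖ₑ ≤ (∑' j, ‖c j‖ₑ * ENNReal.ofReal (qs j)) *
      (e * ∑' k, ‖α k‖ₑ ^ 2 + e⁻¹ * ∑' k, ‖qsMul β k‖ₑ ^ 2) := by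
  refine le_trans (ENNReal.tsum_le_tsum fun p => ?_)
    (tsum_toeplitz_le (fun j => ‖c j‖ₑ * ENNReal.ofReal (qs j)) (fun j => ‖α j‖ₑ)
      (fun j => ‖qsMul β j‖ₑ) h0 ht)
  rw [toepErrR, enorm_mul, enorm_toep]
  calc _ ≤ ENNReal.ofReal (qs p.1) * (‖c p.1‖ₑ * (‖α p.2‖ₑ * ‖qsMul β (p.2 + p.1)‖ₑ)) := by
        gcongr; exact enorm_qs_sub_le _ _
    _ = _ := by ring

lemma tsum_enorm_toepErrL_le (c α β : ℤ → ℂ) {e : ℝ≥0∞} (h0 : e ≠ 0) (ht : e ≠ ⊤) :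
    ∑' p, ‖toepErrL c α β p‖ₑ ≤ (∑' j, ‖c j‖ₑ * ENNReal.ofReal (qs j)) *
      (e * ∑' k, ‖β k‖ₑ ^ 2 + e⁻¹ * ∑' k, ‖qsMul α k‖ₑ ^ 2) := by
  have h := tsum_toeplitz_le (fun j => ‖c j‖ₑ * ENNReal.ofReal (qs j)) (fun j => ‖qsMul α j‖ₑ)
      (fun j => ‖β j‖ₑ) (ENNReal.inv_ne_zero.2 ht) (ENNReal.inv_ne_top.2 h0)
  rw [inv_inv, add_comm (e⁻¹ * _)] at h
  refine le_trans (ENNReal.tsum_le_tsum fun p => ?_) h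
  rw [toepErrL, enorm_neg, enorm_mul, enorm_toep]
  calc _ ≤ ENNReal.ofReal (qs p.1) * (‖c p.1‖ₑ * (‖qsMul α p.2‖ₑ * ‖β (p.2 + p.1)‖ₑ)) := by
        gcongr; exact enorm_qs_sub_le _ _
    _ = _ := by ring

/-- The summand of the time derivative of the Toeplitz form of `qsMul α` when `α' = β`. -/
def toepDeriv (c α β : ℤ → ℂ) (p : ℤ × ℤ) : ℂ :=
  toep c (qsMul β) (qsMul α) p + toep c (qsMul α) (qsMul β) p

lemma tsum_enorm_toepDeriv_le (c α β : ℤ → ℂ) :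
    ∑' p, ‖toepDeriv c α β p‖ₑ ≤ 2 * ((∑' j, ‖c j‖ₑ) + ∑' j, ‖c j‖ₑ * ENNReal.ofReal (qs j)) *
      (∑' k, ‖β k‖ₑ ^ 2 + ∑' k, ‖absMul α k‖ₑ ^ 2) := by
  have h1 := tsum_enorm_toep_le c β (absMul α) one_ne_zero ENNReal.one_ne_top
  have h2 := tsum_enorm_toep_le c (absMul α) β one_ne_zero ENNReal.one_ne_top
  have h3 := tsum_enorm_toepErrR_le c β α one_ne_zero ENNReal.one_ne_top
  have h4 := tsum_enorm_toepErrL_le c α β one_ne_zero ENNReal.one_ne_top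
  simp only [inv_one, one_mul] at h1 h2 h3 h4
  have h5 := tsum_qsMul_le_absMul α
  calc _ ≤ ∑' p, ((‖toep c β (absMul α) p‖ₑ + ‖toepErrR c β α p‖ₑ)
          + (‖toep c (absMul α) β p‖ₑ + ‖toepErrL c α β p‖ₑ)) := by
        refine ENNReal.tsum_le_tsum fun p => ?_
        rw [toepDeriv, toep_qsMul_eq_right c β α, toep_qsMul_eq_left c α β]
        exact (enorm_add_le _ _).trans (add_le_add (enorm_add_le _ _) (enorm_add_le _ _))
    _ = (∑' p, ‖toep c β (absMul α) p‖ₑ + ∑' p, ‖toepErrR c β α p‖ₑ)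
          + (∑' p, ‖toep c (absMul α) β p‖ₑ + ∑' p, ‖toepErrL c α β p‖ₑ) := by
        rw [ENNReal.tsum_add, ENNReal.tsum_add, ENNReal.tsum_add]
    _ ≤ _ := add_le_add (add_le_add h1 h3) (add_le_add h2 h4)
    _ ≤ (((∑' j, ‖c j‖ₑ) * (∑' k, ‖β k‖ₑ ^ 2 + ∑' k, ‖absMul α k‖ₑ ^ 2)
          + (∑' j, ‖c j‖ₑ * ENNReal.ofReal (qs j)) *
            (∑' k, ‖β k‖ₑ ^ 2 + ∑' k, ‖absMul α k‖ₑ ^ 2))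
        + ((∑' j, ‖c j‖ₑ) * (∑' k, ‖absMul α k‖ₑ ^ 2 + ∑' k, ‖β k‖ₑ ^ 2)
          + (∑' j, ‖c j‖ₑ * ENNReal.ofReal (qs j)) *
            (∑' k, ‖β k‖ₑ ^ 2 + ∑' k, ‖absMul α k‖ₑ ^ 2))) := by gcongr
    _ = _ := by ring

lemma exists_tsum_toepDeriv_eq {c α β : ℤ → ℂ} (hc : ∑' j, ‖c j‖ₑ ≠ ⊤)
    (hK : ∑' j, ‖c j‖ₑ * ENNReal.ofReal (qs j) ≠ ⊤) (hβ : ∑' k, ‖β k‖ₑ ^ 2 ≠ ⊤)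
    (hα : ∑' k, ‖absMul α k‖ₑ ^ 2 ≠ ⊤) {e : ℝ≥0∞} (h0 : e ≠ 0) (ht : e ≠ ⊤) :
    ∃ err : ℂ, ‖err‖ₑ ≤ 2 * (∑' j, ‖c j‖ₑ * ENNReal.ofReal (qs j)) *
        (e * ∑' k, ‖β k‖ₑ ^ 2 + e⁻¹ * ∑' k, ‖qsMul α k‖ₑ ^ 2) ∧
      ∑' p, toepDeriv c α β p
        = ∑' p, toep c β (absMul α) p + ∑' p, toep c (absMul α) β p + err := by
  have hα' : ∑' k, ‖qsMul α k‖ₑ ^ 2 ≠ ⊤ := ne_top_of_le_ne_top hα (tsum_qsMul_le_absMul α)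
  have h3 := tsum_enorm_toepErrR_le c β α h0 ht
  have h4 := tsum_enorm_toepErrL_le c α β h0 ht
  have hi : e⁻¹ ≠ ⊤ := ENNReal.inv_ne_top.2 h0
  have s3 : ∑' p, ‖toepErrR c β α p‖ₑ ≠ ⊤ := ne_top_of_le_ne_top (by finiteness) h3
  have s4 : ∑' p, ‖toepErrL c α β p‖ₑ ≠ ⊤ := ne_top_of_le_ne_top (by finiteness) h4
  have s1 := summable_toep hc hβ hα
  have s2 := summable_toep hc hα hβ
  refine ⟨∑' p, toepErrR c β α p + ∑' p, toepErrL c α β p, ?_, ?_⟩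
  · calc _ ≤ ‖∑' p, toepErrR c β α p‖ₑ + ‖∑' p, toepErrL c α β p‖ₑ := enorm_add_le _ _
      _ ≤ ∑' p, ‖toepErrR c β α p‖ₑ + ∑' p, ‖toepErrL c α β p‖ₑ :=
        add_le_add (enorm_tsum_le_tsum_enorm) (enorm_tsum_le_tsum_enorm)
      _ ≤ _ := add_le_add h3 h4
      _ = _ := by ring
  · have s3' := Summable.of_enorm s3
    have s4' := Summable.of_enorm s4
    have : toepDeriv c α β = fun p => (toep c β (absMul α) p + toepErrR c β α p)
        + (toep c (absMul α) β p + toepErrL c α β p) := by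
      ext p
      rw [toepDeriv, toep_qsMul_eq_right c β α, toep_qsMul_eq_left c α β]
    rw [this, (s1.add s3').tsum_add (s2.add s4'), s1.tsum_add s3', s2.tsum_add s4']
    ring

/-- Fundamental theorem of calculus for the localised energy `∑ c_j |k|^{1/2} a_k \bar{…}`. -/
lemma toep_evolution {c : ℤ → ℂ} (hc : ∑' j, ‖c j‖ₑ ≠ ⊤)
    (hK : ∑' j, ‖c j‖ₑ * ENNReal.ofReal (qs j) ≠ ⊤) {t : ℝ} (ht : 0 ≤ t)
    {a0 : ℤ → ℂ} {A b : ℝ → ℤ → ℂ} (hb : ∀ k, IntegrableOn (fun r => b r k) (Set.Ioc 0 t))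
    (hA : ∀ r k, A r k = a0 k + ∫ x in (0 : ℝ)..r, b x k)
    (hB : ∫⁻ r in Set.Ioc 0 t, ∑' k, ‖b r k‖ₑ ^ 2 ≠ ⊤)
    (hN : ∫⁻ r in Set.Ioc 0 t, ∑' k, ‖absMul (A r) k‖ₑ ^ 2 ≠ ⊤)
    (h0 : ∑' k, ‖qsMul a0 k‖ₑ ^ 2 ≠ ⊤) (h1 : ∑' k, ‖qsMul (A t) k‖ₑ ^ 2 ≠ ⊤) :
    IntegrableOn (fun r => ∑' p, toepDeriv c (A r) (b r) p) (Set.Ioc 0 t) ∧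
    ∑' p, toep c (qsMul (A t)) (qsMul (A t)) p - ∑' p, toep c (qsMul a0) (qsMul a0) p
      = ∫ r in Set.Ioc 0 t, ∑' p, toepDeriv c (A r) (b r) p := by
  set ν := volume.restrict (Set.Ioc (0 : ℝ) t) with hν
  have hconj : ∀ r k, conj (A r k) = conj (a0 k) + ∫ x in (0 : ℝ)..r, conj (b x k) := by
    intro r k
    rw [hA, map_add, intervalIntegral, intervalIntegral, map_sub, integral_conj, integral_conj]
  have hp : ∀ p : ℤ × ℤ, Integrable (fun r => toepDeriv c (A r) (b r) p) ν ∧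
      toep c (qsMul (A t)) (qsMul (A t)) p - toep c (qsMul a0) (qsMul a0) p
        = ∫ r, toepDeriv c (A r) (b r) p ∂ν := by
    intro p
    have hb2 : IntegrableOn (fun r => conj (b r (p.2 + p.1))) (Set.Ioc 0 t) :=
      (Complex.conjLIE.toContinuousLinearEquiv.toContinuousLinearMap).integrable_comp (hb (p.2 + p.1))
    obtain ⟨i1, i2⟩ := primitive_mul_primitive ht (hb p.2) hb2 (a0 p.2) (conj (a0 (p.2 + p.1)))
    simp_rw [← hA, ← hconj] at i1 i2
    have e : ∀ r, toepDeriv c (A r) (b r) p = (c p.1 * (qs p.2 : ℂ) * (qs (p.2 + p.1) : ℂ)) *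
        (b r p.2 * conj (A r (p.2 + p.1)) + A r p.2 * conj (b r (p.2 + p.1))) := by
      intro r
      simp only [toepDeriv, toep, qsMul, map_mul, Complex.conj_ofReal]; ring
    simp_rw [e]
    refine ⟨i1.const_mul _, ?_⟩
    rw [integral_const_mul, ← i2]
    simp only [toep, qsMul, map_mul, Complex.conj_ofReal]; ring
  have hsum : ∑' p, ∫⁻ r, ‖toepDeriv c (A r) (b r) p‖ₑ ∂ν ≠ ⊤ := by
    rw [← lintegral_tsum fun p => (hp p).1.1.enorm]
    have hm : AEMeasurable (fun r => ∑' k, ‖b r k‖ₑ ^ 2) ν :=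
      AEMeasurable.tsum fun k => ((hb k).1.enorm.pow_const 2)
    refine ne_top_of_le_ne_top ?_ (lintegral_mono fun r => tsum_enorm_toepDeriv_le c (A r) (b r))
    rw [lintegral_const_mul' _ _ (by finiteness), lintegral_add_left' hm]
    finiteness
  have hae : ∀ᵐ r ∂ν, ∑' p, ‖toepDeriv c (A r) (b r) p‖ₑ ≠ ⊤ := by
    rw [← lintegral_tsum fun p => (hp p).1.1.enorm] at hsum
    filter_upwards [ae_lt_top' (AEMeasurable.tsum fun p => (hp p).1.1.enorm) hsum] with r hr
      using hr.ne
  have hms : AEStronglyMeasurable (fun r => ∑' p, toepDeriv c (A r) (b r) p) ν := by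
    have : ∀ᵐ r ∂ν, HasSum (fun p => toepDeriv c (A r) (b r) p)
        (∑' p, toepDeriv c (A r) (b r) p) := by
      filter_upwards [hae] with r hr using (Summable.of_enorm hr).hasSum
    exact aestronglyMeasurable_of_tendsto_ae (u := (atTop : Filter (Finset (ℤ × ℤ))))
      (f := fun s r => ∑ p ∈ s, toepDeriv c (A r) (b r) p)
      (fun s => Finset.aestronglyMeasurable_fun_sum s fun p _ => (hp p).1.1) this
  refine ⟨⟨hms, ?_⟩, ?_⟩
  · rw [HasFiniteIntegral]
    refine lt_of_le_of_lt (lintegral_mono fun r => enorm_tsum_le_tsum_enorm) ?_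
    rw [lintegral_tsum fun p => (hp p).1.1.enorm]
    exact hsum.lt_top
  · rw [integral_tsum (fun p => (hp p).1.1) hsum, ← Summable.tsum_sub (summable_toep hc h1 h1)
      (summable_toep hc h0 h0)]
    exact tsum_congr fun p => (hp p).2

/-- The tent function of half-width `r`. -/
def tent (r y : ℝ) : ℝ := max (r - |y|) 0

lemma continuous_tent (r : ℝ) : Continuous (tent r) := by unfold tent; fun_prop

lemma tent_neg (r y : ℝ) : tent r (-y) = tent r y := by simp [tent]

lemma integral_tent_mul_exp_half {r : ℝ} (hr : 0 ≤ r) (hrπ : r ≤ π) {l : ℂ} (hl : l ≠ 0) :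
    ∫ y in (0 : ℝ)..π, (tent r y : ℂ) * Complex.exp (l * y)
      = Complex.exp (l * r) / l ^ 2 - r / l - 1 / l ^ 2 := by
  have hi : ∀ a b : ℝ, IntervalIntegrable (fun y : ℝ => (tent r y : ℂ) * Complex.exp (l * y))
      volume a b := fun a b => by
    have := continuous_tent r
    exact Continuous.intervalIntegrable (by fun_prop) a b
  rw [← intervalIntegral.integral_add_adjacent_intervals (hi 0 r) (hi r π)]
  have e2 : ∫ y in r..π, (tent r y : ℂ) * Complex.exp (l * y) = 0 := by
    rw [intervalIntegral.integral_congr (g := fun _ => (0 : ℂ)) ?_, intervalIntegral.integral_zero]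
    intro y hy
    rw [Set.uIcc_of_le hrπ] at hy
    have : tent r y = 0 := by
      rw [tent, max_eq_right]; rw [abs_of_nonneg (hr.trans hy.1)]; linarith [hy.1]
    simp [this]
  have e1 : ∫ y in (0 : ℝ)..r, (tent r y : ℂ) * Complex.exp (l * y)
      = ∫ y in (0 : ℝ)..r, ((r : ℂ) - y) * Complex.exp (l * y) := by
    apply intervalIntegral.integral_congr
    intro y hy
    rw [Set.uIcc_of_le hr] at hy
    have : tent r y = r - y := by
      rw [tent, abs_of_nonneg hy.1, max_eq_left]; linarith [hy.2]
    simp [this]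
  have hd : ∀ y ∈ Set.uIcc 0 r, HasDerivAt
      (fun y : ℝ => ((r : ℂ) - y) * Complex.exp (l * y) / l + Complex.exp (l * y) / l ^ 2)
      (((r : ℂ) - y) * Complex.exp (l * y)) y := by
    intro y _
    have hy : HasDerivAt (fun y : ℝ => (y : ℂ)) 1 y := Complex.ofRealCLM.hasDerivAt
    have he : HasDerivAt (fun y : ℝ => Complex.exp (l * y)) (Complex.exp (l * y) * (l * 1)) y :=
      (hy.const_mul l).cexp
    have := (((hy.const_sub (r : ℂ)).mul he).div_const l).add (he.div_const (l ^ 2))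
    refine this.congr_deriv ?_
    field_simp
    ring
  rw [e1, e2, intervalIntegral.integral_eq_sub_of_hasDerivAt hd
    (Continuous.intervalIntegrable (by fun_prop) _ _)]
  simp
  ring

lemma integral_tent_mul_exp {r : ℝ} (hr : 0 ≤ r) (hrπ : r ≤ π) {l : ℂ} (hl : l ≠ 0) :
    ∫ y in circ, (tent r y : ℂ) * Complex.exp (l * y)
      = (Complex.exp (l * r) + Complex.exp (-(l * r)) - 2) / l ^ 2 := by
  have hi : ∀ a b : ℝ, IntervalIntegrable (fun y : ℝ => (tent r y : ℂ) * Complex.exp (l * y))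
      volume a b := fun a b => by
    have := continuous_tent r
    exact Continuous.intervalIntegrable (by fun_prop) a b
  have e : ∫ y in (-π)..0, (tent r y : ℂ) * Complex.exp (l * y)
      = ∫ y in (0 : ℝ)..π, (tent r y : ℂ) * Complex.exp ((-l) * y) := by
    have := intervalIntegral.integral_comp_neg (a := 0) (b := π)
      (fun y : ℝ => (tent r y : ℂ) * Complex.exp (l * y))
    rw [neg_zero] at this
    rw [← this]
    congr 1; ext y
    rw [tent_neg]; push_cast; ring_nf
  rw [circ, ← intervalIntegral.integral_of_le (by linarith [pi_pos]),
    ← intervalIntegral.integral_add_adjacent_intervals (hi (-π) 0) (hi 0 π), e,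
    integral_tent_mul_exp_half hr hrπ hl, integral_tent_mul_exp_half hr hrπ (neg_ne_zero.2 hl)]
  field_simp
  ring

/-- A trapezoid: equal to `1` for `|y| ≤ R` and to `0` for `|y| ≥ 2R`. -/
def trap (R y : ℝ) : ℝ := (tent (2 * R) y - tent R y) / R

lemma continuous_trap (R : ℝ) : Continuous (trap R) := by
  have := continuous_tent R
  have := continuous_tent (2 * R)
  unfold trap; fun_prop

lemma trap_mem {R : ℝ} (hR : 0 < R) (y : ℝ) : 0 ≤ trap R y ∧ trap R y ≤ 1 := by
  unfold trap tent
  rw [le_div_iff₀ hR, div_le_iff₀ hR]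
  constructor
  · rw [zero_mul, sub_nonneg]; gcongr; linarith
  · rcases le_total (R - |y|) 0 with h | h
    · rw [max_eq_right h]
      have : max (2 * R - |y|) 0 ≤ R := max_le (by linarith) hR.le
      linarith
    · rw [max_eq_left h, max_eq_left (by linarith)]; linarith

lemma trap_eq_one {R y : ℝ} (hR : 0 < R) (hy : |y| ≤ R) : trap R y = 1 := by
  rw [trap, tent, tent, max_eq_left (by linarith), max_eq_left (by linarith)]
  field_simp; ring

lemma trap_eq_zero {R y : ℝ} (hR : 0 < R) (hy : 2 * R ≤ |y|) : trap R y = 0 := by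
  rw [trap, tent, tent, max_eq_right (by linarith), max_eq_right (by linarith)]; simp

lemma trap_abs (R y : ℝ) : trap R |y| = trap R y := by simp [trap, tent]

/-- The trapezoidal cutoff centred at `x₀`, on the circle. -/
def cutC (R x₀ : ℝ) : C(AddCircle (2 * π), ℂ) where
  toFun θ := (trap R ‖θ - (x₀ : AddCircle (2 * π))‖ : ℂ)
  continuous_toFun := by
    have := continuous_trap R
    fun_prop

/-- The trapezoidal cutoff centred at `x₀`, as a periodic function. -/
def cut (R x₀ x : ℝ) : ℝ := trap R ‖((x - x₀ : ℝ) : AddCircle (2 * π))‖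

lemma cutC_coe (R x₀ x : ℝ) : cutC R x₀ (x : AddCircle (2 * π)) = cut R x₀ x := by
  simp [cutC, cut]

lemma norm_addCircle_of_abs_le {y : ℝ} (hy : |y| ≤ π) : ‖(y : AddCircle (2 * π))‖ = |y| := by
  rw [AddCircle.norm_coe_eq_abs_iff _ two_pi_pos.ne', abs_of_pos two_pi_pos]
  linarith

lemma cut_periodic (R x₀ : ℝ) : Function.Periodic (cut R x₀) (2 * π) := by
  intro x
  rw [cut, cut, show x + 2 * π - x₀ = (x - x₀) + 2 * π by ring, AddCircle.coe_add_period]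

lemma continuous_cut (R x₀ : ℝ) : Continuous (cut R x₀) := by
  have h : Continuous fun x : ℝ => ((x - x₀ : ℝ) : AddCircle (2 * π)) :=
    (AddCircle.continuous_mk' (2 * π)).comp (by fun_prop)
  exact (continuous_trap R).comp h.norm

lemma fourierCoeff_cutC_norm_le {R : ℝ} (hR : 0 < R) (hR2 : R < 1 / 2) (x₀ : ℝ) {k : ℤ}
    (hk : k ≠ 0) : ‖fourierCoeff (cutC R x₀) k‖ ≤ 4 / (π * R) * (1 / (k : ℝ) ^ 2) := by
  have hπ := Real.pi_gt_three
  set l : ℂ := -(Complex.I * k) with hl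
  have hk' : (k : ℂ) ≠ 0 := by exact_mod_cast hk
  have hl0 : l ≠ 0 := by rw [hl]; exact neg_ne_zero.2 (mul_ne_zero Complex.I_ne_zero hk')
  set H : ℝ → ℂ := fun y => (trap R ‖(y : AddCircle (2 * π))‖ : ℂ) * Complex.exp (l * y) with hH
  have hHper : Function.Periodic H (2 * π) := by
    intro y
    simp only [hH, AddCircle.coe_add_period]
    congr 1
    rw [Complex.exp_eq_exp_iff_exists_int]
    exact ⟨-k, by rw [hl]; push_cast; ring⟩
  have h1 : fourierCoeff (cutC R x₀) k
      = ((1 / (2 * π) : ℝ) : ℂ) * (Complex.exp (l * x₀) * ∫ y in circ, H y) := by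
    have e1 : ∫ x in circ, H (x - x₀) = ∫ y in circ, H y := by
      rw [circ, ← intervalIntegral.integral_of_le (by linarith),
        ← intervalIntegral.integral_of_le (by linarith), intervalIntegral.integral_comp_sub_right]
      have := hHper.intervalIntegral_add_eq (-π - x₀) (-π)
      rw [show -π - x₀ + 2 * π = π - x₀ by ring, show -π + 2 * π = π by ring] at this
      exact this
    rw [fourierCoeff_eq_fc, fc, ← e1, ← integral_const_mul (Complex.exp (l * x₀))]
    congr 1
    refine setIntegral_congr_fun measurableSet_circ fun x _ => ?_
    rw [cutC_coe, hH, cut]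
    simp only
    rw [mul_left_comm, ← Complex.exp_add]
    congr 2
    rw [hl]; push_cast; ring
  have h2 : ∫ y in circ, H y = ((∫ y in circ, (tent (2 * R) y : ℂ) * Complex.exp (l * y))
      - ∫ y in circ, (tent R y : ℂ) * Complex.exp (l * y)) / R := by
    have hi : ∀ r : ℝ, IntegrableOn (fun y : ℝ => (tent r y : ℂ) * Complex.exp (l * y)) circ := by
      intro r
      have := continuous_tent r
      exact (Continuous.integrableOn_Icc (by fun_prop)).mono_set Set.Ioc_subset_Icc_self
    rw [← integral_sub (hi _) (hi _), ← integral_div]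
    refine setIntegral_congr_fun measurableSet_circ fun y hy => ?_
    simp only [hH]
    rw [norm_addCircle_of_abs_le (abs_le.2 ⟨hy.1.le, hy.2⟩), trap_abs, trap]
    push_cast; ring
  have hexp : ∀ r : ℝ, ‖Complex.exp (l * r)‖ = 1 ∧ ‖Complex.exp (-(l * r))‖ = 1 := by
    intro r
    constructor
    · rw [hl, neg_mul]; exact norm_exp_neg k r
    · rw [hl, neg_mul, neg_neg]; exact norm_exp_pos k r
  have hexp' : ‖Complex.exp (l * ((2 * R : ℝ) : ℂ)) + Complex.exp (-(l * ((2 * R : ℝ) : ℂ))) - 2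
      - (Complex.exp (l * R) + Complex.exp (-(l * R)) - 2)‖ ≤ 4 := by
    rw [sub_sub_sub_cancel_right]
    refine (norm_sub_le _ _).trans ?_
    have a1 := norm_add_le (Complex.exp (l * ((2 * R : ℝ) : ℂ))) (Complex.exp (-(l * ((2 * R : ℝ) : ℂ))))
    have a2 := norm_add_le (Complex.exp (l * R)) (Complex.exp (-(l * R)))
    rw [(hexp _).1, (hexp _).2] at a1 a2
    linarith
  have hnl : ‖l‖ ^ 2 = (k : ℝ) ^ 2 := by
    rw [hl, norm_neg, norm_mul, Complex.norm_I, one_mul, Complex.norm_intCast, sq_abs]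
  rw [h1, h2, integral_tent_mul_exp (by linarith) (by linarith) hl0,
    integral_tent_mul_exp (by linarith) (by linarith) hl0, ← sub_div, norm_mul, norm_mul,
    (hexp x₀).1, one_mul, norm_div, norm_div, norm_pow, hnl, Complex.norm_real, Complex.norm_real,
    Real.norm_of_nonneg hR.le, Real.norm_of_nonneg (by positivity)]
  have hkk : 0 < (k : ℝ) ^ 2 := by positivity
  calc _ ≤ 1 / (2 * π) * (4 / (k : ℝ) ^ 2 / R) := by gcongr
    _ = 2 / (π * R) * (1 / (k : ℝ) ^ 2) := by field_simp; norm_num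
    _ ≤ _ := by gcongr; norm_num

/-- The constant `∑ |k|^{-3/2}` controlling the commutator with the cutoff. -/
def cutConst : ℝ := 4 / π * ∑' k : ℤ, |(k : ℝ)| ^ (-(3 / 2 : ℝ))

lemma cutConst_nonneg : 0 ≤ cutConst := by
  unfold cutConst
  have : 0 ≤ ∑' k : ℤ, |(k : ℝ)| ^ (-(3 / 2 : ℝ)) := tsum_nonneg fun k => by positivity
  positivity

lemma summable_cutC {R : ℝ} (hR : 0 < R) (hR2 : R < 1 / 2) (x₀ : ℝ) :
    Summable fun k => fourierCoeff (cutC R x₀) k := by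
  have hs : Summable fun k : ℤ => 4 / (π * R) * (1 / (k : ℝ) ^ 2) :=
    (Real.summable_one_div_int_pow.2 one_lt_two).mul_left _
  refine Summable.of_norm_bounded_eventually hs ?_
  rw [Filter.eventually_cofinite]
  refine (Set.finite_singleton (0 : ℤ)).subset fun k hk => ?_
  by_contra h
  exact hk (fourierCoeff_cutC_norm_le hR hR2 x₀ h)

lemma hasSum_cut {R : ℝ} (hR : 0 < R) (hR2 : R < 1 / 2) (x₀ x : ℝ) :
    HasSum (fun k : ℤ => fourierCoeff (cutC R x₀) k * Complex.exp (Complex.I * (k : ℂ) * (x : ℂ)))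
      (cut R x₀ x : ℂ) := by
  have := has_pointwise_sum_fourier_series_of_summable (summable_cutC hR hR2 x₀) x
  simp_rw [fourier_two_pi_coe, smul_eq_mul] at this
  rwa [cutC_coe] at this

lemma qs_eq_rpow (k : ℤ) : qs k = |(k : ℝ)| ^ ((1 : ℝ) / 2) := by
  rw [qs, Nat.cast_natAbs]; push_cast; rfl

lemma tsum_cutC_qs_le {R : ℝ} (hR : 0 < R) (hR2 : R < 1 / 2) (x₀ : ℝ) :
    ∑' k, ‖fourierCoeff (cutC R x₀) k‖ₑ * ENNReal.ofReal (qs k)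
      ≤ ENNReal.ofReal (cutConst / R) := by
  have hs : Summable fun k : ℤ => 4 / (π * R) * |(k : ℝ)| ^ (-(3 / 2 : ℝ)) :=
    (Real.summable_abs_int_rpow (by norm_num)).mul_left _
  have hle : ∀ k, ‖fourierCoeff (cutC R x₀) k‖ₑ * ENNReal.ofReal (qs k)
      ≤ ENNReal.ofReal (4 / (π * R) * |(k : ℝ)| ^ (-(3 / 2 : ℝ))) := by
    intro k
    rcases eq_or_ne k 0 with rfl | hk
    · simp [qs]
    · rw [← ofReal_norm, ← ENNReal.ofReal_mul (norm_nonneg _)]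
      apply ENNReal.ofReal_le_ofReal
      have hk' : 0 < |(k : ℝ)| := by positivity
      have e : 1 / (k : ℝ) ^ 2 * qs k = |(k : ℝ)| ^ (-(3 / 2 : ℝ)) := by
        rw [qs_eq_rpow, ← sq_abs, ← Real.rpow_natCast, one_div, ← Real.rpow_neg hk'.le,
          ← Real.rpow_add hk']
        norm_num
      rw [← e, ← mul_assoc]
      have := qs_nonneg k
      gcongr
      exact fourierCoeff_cutC_norm_le hR hR2 x₀ hk
  refine (ENNReal.tsum_le_tsum hle).trans ?_
  rw [← ENNReal.ofReal_tsum_of_nonneg (fun k => by positivity) hs, tsum_mul_left]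
  apply ENNReal.ofReal_le_ofReal
  rw [cutConst]
  apply le_of_eq
  field_simp

lemma cut_mem {R : ℝ} (hR : 0 < R) (x₀ x : ℝ) : 0 ≤ cut R x₀ x ∧ cut R x₀ x ≤ 1 := trap_mem hR _

lemma cut_eq_one {R x₀ x : ℝ} (hR : 0 < R) (hR2 : R < 1 / 2) (hx : |x - x₀| ≤ R) :
    cut R x₀ x = 1 := by
  have := Real.pi_gt_three
  rw [cut, norm_addCircle_of_abs_le (by linarith), trap_abs, trap_eq_one hR hx]

lemma cut_eq_zero {R x₀ x : ℝ} (hR : 0 < R) (hx : |x - x₀| ≤ π) (hx2 : 2 * R ≤ |x - x₀|) :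
    cut R x₀ x = 0 := by
  rw [cut, norm_addCircle_of_abs_le hx, trap_abs, trap_eq_zero hR hx2]

lemma integral_exp_int (k : ℤ) :
    ∫ x in circ, Complex.exp (Complex.I * (k : ℂ) * (x : ℂ)) = if k = 0 then 2 * (π : ℂ) else 0 := by
  rw [circ, ← intervalIntegral.integral_of_le (by linarith [pi_pos])]
  split_ifs with h
  · subst h
    simp; ring
  · have hk : Complex.I * (k : ℂ) ≠ 0 := mul_ne_zero Complex.I_ne_zero (by exact_mod_cast h)
    rw [integral_exp_mul_complex hk, div_eq_zero_iff]
    left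
    rw [sub_eq_zero, Complex.exp_eq_exp_iff_exists_int]
    exact ⟨k, by push_cast; ring⟩

lemma norm_one_sub_exp_sq (h : ℝ) :
    ‖1 - Complex.exp (Complex.I * (h : ℂ))‖ ^ 2 = 4 * Real.sin (h / 2) ^ 2 := by
  have hs : Real.sin (h / 2) ^ 2 = 1 / 2 - Real.cos h / 2 := by
    rw [Real.sin_sq_eq_half_sub]; congr 3; ring
  rw [mul_comm, Complex.exp_mul_I, ← Complex.normSq_eq_norm_sq, Complex.normSq_apply, hs]
  simp only [Complex.sub_re, Complex.one_re, Complex.add_re, Complex.mul_re, Complex.I_re,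
    Complex.I_im, Complex.sub_im, Complex.one_im, Complex.add_im, Complex.mul_im,
    Complex.cos_ofReal_re, Complex.cos_ofReal_im, Complex.sin_ofReal_re, Complex.sin_ofReal_im]
  linarith [Real.sin_sq_add_cos_sq h]

lemma norm_one_sub_exp_neg (k : ℤ) (h : ℝ) :
    ‖1 - Complex.exp (-(Complex.I * (k : ℂ) * (h : ℂ)))‖
      = ‖1 - Complex.exp (Complex.I * (h : ℂ)) ^ k.natAbs‖ := by
  rw [← Complex.exp_nat_mul]
  rcases Int.natAbs_eq k with hk | hk
  · rw [← RCLike.norm_conj, map_sub, ← Complex.exp_conj]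
    conv_lhs => rw [hk]
    simp only [map_one, map_neg, map_mul, Complex.conj_I, map_intCast, Complex.conj_ofReal]
    push_cast
    congr 3; rw [Nat.cast_natAbs]; ring
  · conv_lhs => rw [hk]
    push_cast
    congr 3; rw [Nat.cast_natAbs]; ring

lemma integral_norm_geom_sum_sq (n : ℕ) :
    ∫ h in circ, ‖∑ j ∈ Finset.range n, Complex.exp (Complex.I * (h : ℂ)) ^ j‖ ^ 2 = 2 * π * n := by
  have e : ∀ h : ℝ, ((‖∑ j ∈ Finset.range n, Complex.exp (Complex.I * (h : ℂ)) ^ j‖ ^ 2 : ℝ) : ℂ)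
      = ∑ j ∈ Finset.range n, ∑ l ∈ Finset.range n,
        Complex.exp (Complex.I * (((j : ℤ) - (l : ℤ) : ℤ) : ℂ) * (h : ℂ)) := by
    intro h
    rw [← Complex.normSq_eq_norm_sq, Complex.normSq_eq_conj_mul_self, mul_comm, map_sum,
      Finset.sum_mul_sum]
    refine Finset.sum_congr rfl fun j _ => Finset.sum_congr rfl fun l _ => ?_
    rw [map_pow, ← Complex.exp_conj, ← Complex.exp_nat_mul, ← Complex.exp_nat_mul, ← Complex.exp_add]
    simp only [map_mul, Complex.conj_I, Complex.conj_ofReal]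
    push_cast
    congr 1; ring
  have hi : ∀ m : ℤ, IntegrableOn (fun h : ℝ => Complex.exp (Complex.I * (m : ℂ) * (h : ℂ))) circ :=
    fun m => (Continuous.integrableOn_Icc (by fun_prop)).mono_set Set.Ioc_subset_Icc_self
  apply Complex.ofReal_injective
  rw [← integral_complex_ofReal]
  simp_rw [e]
  rw [integral_finsetSum _ fun j _ => integrable_finsetSum _ fun l _ => hi _]
  simp_rw [integral_finsetSum _ fun l _ => hi _, integral_exp_int]
  have : ∀ j ∈ Finset.range n, ∑ l ∈ Finset.range n,
      (if ((j : ℤ) - (l : ℤ)) = 0 then 2 * (π : ℂ) else 0) = 2 * (π : ℂ) := by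
    intro j hj
    rw [Finset.sum_eq_single j]
    · simp
    · intro l _ hl
      rw [if_neg]
      omega
    · intro h; exact absurd hj h
  rw [Finset.sum_congr rfl this]
  simp; ring

lemma sin_half_ne_zero : ∀ᵐ h ∂(volume.restrict circ), Real.sin (h / 2) ≠ 0 := by
  have h0 : ∀ᵐ h ∂(volume.restrict circ), h ≠ 0 :=
    ae_restrict_of_ae (by simp [ae_iff, measure_singleton])
  filter_upwards [h0, ae_restrict_mem measurableSet_circ] with h h0 hc
  intro hs
  rw [Real.sin_eq_zero_iff_of_lt_of_lt] at hs
  · exact h0 (by linarith)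
  · linarith [hc.1, pi_pos]
  · linarith [hc.2, pi_pos]

lemma fejer_kernel_eq (k : ℤ) {h : ℝ} (hs : Real.sin (h / 2) ≠ 0) :
    ‖1 - Complex.exp (-(Complex.I * (k : ℂ) * (h : ℂ)))‖ ^ 2 / (4 * Real.sin (h / 2) ^ 2)
      = ‖∑ j ∈ Finset.range k.natAbs, Complex.exp (Complex.I * (h : ℂ)) ^ j‖ ^ 2 := by
  rw [norm_one_sub_exp_neg, ← mul_neg_geom_sum, norm_mul, mul_pow, norm_one_sub_exp_sq]
  field_simp

lemma integrableOn_fejer (k : ℤ) : IntegrableOn (fun h : ℝ =>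
    ‖1 - Complex.exp (-(Complex.I * (k : ℂ) * (h : ℂ)))‖ ^ 2 / (4 * Real.sin (h / 2) ^ 2)) circ := by
  have : IntegrableOn (fun h : ℝ =>
      ‖∑ j ∈ Finset.range k.natAbs, Complex.exp (Complex.I * (h : ℂ)) ^ j‖ ^ 2) circ :=
    (Continuous.integrableOn_Icc (by fun_prop)).mono_set Set.Ioc_subset_Icc_self
  refine Integrable.congr this ?_
  filter_upwards [sin_half_ne_zero] with h hs
  rw [fejer_kernel_eq k hs]

/-- The Fejér integral. -/
lemma integral_fejer (k : ℤ) : ∫ h in circ,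
    ‖1 - Complex.exp (-(Complex.I * (k : ℂ) * (h : ℂ)))‖ ^ 2 / (4 * Real.sin (h / 2) ^ 2)
      = 2 * π * k.natAbs := by
  rw [← integral_norm_geom_sum_sq]
  refine integral_congr_ae ?_
  filter_upwards [sin_half_ne_zero] with h hs
  rw [fejer_kernel_eq k hs]

lemma lintegral_fejer (k : ℤ) : ∫⁻ h in circ, ENNReal.ofReal
    (‖1 - Complex.exp (-(Complex.I * (k : ℂ) * (h : ℂ)))‖ ^ 2 / (4 * Real.sin (h / 2) ^ 2))
      = ENNReal.ofReal (2 * π) * k.natAbs := by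
  rw [← ofReal_integral_eq_lintegral_ofReal (integrableOn_fejer k)
    (ae_of_all _ fun h => by positivity), integral_fejer, ENNReal.ofReal_mul (by positivity),
    ENNReal.ofReal_natCast]

lemma fc_shift {f : ℝ → ℂ} (hf : Function.Periodic f (2 * π)) (h : ℝ) (k : ℤ) :
    fc (fun x => f (x - h)) k = Complex.exp (-(Complex.I * (k : ℂ) * (h : ℂ))) * fc f k := by
  set H : ℝ → ℂ := fun y => f y * Complex.exp (-(Complex.I * (k : ℂ) * (y : ℂ))) with hH
  have hHper : Function.Periodic H (2 * π) := by
    intro y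
    simp only [hH, hf y]
    congr 1
    rw [Complex.exp_eq_exp_iff_exists_int]
    exact ⟨-k, by push_cast; ring⟩
  have e1 : ∫ x in circ, H (x - h) = ∫ y in circ, H y := by
    rw [circ, ← intervalIntegral.integral_of_le (by linarith [pi_pos]),
      ← intervalIntegral.integral_of_le (by linarith [pi_pos]),
      intervalIntegral.integral_comp_sub_right]
    have := hHper.intervalIntegral_add_eq (-π - h) (-π)
    rw [show -π - h + 2 * π = π - h by ring, show -π + 2 * π = π by ring] at this
    exact this
  rw [fc, fc, mul_left_comm, ← e1, ← integral_const_mul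
    (Complex.exp (-(Complex.I * (k : ℂ) * (h : ℂ))))]
  congr 1
  refine setIntegral_congr_fun measurableSet_circ fun x _ => ?_
  simp only [hH]
  rw [mul_left_comm, ← Complex.exp_add]
  congr 2
  push_cast; ring

lemma lintegral_period_eq {f : ℝ → ℝ≥0∞} (hf : Function.Periodic f (2 * π)) (s t : ℝ) :
    ∫⁻ x in Set.Ioc s (s + 2 * π), f x = ∫⁻ x in Set.Ioc t (t + 2 * π), f x := by
  refine IsAddFundamentalDomain.setLIntegral_eq (G := AddSubgroup.zmultiples (2 * π))
    (isAddFundamentalDomain_Ioc two_pi_pos s) (isAddFundamentalDomain_Ioc two_pi_pos t) f ?_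
  exact hf.map_vadd_zmultiples

lemma lintegral_circ_shift {f : ℝ → ℝ≥0∞} (hf : Function.Periodic f (2 * π)) (h : ℝ) :
    ∫⁻ x in circ, f (x - h) = ∫⁻ x in circ, f x := by
  have h1 := (measurePreserving_sub_right volume h).setLIntegral_comp_preimage_emb
    (measurableEmbedding_subRight h) f (Set.Ioc (-π - h) (-π - h + 2 * π))
  rw [lintegral_period_eq hf _ (-π), ← circ_eq] at h1
  rw [← h1]
  congr 2
  rw [circ_eq, Set.preimage_sub_const_Ioc]
  congr 1 <;> ring

lemma integral_circ_reflect {f : ℝ → ℝ} (hf : Function.Periodic f (2 * π)) (x : ℝ) :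
    ∫ y in circ, f y = ∫ h in circ, f (x - h) := by
  rw [circ, ← intervalIntegral.integral_of_le (by linarith [pi_pos]),
    ← intervalIntegral.integral_of_le (by linarith [pi_pos]),
    intervalIntegral.integral_comp_sub_left]
  have := hf.intervalIntegral_add_eq (x - π) (-π)
  rw [show x - π + 2 * π = x - -π by ring, show -π + 2 * π = π by ring] at this
  exact this.symm

lemma memLp_two_of_lintegral {α F : Type*} [MeasurableSpace α] {μ : Measure α}
    [NormedAddCommGroup F] {f : α → F} (hf : AEStronglyMeasurable f μ)
    (h : ∫⁻ x, ‖f x‖ₑ ^ 2 ∂μ ≠ ⊤) : MemLp f 2 μ := by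
  refine ⟨hf, ?_⟩
  rw [eLpNorm_lt_top_iff_lintegral_rpow_enorm_lt_top two_ne_zero ENNReal.ofNat_ne_top]
  simpa using h.lt_top

lemma lintegral_ne_top_of_memLp_two {α F : Type*} [MeasurableSpace α] {μ : Measure α}
    [NormedAddCommGroup F] {f : α → F} (hf : MemLp f 2 μ) : ∫⁻ x, ‖f x‖ₑ ^ 2 ∂μ ≠ ⊤ := by
  have := hf.2
  rw [eLpNorm_lt_top_iff_lintegral_rpow_enorm_lt_top two_ne_zero ENNReal.ofNat_ne_top] at this
  simpa using this.ne

lemma lintegral_parseval {f : ℝ → ℂ} (hf : MemLp f 2 (volume.restrict circ)) :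
    ∫⁻ x in circ, ‖f x‖ₑ ^ 2 = ENNReal.ofReal (2 * π) * ∑' k, ‖fc f k‖ₑ ^ 2 := by
  have h := hasSum_parseval_norm hf
  have e : ∀ z : ℂ, ‖z‖ₑ ^ 2 = ENNReal.ofReal (‖z‖ ^ 2) := fun z => by
    rw [ENNReal.ofReal_pow (norm_nonneg _), ofReal_norm]
  simp_rw [e]
  rw [← ENNReal.ofReal_tsum_of_nonneg (fun k => by positivity) h.summable, h.tsum_eq,
    ← ENNReal.ofReal_mul (by positivity), ← ofReal_integral_eq_lintegral_ofReal
      (hf.integrable_norm_pow two_ne_zero) (ae_of_all _ fun x => by positivity)]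
  congr 1
  field_simp

lemma MemLp.comp_shift {f : ℝ → ℂ} (hm : Measurable f) (hp : Function.Periodic f (2 * π))
    (hf : MemLp f 2 (volume.restrict circ)) (h : ℝ) :
    MemLp (fun x => f (x - h)) 2 (volume.restrict circ) := by
  refine memLp_two_of_lintegral (hm.comp (measurable_id.sub_const h)).aestronglyMeasurable ?_
  rw [lintegral_circ_shift (f := fun x => ‖f x‖ₑ ^ 2) (fun x => by simp only [hp x])]
  exact lintegral_ne_top_of_memLp_two hf

lemma fc_sub_shift {f : ℝ → ℂ} (hm : Measurable f) (hp : Function.Periodic f (2 * π))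
    (hf : MemLp f 2 (volume.restrict circ)) (h : ℝ) (k : ℤ) :
    fc (fun x => f x - f (x - h)) k
      = (1 - Complex.exp (-(Complex.I * (k : ℂ) * (h : ℂ)))) * fc f k := by
  rw [fc_sub (hf.integrable one_le_two) ((MemLp.comp_shift hm hp hf h).integrable one_le_two),
    fc_shift hp]
  ring

/-- The kernel `1 / |x - y|²`, as a function of `h = x - y`. -/
def gKer (h : ℝ) : ℝ≥0∞ := ENNReal.ofReal (1 / (4 * Real.sin (h / 2) ^ 2))

lemma measurable_gKer : Measurable gKer := by unfold gKer; fun_prop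

lemma lintegral_fejer' (k : ℤ) : ∫⁻ h in circ,
    ‖1 - Complex.exp (-(Complex.I * (k : ℂ) * (h : ℂ)))‖ₑ ^ 2 * gKer h
      = ENNReal.ofReal (2 * π) * k.natAbs := by
  rw [← lintegral_fejer]
  congr 1; ext h
  rw [gKer, ← ofReal_norm, ← ENNReal.ofReal_pow (norm_nonneg _), ← ENNReal.ofReal_mul (by positivity),
    mul_one_div]

lemma measurable_diff {F : Type*} [NormedAddCommGroup F] [MeasurableSpace F] [BorelSpace F]
    [SecondCountableTopology F] {f : ℝ → F} (hm : Measurable f) :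
    Measurable fun p : ℝ × ℝ => f p.1 - f (p.1 - p.2) :=
  (hm.comp measurable_fst).sub (hm.comp (measurable_fst.sub measurable_snd))

/-- The Gagliardo seminorm in terms of Fourier coefficients. -/
lemma lintegral_gagliardo {f : ℝ → ℂ} (hm : Measurable f) (hp : Function.Periodic f (2 * π))
    (hf : MemLp f 2 (volume.restrict circ)) :
    ∫⁻ x in circ, ∫⁻ h in circ, ‖f x - f (x - h)‖ₑ ^ 2 * gKer h
      = ENNReal.ofReal (2 * π) ^ 2 * ∑' k, ‖qsMul (fc f) k‖ₑ ^ 2 := by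
  rw [lintegral_lintegral_swap (((measurable_diff hm).enorm.pow_const 2).mul
    (measurable_gKer.comp measurable_snd)).aemeasurable]
  have h1 : ∀ h, ∫⁻ x in circ, ‖f x - f (x - h)‖ₑ ^ 2 * gKer h
      = ∑' k, (ENNReal.ofReal (2 * π) * ‖fc f k‖ₑ ^ 2) *
        (‖1 - Complex.exp (-(Complex.I * (k : ℂ) * (h : ℂ)))‖ₑ ^ 2 * gKer h) := by
    intro h
    have hmem : MemLp (fun x => f x - f (x - h)) 2 (volume.restrict circ) :=
      hf.sub (MemLp.comp_shift hm hp hf h)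
    rw [lintegral_mul_const' (gKer h) _ ENNReal.ofReal_ne_top,
      lintegral_parseval hmem, ← ENNReal.tsum_mul_left,
      ← ENNReal.tsum_mul_right]
    refine tsum_congr fun k => ?_
    rw [fc_sub_shift hm hp hf, enorm_mul]
    ring
  simp_rw [h1]
  rw [lintegral_tsum, ← ENNReal.tsum_mul_left]
  · refine tsum_congr fun k => ?_
    rw [lintegral_const_mul' _ _ (by finiteness), lintegral_fejer', enorm_qsMul_sq]
    ring
  · intro k
    have := measurable_gKer
    exact Measurable.aemeasurable (by fun_prop)

lemma cd_sub_sq (x h : ℝ) : cd x (x - h) ^ 2 = 4 * Real.sin (h / 2) ^ 2 := by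
  rw [cd, mul_pow, sq_abs, sub_sub_cancel]; norm_num

lemma cd_periodic (x : ℝ) : Function.Periodic (fun y => cd x y ^ 2) (2 * π) := by
  intro y
  simp only [cd, mul_pow, sq_abs]
  rw [show (x - (y + 2 * π)) / 2 = (x - y) / 2 - π by ring, Real.sin_sub_pi]
  ring

variable {n : ℕ}

lemma fcV_def (v : ℝ → E n) (k : ℤ) (i : Fin n) : fcV v k i = fc (fun x => (v x i : ℂ)) k := rfl

lemma hHalf_eq (v : ℝ → E n) : hHalf v = ∑ i, ∑' k, ‖qsMul (fun k => fcV v k i) k‖ₑ ^ 2 := by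
  rw [hHalf, ← Summable.tsum_finsetSum fun i _ => ENNReal.summable]
  refine tsum_congr fun k => ?_
  rw [Finset.mul_sum]
  refine Finset.sum_congr rfl fun i _ => ?_
  rw [enorm_qsMul_sq]; rfl

/-- Each component of `v` is a measurable, periodic, square integrable function. -/
structure IsNice (v : ℝ → E n) : Prop where
  meas : Measurable v
  periodic : Function.Periodic v (2 * π)
  memLp : ∀ i, MemLp (fun x => (v x i : ℂ)) 2 (volume.restrict circ)

lemma IsNice.meas_comp {v : ℝ → E n} (hv : IsNice v) (i : Fin n) :
    Measurable fun x => (v x i : ℂ) := by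
  have := hv.meas
  fun_prop

lemma IsNice.periodic_comp {v : ℝ → E n} (hv : IsNice v) (i : Fin n) :
    Function.Periodic (fun x => (v x i : ℂ)) (2 * π) := fun x => by
  simp only [hv.periodic x]

lemma gagl_eq {v : ℝ → E n} (hp : Function.Periodic v (2 * π)) (x : ℝ) : gagl v x
    = ∫ h in circ, (∑ i, (v x i - v (x - h) i) ^ 2) / (4 * Real.sin (h / 2) ^ 2) := by
  rw [gagl, integral_circ_reflect (x := x)]
  · simp_rw [cd_sub_sq]
  · intro y
    have := cd_periodic x y
    simp only at this
    simp only [hp y, this]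

lemma enorm_sq_mul_gKer (a b h : ℝ) : ‖(a : ℂ) - (b : ℂ)‖ₑ ^ 2 * gKer h
    = ENNReal.ofReal ((a - b) ^ 2 / (4 * Real.sin (h / 2) ^ 2)) := by
  rw [gKer, ← Complex.ofReal_sub, ← ofReal_norm, Complex.norm_real,
    ← ENNReal.ofReal_pow (norm_nonneg _), ← ENNReal.ofReal_mul (by positivity), Real.norm_eq_abs,
    sq_abs, mul_one_div]

lemma enorm_sum_sq_div (a b : Fin n → ℝ) (h : ℝ) :
    ‖(∑ i, (a i - b i) ^ 2) / (4 * Real.sin (h / 2) ^ 2)‖ₑ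
      = ∑ i, ‖(a i : ℂ) - (b i : ℂ)‖ₑ ^ 2 * gKer h := by
  have h0 : 0 ≤ ∑ i, (a i - b i) ^ 2 := Finset.sum_nonneg fun i _ => sq_nonneg _
  rw [← ofReal_norm, Real.norm_of_nonneg (by positivity), Finset.sum_div,
    ENNReal.ofReal_sum_of_nonneg fun i _ => by positivity]
  exact Finset.sum_congr rfl fun i _ => (enorm_sq_mul_gKer _ _ _).symm

/-- The Gagliardo density of a component. -/
def gSq (v : ℝ → E n) (i : Fin n) (x h : ℝ) : ℝ≥0∞ :=
  ‖(v x i : ℂ) - (v (x - h) i : ℂ)‖ₑ ^ 2 * gKer h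

lemma measurable_gSq {v : ℝ → E n} (hv : IsNice v) (i : Fin n) :
    Measurable (Function.uncurry (gSq v i)) :=
  ((measurable_diff (hv.meas_comp i)).enorm.pow_const 2).mul (measurable_gKer.comp measurable_snd)

lemma lintegral_gSq {v : ℝ → E n} (hv : IsNice v) (i : Fin n) :
    ∫⁻ x in circ, ∫⁻ h in circ, gSq v i x h
      = ENNReal.ofReal (2 * π) ^ 2 * ∑' k, ‖qsMul (fun k => fcV v k i) k‖ₑ ^ 2 :=
  lintegral_gagliardo (hv.meas_comp i) (hv.periodic_comp i) (hv.memLp i)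

lemma enorm_gagl_le {v : ℝ → E n} (hv : IsNice v) (x : ℝ) :
    ‖gagl v x‖ₑ ≤ ∑ i, ∫⁻ h in circ, gSq v i x h := by
  have hm : ∀ i ∈ Finset.univ, Measurable (gSq v i x) :=
    fun i _ => (measurable_gSq hv i).of_uncurry_left
  rw [gagl_eq hv.periodic, ← lintegral_finsetSum _ hm]
  refine (enorm_integral_le_lintegral_enorm _).trans (lintegral_mono fun h => ?_)
  exact (enorm_sum_sq_div (v x) (v (x - h)) h).le

lemma lintegral_gagl_le {v : ℝ → E n} (hv : IsNice v) :
    ∫⁻ x in circ, ‖gagl v x‖ₑ ≤ ENNReal.ofReal (2 * π) ^ 2 * hHalf v := by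
  refine (lintegral_mono fun x => enorm_gagl_le hv x).trans (le_of_eq ?_)
  have hm : ∀ i ∈ Finset.univ, Measurable fun x => ∫⁻ h in circ, gSq v i x h :=
    fun i _ => (measurable_gSq hv i).lintegral_prod_right'
  rw [lintegral_finsetSum _ hm, hHalf_eq, Finset.mul_sum]
  exact Finset.sum_congr rfl fun i _ => lintegral_gSq hv i

/-- The real character `Re (ζ e^{-ikx})`. -/
def chr (k : ℤ) (ζ : ℂ) (x : ℝ) : ℝ := (ζ * Complex.exp (-(Complex.I * (k : ℂ) * (x : ℂ)))).re

lemma chr_contDiff (k : ℤ) (ζ : ℂ) : ContDiff ℝ (⊤ : ℕ∞) (chr k ζ) := by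
  have h : ContDiff ℝ (⊤ : ℕ∞) (fun x : ℝ => ζ * Complex.exp (-(Complex.I * (k : ℂ) * (x : ℂ)))) := by
    have : ContDiff ℝ (⊤ : ℕ∞) (fun x : ℝ => (x : ℂ)) := Complex.ofRealCLM.contDiff
    fun_prop
  exact Complex.reCLM.contDiff.comp h

lemma continuous_chr (k : ℤ) (ζ : ℂ) : Continuous (chr k ζ) := (chr_contDiff k ζ).continuous

lemma abs_chr_le (k : ℤ) (ζ : ℂ) (x : ℝ) : |chr k ζ x| ≤ ‖ζ‖ := by
  refine (Complex.abs_re_le_norm _).trans ?_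
  rw [norm_mul, norm_exp_neg, mul_one]

lemma exp_shift (k : ℤ) (x h : ℝ) : Complex.exp (-(Complex.I * (k : ℂ) * ((x - h : ℝ) : ℂ)))
    = Complex.exp (-(Complex.I * (k : ℂ) * (x : ℂ))) * Complex.exp (Complex.I * (k : ℂ) * (h : ℂ)) := by
  rw [← Complex.exp_add]; congr 1; push_cast; ring

lemma chr_sub_chr (k : ℤ) (ζ : ℂ) (x h : ℝ) :
    chr k ζ x - chr k ζ (x - h) = chr k (ζ * (1 - Complex.exp (Complex.I * (k : ℂ) * (h : ℂ)))) x := by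
  rw [chr, chr, chr, exp_shift, ← Complex.sub_re]
  congr 1; ring

lemma chr_periodic (k : ℤ) (ζ : ℂ) : Function.Periodic (chr k ζ) (2 * π) := by
  intro y
  simp only [chr]
  congr 2
  rw [Complex.exp_eq_exp_iff_exists_int]
  exact ⟨-k, by push_cast; ring⟩

lemma integral_mul_chr {F : ℝ → ℝ} (hF : IntegrableOn F circ) (k : ℤ) (ζ : ℂ) :
    ∫ x in circ, F x * chr k ζ x = 2 * π * (ζ * fcR F k).re := by
  have hi : IntegrableOn (fun x => (F x : ℂ) * Complex.exp (-(Complex.I * (k : ℂ) * (x : ℂ)))) circ := by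
    refine (hF.ofReal (𝕜 := ℂ)).mul_bdd (c := 1) (continuous_exp_neg k).aestronglyMeasurable
      (ae_of_all _ fun x => (norm_exp_neg k x).le)
  have e : ∀ x, F x * chr k ζ x
      = (ζ * ((F x : ℂ) * Complex.exp (-(Complex.I * (k : ℂ) * (x : ℂ))))).re := by
    intro x
    rw [chr, ← Complex.re_ofReal_mul]; congr 1; ring
  simp_rw [e]
  have h := integral_re (𝕜 := ℂ) (hi.const_mul ζ)
  simp only [RCLike.re_to_complex] at h
  rw [h, integral_const_mul, fcR, fc]
  have hπ : (π : ℂ) ≠ 0 := by exact_mod_cast pi_ne_zero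
  rw [show (2 : ℝ) * π = ((2 * π : ℝ)) from rfl, ← Complex.re_ofReal_mul]
  congr 1
  push_cast
  field_simp

lemma norm_one_sub_exp_pos_neg (k : ℤ) (h : ℝ) :
    (1 - Complex.exp (Complex.I * (k : ℂ) * (h : ℂ)))
      * (1 - Complex.exp (-(Complex.I * (k : ℂ) * (h : ℂ))))
      = ((‖1 - Complex.exp (-(Complex.I * (k : ℂ) * (h : ℂ)))‖ ^ 2 : ℝ) : ℂ) := by
  rw [← Complex.normSq_eq_norm_sq, Complex.normSq_eq_conj_mul_self, map_sub, ← Complex.exp_conj]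
  simp only [map_one, map_neg, map_mul, Complex.conj_I, map_intCast, Complex.conj_ofReal]
  ring_nf

section

variable {n : ℕ}

/-- The integrand of the pairing of a component of `v` with a character. -/
def pairInt (v : ℝ → E n) (i : Fin n) (k : ℤ) (ζ : ℂ) (x h : ℝ) : ℝ :=
  (v x i - v (x - h) i) * (chr k ζ x - chr k ζ (x - h)) / (4 * Real.sin (h / 2) ^ 2)

lemma measurable_pairInt {v : ℝ → E n} (hv : IsNice v) (i : Fin n) (k : ℤ) (ζ : ℂ) :
    Measurable (Function.uncurry (pairInt v i k ζ)) := by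
  have hfm : Measurable fun x => v x i := by have := hv.meas; fun_prop
  have h1 := measurable_diff hfm
  have h2 := measurable_diff (continuous_chr k ζ).measurable
  exact (h1.mul h2).div (by fun_prop)

lemma enorm_chr_sub_chr_le (k : ℤ) (ζ : ℂ) (x h : ℝ) : ‖chr k ζ x - chr k ζ (x - h)‖ₑ
    ≤ ‖ζ‖ₑ * ‖1 - Complex.exp (-(Complex.I * (k : ℂ) * (h : ℂ)))‖ₑ := by
  have hn : ‖1 - Complex.exp (Complex.I * (k : ℂ) * (h : ℂ))‖
      = ‖1 - Complex.exp (-(Complex.I * (k : ℂ) * (h : ℂ)))‖ := by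
    rw [← RCLike.norm_conj, map_sub, ← Complex.exp_conj]
    simp only [map_one, map_mul, Complex.conj_I, map_intCast, Complex.conj_ofReal]
    ring_nf
  rw [chr_sub_chr, ← enorm_mul, ← ofReal_norm, ← ofReal_norm]
  refine ENNReal.ofReal_le_ofReal ((abs_chr_le _ _ _).trans ?_)
  rw [norm_mul, norm_mul, hn]

lemma enorm_pairInt_le (v : ℝ → E n) (i : Fin n) (k : ℤ) (ζ : ℂ) (x h : ℝ) :
    ‖pairInt v i k ζ x h‖ₑ ≤ gSq v i x h
      + ‖ζ‖ₑ ^ 2 * (‖1 - Complex.exp (-(Complex.I * (k : ℂ) * (h : ℂ)))‖ₑ ^ 2 * gKer h) := by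
  have hv' : ‖v x i - v (x - h) i‖ₑ = ‖(v x i : ℂ) - (v (x - h) i : ℂ)‖ₑ := by
    rw [← Complex.ofReal_sub, ← ofReal_norm, ← ofReal_norm, Complex.norm_real]
  have hk : ‖(4 * Real.sin (h / 2) ^ 2)⁻¹‖ₑ = gKer h := by
    rw [gKer, ← ofReal_norm, Real.norm_of_nonneg (by positivity), one_div]
  have h1 := ENNReal.mul_le_weighted_sq ‖(v x i : ℂ) - (v (x - h) i : ℂ)‖ₑ
    (‖ζ‖ₑ * ‖1 - Complex.exp (-(Complex.I * (k : ℂ) * (h : ℂ)))‖ₑ) one_ne_zero ENNReal.one_ne_top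
  rw [inv_one, one_mul, one_mul] at h1
  rw [pairInt, div_eq_mul_inv, enorm_mul, enorm_mul, hk, hv', gSq, ← mul_assoc (‖ζ‖ₑ ^ 2),
    ← mul_pow, ← add_mul]
  gcongr
  exact (mul_le_mul_right (enorm_chr_sub_chr_le k ζ x h) _).trans h1

lemma tsum_qsMul_le_hHalf (v : ℝ → E n) (i : Fin n) :
    ∑' k, ‖qsMul (fun k => fcV v k i) k‖ₑ ^ 2 ≤ hHalf v := by
  rw [hHalf_eq]
  exact Finset.single_le_sum (f := fun i => ∑' k, ‖qsMul (fun k => fcV v k i) k‖ₑ ^ 2)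
    (fun _ _ => zero_le) (Finset.mem_univ i)

lemma integrable_pairInt {v : ℝ → E n} (hv : IsNice v) (hH : hHalf v < ⊤) (i : Fin n) (k : ℤ)
    (ζ : ℂ) : Integrable (Function.uncurry (pairInt v i k ζ))
      ((volume.restrict circ).prod (volume.restrict circ)) := by
  refine ⟨(measurable_pairInt hv i k ζ).aestronglyMeasurable, ?_⟩
  rw [HasFiniteIntegral, lintegral_prod _ (measurable_pairInt hv i k ζ).enorm.aemeasurable]
  refine lt_of_le_of_lt (lintegral_mono fun x => lintegral_mono fun h =>
    enorm_pairInt_le v i k ζ x h) ?_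
  have e1 : ∀ x, ∫⁻ h in circ, (gSq v i x h
        + ‖ζ‖ₑ ^ 2 * (‖1 - Complex.exp (-(Complex.I * (k : ℂ) * (h : ℂ)))‖ₑ ^ 2 * gKer h))
      = (∫⁻ h in circ, gSq v i x h)
        + ‖ζ‖ₑ ^ 2 * (ENNReal.ofReal (2 * π) * k.natAbs) := by
    intro x
    have hm3 : Measurable (gSq v i x) := (measurable_gSq hv i).of_uncurry_left
    rw [lintegral_add_left hm3, lintegral_const_mul' _ _ (by finiteness), lintegral_fejer']
  have hm4 : Measurable fun x => ∫⁻ h in circ, gSq v i x h :=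
    (measurable_gSq hv i).lintegral_prod_right'
  simp_rw [e1]
  rw [lintegral_add_left hm4, lintegral_gSq hv i, lintegral_const]
  have h2 : ∑' k, ‖qsMul (fun k => fcV v k i) k‖ₑ ^ 2 ≠ ⊤ :=
    ne_top_of_le_ne_top hH.ne (tsum_qsMul_le_hHalf v i)
  have h3 : (volume.restrict circ) Set.univ ≠ ⊤ := measure_ne_top _ _
  exact lt_top_iff_ne_top.2 (by finiteness)

lemma integral_pairInt_left {v : ℝ → E n} (hv : IsNice v) (i : Fin n) (k : ℤ) (ζ : ℂ) (h : ℝ) :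
    ∫ x in circ, pairInt v i k ζ x h
      = (2 * π * (ζ * fcV v k i).re) *
        (‖1 - Complex.exp (-(Complex.I * (k : ℂ) * (h : ℂ)))‖ ^ 2 / (4 * Real.sin (h / 2) ^ 2)) := by
  have hi1 : IntegrableOn (fun x => v x i - v (x - h) i) circ := by
    have := (((hv.memLp i).sub (MemLp.comp_shift (hv.meas_comp i) (hv.periodic_comp i)
      (hv.memLp i) h)).integrable one_le_two).re
    refine this.congr (ae_of_all _ fun x => ?_)
    simp
  have e : fcR (fun x => v x i - v (x - h) i) k
      = (1 - Complex.exp (-(Complex.I * (k : ℂ) * (h : ℂ)))) * fcV v k i := by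
    rw [fcV_def, ← fc_sub_shift (hv.meas_comp i) (hv.periodic_comp i) (hv.memLp i), fcR]
    simp
  simp only [pairInt]
  rw [integral_div]
  simp_rw [chr_sub_chr]
  rw [integral_mul_chr hi1, e, mul_div_assoc']
  congr 1
  rw [show ζ * (1 - Complex.exp (Complex.I * (k : ℂ) * (h : ℂ))) *
    ((1 - Complex.exp (-(Complex.I * (k : ℂ) * (h : ℂ)))) * fcV v k i)
    = ((1 - Complex.exp (Complex.I * (k : ℂ) * (h : ℂ)))
    * (1 - Complex.exp (-(Complex.I * (k : ℂ) * (h : ℂ))))) * (ζ * fcV v k i) by ring,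
    norm_one_sub_exp_pos_neg, Complex.re_ofReal_mul]
  ring

/-- The pairing of a component of `v` with a character. -/
lemma pairing_chr {v : ℝ → E n} (hv : IsNice v) (hH : hHalf v < ⊤) (i : Fin n) (k : ℤ) (ζ : ℂ) :
    ∫ x in circ, ∫ y in circ, (v x i - v y i) * (chr k ζ x - chr k ζ y) / cd x y ^ 2
      = (2 * π) ^ 2 * k.natAbs * (ζ * fcV v k i).re := by
  have hrefl : ∀ x, ∫ y in circ, (v x i - v y i) * (chr k ζ x - chr k ζ y) / cd x y ^ 2
      = ∫ h in circ, pairInt v i k ζ x h := by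
    intro x
    rw [integral_circ_reflect (x := x)]
    · simp_rw [cd_sub_sq, pairInt]
    · intro y
      have h1 := cd_periodic x y
      simp only at h1
      simp only [hv.periodic y, chr_periodic k ζ y, h1]
  simp_rw [hrefl]
  rw [integral_integral_swap (integrable_pairInt hv hH i k ζ)]
  simp_rw [integral_pairInt_left hv i k ζ]
  rw [integral_const_mul, integral_fejer]
  ring

/-- The test vector field `θ Re (ζ e^{-ikx}) e_i`. -/
def chrVec (i : Fin n) (k : ℤ) (ζ : ℂ) (θ : ℝ) (x : ℝ) : E n :=
  EuclideanSpace.single i (θ * chr k ζ x)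

lemma chrVec_apply (i j : Fin n) (k : ℤ) (ζ : ℂ) (θ x : ℝ) :
    chrVec i k ζ θ x j = if j = i then θ * chr k ζ x else 0 := by
  simp [chrVec]

lemma sum_mul_chrVec (a : E n) (i : Fin n) (k : ℤ) (ζ : ℂ) (θ x : ℝ) :
    ∑ j, a j * chrVec i k ζ θ x j = θ * (a i * chr k ζ x) := by
  simp only [chrVec_apply, mul_ite, mul_zero]
  rw [Finset.sum_ite_eq' Finset.univ i, if_pos (Finset.mem_univ i)]
  ring

lemma pairing_chrVec {v : ℝ → E n} (hv : IsNice v) (hH : hHalf v < ⊤) (i : Fin n) (k : ℤ) (ζ : ℂ)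
    (θ : ℝ) : pairing v (chrVec i k ζ θ)
      = θ * ((2 * π) ^ 2 * k.natAbs * (ζ * fcV v k i).re) := by
  rw [← pairing_chr hv hH, pairing, ← integral_const_mul]
  congr 1; ext x
  rw [← integral_const_mul]
  congr 1; ext y
  have : ∀ j, (v x j - v y j) * (chrVec i k ζ θ x j - chrVec i k ζ θ y j)
      = if j = i then θ * ((v x j - v y j) * (chr k ζ x - chr k ζ y)) else 0 := by
    intro j
    rw [chrVec_apply, chrVec_apply]
    split_ifs <;> ring
  simp_rw [this]
  rw [Finset.sum_ite_eq' Finset.univ i, if_pos (Finset.mem_univ i), mul_div_assoc]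

end

/-- Smooth functions with compact support in `(0, T)`. -/
structure IsTimeTest (T : ℝ) (θ : ℝ → ℝ) : Prop where
  smooth : ContDiff ℝ (⊤ : ℕ∞) θ
  supp : ∃ a b : ℝ, 0 < a ∧ b < T ∧ ∀ t, t ∉ Set.Icc a b → θ t = 0

lemma isTimeTest_of_tsupport_subset {T : ℝ} {θ : ℝ → ℝ} (hT : 0 < T)
    (h1 : ContDiff ℝ (⊤ : ℕ∞) θ) (h2 : HasCompactSupport θ) (h3 : tsupport θ ⊆ Set.Ioo 0 T) :
    IsTimeTest T θ := by
  refine ⟨h1, ?_⟩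
  rcases (tsupport θ).eq_empty_or_nonempty with he | hne
  · refine ⟨T / 2, T / 2, by linarith, by linarith, fun t _ => ?_⟩
    exact image_eq_zero_of_notMem_tsupport (by simp [he])
  · obtain ⟨a, ha⟩ := h2.isCompact.exists_isLeast hne
    obtain ⟨b, hb⟩ := h2.isCompact.exists_isGreatest hne
    refine ⟨a, b, (h3 ha.1).1, (h3 hb.1).2, fun t ht => ?_⟩
    exact image_eq_zero_of_notMem_tsupport fun htt => ht ⟨ha.2 htt, hb.2 htt⟩

lemma ae_eq_zero_of_timeTest {T : ℝ} (hT : 0 < T) {f : ℝ → ℂ} (hf : IntegrableOn f (Set.Ioc 0 T))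
    (h : ∀ θ, IsTimeTest T θ → ∫ t in Set.Ioc 0 T, (θ t : ℂ) * f t = 0) :
    ∀ᵐ t ∂(volume.restrict (Set.Ioc 0 T)), f t = 0 := by
  have h0 : ∀ᵐ t, t ∈ Set.Ioo 0 T → f t = 0 := by
    refine isOpen_Ioo.ae_eq_zero_of_integral_contDiff_smul_eq_zero
      (hf.mono_set Set.Ioo_subset_Ioc_self).locallyIntegrableOn fun θ h1 h2 h3 => ?_
    have h4 := h θ (isTimeTest_of_tsupport_subset hT h1 h2 h3)
    rw [setIntegral_eq_integral_of_forall_compl_eq_zero] at h4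
    · simpa [Complex.real_smul] using h4
    · intro t ht
      rw [image_eq_zero_of_notMem_tsupport fun htt => ht (Set.Ioo_subset_Ioc_self (h3 htt))]
      simp
  rw [← restrict_Ioo_eq_restrict_Ioc, ae_restrict_iff' measurableSet_Ioo]
  exact h0

lemma exists_timeTest_integral_eq_one {T : ℝ} (hT : 0 < T) :
    ∃ ρ, IsTimeTest T ρ ∧ ∫ t in Set.Ioc 0 T, ρ t = 1 := by
  let B : ContDiffBump (T / 2) := ⟨T / 8, T / 4, by linarith, by linarith⟩
  have hs : tsupport (B.normed volume) ⊆ Set.Ioo 0 T := by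
    rw [B.tsupport_normed_eq, Real.closedBall_eq_Icc]
    exact Set.Icc_subset_Ioo (by change 0 < T / 2 - T / 4; linarith)
      (by change T / 2 + T / 4 < T; linarith)
  refine ⟨B.normed volume, isTimeTest_of_tsupport_subset hT B.contDiff_normed
    B.hasCompactSupport_normed hs, ?_⟩
  rw [setIntegral_eq_integral_of_forall_compl_eq_zero, B.integral_normed]
  exact fun t ht => image_eq_zero_of_notMem_tsupport fun htt => ht (Set.Ioo_subset_Ioc_self (hs htt))

lemma IsTimeTest.continuous {T : ℝ} {θ : ℝ → ℝ} (h : IsTimeTest T θ) : Continuous θ :=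
  h.smooth.continuous

lemma IsTimeTest.eq_zero {T : ℝ} {θ : ℝ → ℝ} (h : IsTimeTest T θ) {t : ℝ}
    (ht : t ≤ 0 ∨ T ≤ t) : θ t = 0 := by
  obtain ⟨a, b, ha, hb, hs⟩ := h.supp
  refine hs t fun hh => ?_
  rcases ht with h1 | h1
  · linarith [hh.1]
  · linarith [hh.2]

lemma IsTimeTest.primitive {T : ℝ} (hT : 0 < T) {θ : ℝ → ℝ} (h : IsTimeTest T θ)
    (h0 : ∫ t in Set.Ioc 0 T, θ t = 0) : IsTimeTest T (fun t => ∫ s in (0 : ℝ)..t, θ s) := by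
  have hc := h.continuous
  have hd : ∀ t, HasDerivAt (fun t => ∫ s in (0 : ℝ)..t, θ s) (θ t) t := fun t =>
    intervalIntegral.integral_hasDerivAt_right (hc.intervalIntegrable _ _)
      hc.stronglyMeasurable.stronglyMeasurableAtFilter hc.continuousAt
  constructor
  · rw [contDiff_infty_iff_deriv]
    refine ⟨fun t => (hd t).differentiableAt, ?_⟩
    rw [show deriv (fun t => ∫ s in (0 : ℝ)..t, θ s) = θ from funext fun t => (hd t).deriv]
    exact h.smooth
  · obtain ⟨a, b, ha, hb, hs⟩ := h.supp
    rw [← intervalIntegral.integral_of_le hT.le] at h0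
    have hz : ∀ x y : ℝ, (∀ t ∈ Set.uIcc x y, t < a ∨ b < t) → ∫ t in x..y, θ t = 0 := by
      intro x y hxy
      rw [intervalIntegral.integral_congr (g := fun _ => (0 : ℝ)), intervalIntegral.integral_zero]
      intro t ht
      refine hs t fun hh => ?_
      rcases hxy t ht with h1 | h1
      · exact absurd hh.1 (not_le.2 h1)
      · exact absurd hh.2 (not_le.2 h1)
    refine ⟨a, b, ha, hb, fun t ht => ?_⟩
    rw [Set.mem_Icc, not_and_or, not_le, not_le] at ht
    rcases ht with ht | ht
    · refine hz 0 t fun s hs' => Or.inl ?_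
      exact lt_of_le_of_lt hs'.2 (max_lt ha ht)
    · rw [← intervalIntegral.integral_add_adjacent_intervals (hc.intervalIntegrable 0 T)
        (hc.intervalIntegrable T t), h0, zero_add]
      refine hz T t fun s hs' => Or.inr ?_
      exact lt_of_lt_of_le (lt_min hb ht) hs'.1

lemma IsTimeTest.deriv {T : ℝ} {θ : ℝ → ℝ} (h : IsTimeTest T θ) : IsTimeTest T (deriv θ) := by
  refine ⟨(contDiff_infty_iff_deriv.1 h.smooth).2, ?_⟩
  obtain ⟨a, b, ha, hb, hs⟩ := h.supp
  refine ⟨a, b, ha, hb, fun t ht => ?_⟩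
  have : θ =ᶠ[𝓝 t] fun _ => 0 := by
    filter_upwards [isClosed_Icc.isOpen_compl.mem_nhds ht] with s hs'
    exact hs s hs'
  rw [this.deriv_eq, deriv_const]

lemma IsTimeTest.integral_deriv_mul {T : ℝ} (hT : 0 < T) {θ : ℝ → ℝ} (h : IsTimeTest T θ)
    {g : ℝ → ℂ} (hg : IntegrableOn g (Set.Ioc 0 T)) :
    ∫ t in Set.Ioc 0 T, (((_root_.deriv θ t : ℝ) : ℂ) * ∫ s in (0 : ℝ)..t, g s)
      = - ∫ t in Set.Ioc 0 T, (θ t : ℂ) * g t := by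
  have hc : Continuous fun t => ((_root_.deriv θ t : ℝ) : ℂ) :=
    Complex.continuous_ofReal.comp h.deriv.continuous
  have hc' : Continuous fun t => (θ t : ℂ) := Complex.continuous_ofReal.comp h.continuous
  have hp : ∀ t, ∫ s in (0 : ℝ)..t, ((_root_.deriv θ s : ℝ) : ℂ) = θ t := by
    intro t
    rw [intervalIntegral.integral_ofReal, intervalIntegral.integral_deriv_eq_sub
      (fun s _ => (h.smooth.differentiable (by simp)).differentiableAt)
      (h.deriv.continuous.intervalIntegrable _ _), h.eq_zero (Or.inl le_rfl), sub_zero]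
  have h1 := primitive_mul_primitive hT.le ((hc.intervalIntegrable 0 T).1) hg 0 0
  simp only [hp, zero_add, mul_zero, sub_zero] at h1
  rw [h.eq_zero (Or.inr le_rfl), Complex.ofReal_zero, zero_mul] at h1
  have hi : IntegrableOn (fun t => (θ t : ℂ) * g t) (Set.Ioc 0 T) := by
    obtain ⟨C, hC⟩ := (isCompact_Icc (a := (0:ℝ)) (b := T)).exists_bound_of_continuousOn
      hc'.continuousOn
    refine Integrable.bdd_mul (c := C) hg hc'.aestronglyMeasurable ?_
    filter_upwards [ae_restrict_mem measurableSet_Ioc] with t ht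
    exact hC t (Set.Ioc_subset_Icc_self ht)
  have h2 := h1.1.sub hi
  have h3 := integral_add h2 hi
  simp only [Pi.sub_apply, add_sub_cancel_right] at h3
  rw [← h1.2] at h3
  exact eq_neg_of_add_eq_zero_left h3.symm

/-- The du Bois-Reymond lemma. -/
lemma exists_ae_eq_const_add_primitive {T : ℝ} (hT : 0 < T) {f g : ℝ → ℂ}
    (hf : IntegrableOn f (Set.Ioc 0 T)) (hg : IntegrableOn g (Set.Ioc 0 T))
    (h : ∀ θ, IsTimeTest T θ → ∫ t in Set.Ioc 0 T, ((deriv θ t : ℝ) : ℂ) * f t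
      = - ∫ t in Set.Ioc 0 T, (θ t : ℂ) * g t) :
    ∃ c : ℂ, ∀ᵐ t ∂(volume.restrict (Set.Ioc 0 T)), f t = c + ∫ s in (0 : ℝ)..t, g s := by
  have hprim : IntegrableOn (fun t => ∫ s in (0 : ℝ)..t, g s) (Set.Ioc 0 T) := by
    refine IntegrableOn.mono_set (ContinuousOn.integrableOn_Icc ?_) Set.Ioc_subset_Icc_self
    have := intervalIntegral.continuousOn_primitive_interval (a := 0) (b := T) (f := g)
      (μ := volume) (((integrableOn_Icc_iff_integrableOn_Ioc (by finiteness)).2 hg).mono_set (by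
        rw [Set.uIcc_of_le hT.le]))
    rwa [Set.uIcc_of_le hT.le] at this
  have hF : IntegrableOn (fun t => f t - ∫ s in (0 : ℝ)..t, g s) (Set.Ioc 0 T) := hf.sub hprim
  obtain ⟨ρ, hρ, hρ1⟩ := exists_timeTest_integral_eq_one hT
  have hmul : ∀ θ, IsTimeTest T θ → ∀ F : ℝ → ℂ, IntegrableOn F (Set.Ioc 0 T) →
      IntegrableOn (fun t => (θ t : ℂ) * F t) (Set.Ioc 0 T) := by
    intro θ hθ F hF
    have hc' : Continuous fun t => (θ t : ℂ) := Complex.continuous_ofReal.comp hθ.continuous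
    obtain ⟨C, hC⟩ := (isCompact_Icc (a := (0:ℝ)) (b := T)).exists_bound_of_continuousOn
      hc'.continuousOn
    refine Integrable.bdd_mul (c := C) hF hc'.aestronglyMeasurable ?_
    filter_upwards [ae_restrict_mem measurableSet_Ioc] with t ht
    exact hC t (Set.Ioc_subset_Icc_self ht)
  set F : ℝ → ℂ := fun t => f t - ∫ s in (0 : ℝ)..t, g s with hFdef
  have hweak : ∀ θ, IsTimeTest T θ → ∫ t in Set.Ioc 0 T, ((deriv θ t : ℝ) : ℂ) * F t = 0 := by
    intro θ hθ
    simp only [hFdef, mul_sub]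
    rw [integral_sub (hmul _ hθ.deriv _ hf) (hmul _ hθ.deriv _ hprim), h θ hθ,
      hθ.integral_deriv_mul hT hg, sub_self]
  set c : ℂ := ∫ t in Set.Ioc 0 T, (ρ t : ℂ) * F t with hc
  refine ⟨c, ?_⟩
  have hcint : IntegrableOn (fun _ : ℝ => c) (Set.Ioc 0 T) := by simp
  have key : ∀ᵐ t ∂(volume.restrict (Set.Ioc 0 T)), F t - c = 0 := by
    refine ae_eq_zero_of_timeTest hT (hF.sub hcint) fun η hη => ?_
    set m : ℝ := ∫ t in Set.Ioc 0 T, η t with hm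
    have iη : IntegrableOn η (Set.Ioc 0 T) := (hη.continuous.intervalIntegrable 0 T).1
    have iρ : IntegrableOn ρ (Set.Ioc 0 T) := (hρ.continuous.intervalIntegrable 0 T).1
    have hψ : IsTimeTest T (fun t => η t - m * ρ t) := by
      refine ⟨hη.smooth.sub (contDiff_const.mul hρ.smooth), ?_⟩
      obtain ⟨a, b, ha, hb, hs⟩ := hη.supp
      obtain ⟨a', b', ha', hb', hs'⟩ := hρ.supp
      refine ⟨min a a', max b b', lt_min ha ha', max_lt hb hb', fun t ht => ?_⟩
      rw [hs t fun hh => ht ⟨(min_le_left _ _).trans hh.1, hh.2.trans (le_max_left _ _)⟩,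
        hs' t fun hh => ht ⟨(min_le_right _ _).trans hh.1, hh.2.trans (le_max_right _ _)⟩]
      simp
    have hψ0 : ∫ t in Set.Ioc 0 T, (η t - m * ρ t) = 0 := by
      rw [integral_sub iη (iρ.const_mul m), integral_const_mul, hρ1]
      simp [hm]
    have hd : ∀ t, deriv (fun t => ∫ s in (0 : ℝ)..t, (η s - m * ρ s)) t = η t - m * ρ t :=
      fun t => (intervalIntegral.integral_hasDerivAt_right
        (hψ.continuous.intervalIntegrable _ _)
        hψ.continuous.stronglyMeasurable.stronglyMeasurableAtFilter
        hψ.continuous.continuousAt).deriv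
    have h1 := hweak _ (hψ.primitive hT hψ0)
    simp only [hd] at h1
    have e1 : ∀ t, ((η t - m * ρ t : ℝ) : ℂ) * F t
        = (η t : ℂ) * F t - (m : ℂ) * ((ρ t : ℂ) * F t) := by intro t; push_cast; ring
    simp_rw [e1] at h1
    rw [integral_sub (hmul _ hη _ hF) ((hmul _ hρ _ hF).const_mul _), integral_const_mul] at h1
    simp_rw [mul_sub]
    rw [integral_sub (hmul _ hη _ hF) (hmul _ hη _ hcint), integral_mul_const,
      integral_complex_ofReal]
    exact h1
  filter_upwards [key] with t ht
  rw [← sub_eq_zero, ← ht]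
  ring

section

variable {n : ℕ} {T : ℝ}

/-- Square integrable maps on `(0, T] × S¹`. -/
structure IsL2 (T : ℝ) (v : ℝ → ℝ → E n) : Prop where
  meas : Measurable (Function.uncurry v)
  fin : ∫⁻ t in Set.Ioc 0 T, ∫⁻ x in circ, ‖v t x‖ₑ ^ 2 ≠ ⊤

lemma enorm_comp_le (a : E n) (i : Fin n) : ‖(a i : ℂ)‖ₑ ≤ ‖a‖ₑ := by
  rw [← ofReal_norm, ← ofReal_norm, Complex.norm_real]
  exact ENNReal.ofReal_le_ofReal (PiLp.norm_apply_le a i)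

lemma memLp_two_comp {v : ℝ → E n} (hv : Measurable v) (h : ∫⁻ x in circ, ‖v x‖ₑ ^ 2 ≠ ⊤)
    (i : Fin n) : MemLp (fun x => (v x i : ℂ)) 2 (volume.restrict circ) := by
  have hm : Measurable fun x => (v x i : ℂ) := by fun_prop
  refine memLp_two_of_lintegral hm.aestronglyMeasurable
    (ne_top_of_le_ne_top h (lintegral_mono fun x => ?_))
  exact pow_le_pow_left' (enorm_comp_le _ _) 2

lemma tsum_fcV_le {v : ℝ → E n} (hv : Measurable v) (h : ∫⁻ x in circ, ‖v x‖ₑ ^ 2 ≠ ⊤)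
    (i : Fin n) : ENNReal.ofReal (2 * π) * ∑' k, ‖fcV v k i‖ₑ ^ 2
      ≤ ∫⁻ x in circ, ‖v x‖ₑ ^ 2 := by
  refine (lintegral_parseval (memLp_two_comp hv h i)).symm.le.trans (lintegral_mono fun x => ?_)
  exact pow_le_pow_left' (enorm_comp_le _ _) 2

lemma ofReal_two_pi_ne_zero : ENNReal.ofReal (2 * π) ≠ 0 := by
  rw [Ne, ENNReal.ofReal_eq_zero, not_le]; exact two_pi_pos

namespace IsL2

variable {v : ℝ → ℝ → E n}

lemma measurable_slice (hv : IsL2 T v) (t : ℝ) : Measurable (v t) := hv.meas.of_uncurry_left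

lemma ae_fin (hv : IsL2 T v) :
    ∀ᵐ t ∂(volume.restrict (Set.Ioc 0 T)), ∫⁻ x in circ, ‖v t x‖ₑ ^ 2 ≠ ⊤ := by
  have hm : Measurable fun t => ∫⁻ x in circ, ‖v t x‖ₑ ^ 2 :=
    (hv.meas.enorm.pow_const 2).lintegral_prod_right'
  filter_upwards [ae_lt_top hm hv.fin] with t ht using ht.ne

lemma ae_memLp (hv : IsL2 T v) : ∀ᵐ t ∂(volume.restrict (Set.Ioc 0 T)),
    ∀ i, MemLp (fun x => (v t x i : ℂ)) 2 (volume.restrict circ) := by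
  filter_upwards [hv.ae_fin] with t ht i
  exact memLp_two_comp (hv.measurable_slice t) ht i

lemma measurable_comp (hv : IsL2 T v) (i : Fin n) :
    Measurable fun p : ℝ × ℝ => v p.1 p.2 i := by
  have := hv.meas
  have h : Measurable fun p : ℝ × ℝ => Function.uncurry v p i := by fun_prop
  exact h

lemma measurable_fcR_slice {F : ℝ × ℝ → ℝ} (hF : Measurable F) (k : ℤ) :
    Measurable fun t => fcR (fun x => F (t, x)) k := by
  have hm : StronglyMeasurable fun p : ℝ × ℝ =>
      (F p : ℂ) * Complex.exp (-(Complex.I * (k : ℂ) * (p.2 : ℂ))) := by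
    apply Measurable.stronglyMeasurable
    fun_prop
  exact (hm.integral_prod_right' (ν := volume.restrict circ)).measurable.const_mul _

lemma measurable_fcV (hv : IsL2 T v) (k : ℤ) (i : Fin n) : Measurable fun t => fcV (v t) k i :=
  measurable_fcR_slice (hv.measurable_comp i) k

lemma lintegral_tsum_fcV (hv : IsL2 T v) (i : Fin n) :
    ∫⁻ t in Set.Ioc 0 T, ∑' k, ‖fcV (v t) k i‖ₑ ^ 2 ≠ ⊤ := by
  have h : ∫⁻ t in Set.Ioc 0 T, ENNReal.ofReal (2 * π) * ∑' k, ‖fcV (v t) k i‖ₑ ^ 2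
      ≤ ∫⁻ t in Set.Ioc 0 T, ∫⁻ x in circ, ‖v t x‖ₑ ^ 2 := by
    refine lintegral_mono_ae ?_
    filter_upwards [hv.ae_fin] with t ht
    exact tsum_fcV_le (hv.measurable_slice t) ht i
  rw [lintegral_const_mul' _ _ (by finiteness)] at h
  intro htop
  rw [htop, ENNReal.mul_top ofReal_two_pi_ne_zero] at h
  exact hv.fin (top_le_iff.1 h)

lemma integrableOn_fcV (hv : IsL2 T v) (k : ℤ) (i : Fin n) :
    IntegrableOn (fun t => fcV (v t) k i) (Set.Ioc 0 T) := by
  have h : MemLp (fun t => fcV (v t) k i) 2 (volume.restrict (Set.Ioc 0 T)) := by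
    refine memLp_two_of_lintegral (hv.measurable_fcV k i).aestronglyMeasurable
      (ne_top_of_le_ne_top (hv.lintegral_tsum_fcV i) (lintegral_mono fun t => ?_))
    exact ENNReal.le_tsum k
  exact h.integrable one_le_two

end IsL2

/-- The hypotheses on a weak solution of the half-harmonic gradient flow. -/
structure IsFlow (T : ℝ) (u₀ : ℝ → E n) (u w : ℝ → ℝ → E n) : Prop where
  pos : 0 < T
  meas₀ : Measurable u₀
  periodic₀ : Function.Periodic u₀ (2 * π)
  sphere₀ : ∀ x, ‖u₀ x‖ = 1
  energy₀ : hHalf u₀ < ⊤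
  meas : Measurable (Function.uncurry u)
  wL2 : IsL2 T w
  periodic : ∀ t, Function.Periodic (u t) (2 * π)
  sphere : ∀ᵐ p ∂((volume.restrict (Set.Ioc (0 : ℝ) T)).prod (volume.restrict circ)),
    ‖u p.1 p.2‖ = 1
  sob : (∫⁻ t in Set.Ioc (0 : ℝ) T, hSob 1 (u t)) < ⊤
  ae_sob : ∀ᵐ t ∂(volume.restrict (Set.Ioc (0 : ℝ) T)), hSob 1 (u t) < ⊤
  weak : ∀ φ : ℝ → ℝ → E n, IsSTTestOn n T φ →
    (∫ t in Set.Ioc (0 : ℝ) T, ∫ x in circ, ∑ i, u t x i * deriv (fun s => φ s x i) t)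
      = - ∫ t in Set.Ioc (0 : ℝ) T, ∫ x in circ, ∑ i, w t x i * φ t x i
  flow : ∀ φ : ℝ → ℝ → E n, IsSTTestOn n T φ →
    (∫ t in Set.Ioc (0 : ℝ) T, ∫ x in circ, ∑ i, w t x i * φ t x i)
      + (∫ t in Set.Ioc (0 : ℝ) T, pairing (u t) (φ t))
      = ∫ t in Set.Ioc (0 : ℝ) T, ∫ x in circ, gagl (u t) x * ∑ i, u t x i * φ t x i
  init : Tendsto (fun t => ∫⁻ x in circ, (‖u t x - u₀ x‖₊ : ℝ≥0∞) ^ 2)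
    (nhdsWithin 0 (Set.Ioi 0)) (nhds 0)
  decay : ∀ᵐ t ∂(volume.restrict (Set.Ioc (0 : ℝ) T)), hHalf (u t) ≤ hHalf u₀

lemma lintegral_circ_of_norm_eq_one {v : ℝ → E n} (h : ∀ᵐ x ∂(volume.restrict circ), ‖v x‖ = 1) :
    ∫⁻ x in circ, ‖v x‖ₑ ^ 2 = ENNReal.ofReal (2 * π) := by
  have : ∫⁻ x in circ, ‖v x‖ₑ ^ 2 = ∫⁻ x in circ, 1 := by
    refine lintegral_congr_ae ?_
    filter_upwards [h] with x hx
    rw [← ofReal_norm, hx]; simp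
  rw [this, lintegral_one, Measure.restrict_apply_univ, volume_circ]

lemma isNice_of_norm_eq_one {v : ℝ → E n} (hm : Measurable v)
    (hp : Function.Periodic v (2 * π)) (h : ∀ᵐ x ∂(volume.restrict circ), ‖v x‖ = 1) :
    IsNice v :=
  ⟨hm, hp, memLp_two_comp hm (by rw [lintegral_circ_of_norm_eq_one h]; finiteness)⟩

lemma isSTTestOn_chrVec {θ : ℝ → ℝ} (hθ : IsTimeTest T θ) (i : Fin n) (k : ℤ) (ζ : ℂ) :
    IsSTTestOn n T (fun t => chrVec i k ζ (θ t)) := by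
  refine ⟨?_, fun t x => ?_, ?_⟩
  · rw [contDiff_euclidean]
    intro j
    simp only [chrVec_apply]
    by_cases hj : j = i
    · simp only [hj, if_true]
      exact (hθ.smooth.comp contDiff_fst).mul ((chr_contDiff k ζ).comp contDiff_snd)
    · simp only [hj, if_false]
      exact contDiff_const
  · simp only [chrVec, chr_periodic k ζ x]
  · obtain ⟨a, b, ha, hb, hs⟩ := hθ.supp
    refine ⟨a, b, ha, hb, fun t ht x => ?_⟩
    simp [chrVec, hs t ht]

lemma deriv_chrVec {θ : ℝ → ℝ} (hθ : IsTimeTest T θ) (i j : Fin n) (k : ℤ) (ζ : ℂ) (t x : ℝ) :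
    deriv (fun s => chrVec i k ζ (θ s) x j) t = chrVec i k ζ (deriv θ t) x j := by
  simp only [chrVec_apply]
  split_ifs with h
  · exact deriv_mul_const ((hθ.smooth.differentiable (by simp)).differentiableAt) _
  · exact deriv_const _ _

lemma complex_eq_zero_of_re {z : ℂ} (h : ∀ ζ : ℂ, (ζ * z).re = 0) : z = 0 := by
  refine Complex.ext ?_ ?_
  · simpa using h 1
  · simpa using h (-Complex.I)

lemma IsTimeTest.integrableOn_mul {θ : ℝ → ℝ} (hθ : IsTimeTest T θ) {F : ℝ → ℂ}
    (hF : IntegrableOn F (Set.Ioc 0 T)) : IntegrableOn (fun t => (θ t : ℂ) * F t) (Set.Ioc 0 T) := by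
  have hc' : Continuous fun t => (θ t : ℂ) := Complex.continuous_ofReal.comp hθ.continuous
  obtain ⟨C, hC⟩ := (isCompact_Icc (a := (0:ℝ)) (b := T)).exists_bound_of_continuousOn
    hc'.continuousOn
  refine Integrable.bdd_mul (c := C) hF hc'.aestronglyMeasurable ?_
  filter_upwards [ae_restrict_mem measurableSet_Ioc] with t ht
  exact hC t (Set.Ioc_subset_Icc_self ht)

/-- Pull the real part out of a weighted integral. -/
lemma integral_mul_re {θ : ℝ → ℝ} (hθ : IsTimeTest T θ) {F : ℝ → ℂ}
    (hF : IntegrableOn F (Set.Ioc 0 T)) (ζ : ℂ) (c : ℝ) :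
    ∫ t in Set.Ioc 0 T, θ t * (c * (ζ * F t).re)
      = c * (ζ * ∫ t in Set.Ioc 0 T, (θ t : ℂ) * F t).re := by
  have h := integral_re (𝕜 := ℂ) ((hθ.integrableOn_mul hF).const_mul ζ)
  simp only [RCLike.re_to_complex] at h
  rw [← integral_const_mul ζ, ← h, ← integral_const_mul c]
  congr 1; ext t
  rw [show ζ * ((θ t : ℂ) * F t) = (θ t : ℂ) * (ζ * F t) by ring, Complex.re_ofReal_mul]
  ring

lemma integral_sum_mul_chrVec {v : ℝ → E n} {i : Fin n}
    (hv : IntegrableOn (fun x => v x i) circ) (k : ℤ) (ζ : ℂ) (θ : ℝ) :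
    ∫ x in circ, ∑ j, v x j * chrVec i k ζ θ x j = θ * (2 * π * (ζ * fcV v k i).re) := by
  simp_rw [sum_mul_chrVec]
  rw [integral_const_mul, integral_mul_chr hv]; rfl

lemma integrableOn_of_memLp_ofReal {f : ℝ → ℝ} (h : MemLp (fun x => (f x : ℂ)) 2 (volume.restrict circ)) :
    IntegrableOn f circ := by
  have := (h.integrable one_le_two).re
  exact this.congr (ae_of_all _ fun x => by simp)

namespace IsFlow

variable {u₀ : ℝ → E n} {u w : ℝ → ℝ → E n}

lemma ae_sphere (H : IsFlow T u₀ u w) : ∀ᵐ t ∂(volume.restrict (Set.Ioc 0 T)),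
    ∀ᵐ x ∂(volume.restrict circ), ‖u t x‖ = 1 := Measure.ae_ae_of_ae_prod H.sphere

lemma isNice₀ (H : IsFlow T u₀ u w) : IsNice u₀ :=
  isNice_of_norm_eq_one H.meas₀ H.periodic₀ (ae_of_all _ H.sphere₀)

lemma ae_isNice (H : IsFlow T u₀ u w) : ∀ᵐ t ∂(volume.restrict (Set.Ioc 0 T)), IsNice (u t) := by
  filter_upwards [H.ae_sphere] with t ht
  exact isNice_of_norm_eq_one H.meas.of_uncurry_left (H.periodic t) ht

lemma uL2 (H : IsFlow T u₀ u w) : IsL2 T u := by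
  refine ⟨H.meas, ?_⟩
  have : ∫⁻ t in Set.Ioc 0 T, ∫⁻ x in circ, ‖u t x‖ₑ ^ 2
      = ∫⁻ t in Set.Ioc 0 T, ENNReal.ofReal (2 * π) := by
    refine lintegral_congr_ae ?_
    filter_upwards [H.ae_sphere] with t ht using lintegral_circ_of_norm_eq_one ht
  rw [this, lintegral_const, Measure.restrict_apply_univ, Real.volume_Ioc]
  finiteness

lemma weak_fcV (H : IsFlow T u₀ u w) (k : ℤ) (i : Fin n) {θ : ℝ → ℝ} (hθ : IsTimeTest T θ) :
    ∫ t in Set.Ioc 0 T, ((deriv θ t : ℝ) : ℂ) * fcV (u t) k i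
      = - ∫ t in Set.Ioc 0 T, (θ t : ℂ) * fcV (w t) k i := by
  rw [eq_neg_iff_add_eq_zero]
  refine complex_eq_zero_of_re fun ζ => ?_
  have h := H.weak _ (isSTTestOn_chrVec hθ i k ζ)
  simp_rw [deriv_chrVec hθ] at h
  have e1 : ∫ t in Set.Ioc 0 T, ∫ x in circ, ∑ j, u t x j * chrVec i k ζ (deriv θ t) x j
      = ∫ t in Set.Ioc 0 T, deriv θ t * (2 * π * (ζ * fcV (u t) k i).re) := by
    refine integral_congr_ae ?_
    filter_upwards [H.uL2.ae_memLp] with t ht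
    exact integral_sum_mul_chrVec (integrableOn_of_memLp_ofReal (ht i)) _ _ _
  have e2 : ∫ t in Set.Ioc 0 T, ∫ x in circ, ∑ j, w t x j * chrVec i k ζ (θ t) x j
      = ∫ t in Set.Ioc 0 T, θ t * (2 * π * (ζ * fcV (w t) k i).re) := by
    refine integral_congr_ae ?_
    filter_upwards [H.wL2.ae_memLp] with t ht
    exact integral_sum_mul_chrVec (integrableOn_of_memLp_ofReal (ht i)) _ _ _
  rw [e1, e2, integral_mul_re hθ.deriv (H.uL2.integrableOn_fcV k i),
    integral_mul_re hθ (H.wL2.integrableOn_fcV k i), ← mul_neg] at h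
  have h' := mul_left_cancel₀ two_pi_pos.ne' h
  rw [mul_add, Complex.add_re, h', neg_add_cancel]

/-- The coefficients of the initial datum are attained. -/
lemma fcV_sub_le (H : IsFlow T u₀ u w) {t : ℝ} (ht : IsNice (u t)) (k : ℤ) (i : Fin n) :
    ENNReal.ofReal (2 * π) * ‖fcV (u t) k i - fcV u₀ k i‖ₑ ^ 2
      ≤ ∫⁻ x in circ, (‖u t x - u₀ x‖₊ : ℝ≥0∞) ^ 2 := by
  have hd : MemLp (fun x => (u t x i : ℂ) - (u₀ x i : ℂ)) 2 (volume.restrict circ) :=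
    (ht.memLp i).sub (H.isNice₀.memLp i)
  have h := lintegral_parseval hd
  have e : ∀ k, fc (fun x => (u t x i : ℂ) - (u₀ x i : ℂ)) k = fcV (u t) k i - fcV u₀ k i :=
    fun k => fc_sub ((ht.memLp i).integrable one_le_two)
      ((H.isNice₀.memLp i).integrable one_le_two) k
  simp_rw [e] at h
  calc ENNReal.ofReal (2 * π) * ‖fcV (u t) k i - fcV u₀ k i‖ₑ ^ 2
      ≤ ENNReal.ofReal (2 * π) * ∑' k, ‖fcV (u t) k i - fcV u₀ k i‖ₑ ^ 2 := by
        gcongr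
        exact ENNReal.le_tsum (f := fun k => ‖fcV (u t) k i - fcV u₀ k i‖ₑ ^ 2) k
    _ ≤ _ := by
        rw [← h]
        refine lintegral_mono fun x => pow_le_pow_left' ?_ 2
        change _ ≤ ‖u t x - u₀ x‖ₑ
        refine le_trans (le_of_eq ?_) (enorm_comp_le (u t x - u₀ x) i)
        simp

lemma frequently_of_ae {p : ℝ → Prop} (hT : 0 < T)
    (h : ∀ᵐ t ∂(volume.restrict (Set.Ioc 0 T)), p t) : ∃ᶠ t in 𝓝[>] (0 : ℝ), p t := by
  intro hn
  obtain ⟨δ, hδ, hs⟩ := mem_nhdsGT_iff_exists_Ioo_subset.1 hn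
  have hδ' : (0 : ℝ) < δ := hδ
  rw [ae_restrict_iff' measurableSet_Ioc] at h
  have h0 : volume (Set.Ioo 0 (min δ T)) = 0 := by
    refine measure_mono_null (fun t ht => ?_) h
    intro hh
    exact hs ⟨ht.1, ht.2.trans_le (min_le_left _ _)⟩
      (hh ⟨ht.1, (ht.2.trans_le (min_le_right _ _)).le⟩)
  rw [Real.volume_Ioo, sub_zero, ENNReal.ofReal_eq_zero] at h0
  exact absurd h0 (not_le.2 (lt_min hδ' hT))

lemma ae_fcV_eq_aux (H : IsFlow T u₀ u w) (k : ℤ) (i : Fin n) :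
    ∀ᵐ t ∂(volume.restrict (Set.Ioc 0 T)),
      fcV (u t) k i = fcV u₀ k i + ∫ r in (0 : ℝ)..t, fcV (w r) k i := by
  obtain ⟨c, hc⟩ := exists_ae_eq_const_add_primitive H.pos (H.uL2.integrableOn_fcV k i)
    (H.wL2.integrableOn_fcV k i) fun θ hθ => H.weak_fcV k i hθ
  have hcont : Tendsto (fun t => ∫ r in (0 : ℝ)..t, fcV (w r) k i) (𝓝[>] 0) (𝓝 0) := by
    have h1 := intervalIntegral.continuousOn_primitive_interval (a := 0) (b := T)
      (f := fun r => fcV (w r) k i) (μ := volume) (by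
        rw [Set.uIcc_of_le H.pos.le]
        exact (integrableOn_Icc_iff_integrableOn_Ioc (by finiteness)).2 (H.wL2.integrableOn_fcV k i))
    rw [Set.uIcc_of_le H.pos.le] at h1
    have h2 := (h1 0 ⟨le_rfl, H.pos.le⟩).mono_of_mem_nhdsWithin (s := Set.Ioi 0)
      (Icc_mem_nhdsGT H.pos)
    simpa [ContinuousWithinAt] using h2
  have hlim : Tendsto (fun t => ENNReal.ofReal (2 * π) *
      ‖(c + ∫ r in (0 : ℝ)..t, fcV (w r) k i) - fcV u₀ k i‖ₑ ^ 2) (𝓝[>] 0)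
      (𝓝 (ENNReal.ofReal (2 * π) * ‖c + 0 - fcV u₀ k i‖ₑ ^ 2)) := by
    refine ENNReal.Tendsto.const_mul ?_ (Or.inr ENNReal.ofReal_ne_top)
    exact ((ENNReal.continuous_pow 2).tendsto _).comp ((hcont.const_add c).sub_const _).enorm
  have hle : ∃ᶠ t in 𝓝[>] (0 : ℝ), ENNReal.ofReal (2 * π) *
      ‖(c + ∫ r in (0 : ℝ)..t, fcV (w r) k i) - fcV u₀ k i‖ₑ ^ 2
      ≤ ∫⁻ x in circ, (‖u t x - u₀ x‖₊ : ℝ≥0∞) ^ 2 := by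
    refine frequently_of_ae H.pos ?_
    filter_upwards [hc, H.ae_isNice] with t h1 h2
    rw [← h1]
    exact H.fcV_sub_le h2 k i
  have h0 := le_of_tendsto_of_tendsto_of_frequently hlim H.init hle
  have hcu : c = fcV u₀ k i := by
    have h1 := le_antisymm h0 bot_le
    rw [mul_eq_zero, or_iff_right ofReal_two_pi_ne_zero, pow_eq_zero_iff two_ne_zero,
      enorm_eq_zero, add_zero, sub_eq_zero] at h1
    exact h1
  rw [← hcu]; exact hc

lemma ae_fcV_eq (H : IsFlow T u₀ u w) :
    ∀ᵐ t ∂(volume.restrict (Set.Ioc 0 T)), ∀ k i,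
      fcV (u t) k i = fcV u₀ k i + ∫ r in (0 : ℝ)..t, fcV (w r) k i := by
  rw [ae_all_iff]; intro k
  rw [ae_all_iff]; intro i
  exact H.ae_fcV_eq_aux k i

end IsFlow

end

section

variable {n : ℕ} {T : ℝ}

lemma enorm_fcR_le (F : ℝ → ℝ) (k : ℤ) :
    ‖fcR F k‖ₑ ≤ ENNReal.ofReal (1 / (2 * π)) * ∫⁻ x in circ, ‖F x‖ₑ := by
  rw [fcR, fc, enorm_mul]
  refine mul_le_mul' (le_of_eq ?_) ((enorm_integral_le_lintegral_enorm _).trans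
    (lintegral_mono fun x => le_of_eq ?_))
  · rw [← ofReal_norm, Complex.norm_real, Real.norm_of_nonneg (by positivity)]
  · rw [enorm_mul, ← ofReal_norm (Complex.exp _), norm_exp_neg, ENNReal.ofReal_one, mul_one,
      ← ofReal_norm, ← ofReal_norm, Complex.norm_real]

lemma enorm_gagl_mul_le {v : ℝ → E n} (h1 : ∀ᵐ x ∂(volume.restrict circ), ‖v x‖ = 1) (i : Fin n) :
    ∫⁻ x in circ, ‖gagl v x * v x i‖ₑ ≤ ∫⁻ x in circ, ‖gagl v x‖ₑ := by
  refine lintegral_mono_ae ?_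
  filter_upwards [h1] with x hx
  rw [enorm_mul]
  refine mul_le_of_le_one_right' ?_
  rw [← ofReal_norm, ← ENNReal.ofReal_one]
  exact ENNReal.ofReal_le_ofReal ((PiLp.norm_apply_le _ _).trans hx.le)

namespace IsFlow

variable {u₀ : ℝ → E n} {u w : ℝ → ℝ → E n}

lemma measurable_gagl (H : IsFlow T u₀ u w) : Measurable fun p : ℝ × ℝ => gagl (u p.1) p.2 := by
  have hc := H.uL2.measurable_comp
  have hm : StronglyMeasurable fun q : (ℝ × ℝ) × ℝ =>
      (∑ i, (u q.1.1 q.1.2 i - u q.1.1 q.2 i) ^ 2) / cd q.1.2 q.2 ^ 2 := by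
    apply Measurable.stronglyMeasurable
    refine Measurable.div ?_ (by unfold cd; fun_prop)
    refine Finset.measurable_sum _ fun i _ => Measurable.pow_const (Measurable.sub ?_ ?_) 2
    · exact (hc i).comp measurable_fst
    · exact (hc i).comp (f := fun q : (ℝ × ℝ) × ℝ => (q.1.1, q.2)) (by fun_prop)
  exact (hm.integral_prod_right' (ν := volume.restrict circ)).measurable

lemma measurable_gaglMul (H : IsFlow T u₀ u w) (i : Fin n) :
    Measurable fun p : ℝ × ℝ => gagl (u p.1) p.2 * u p.1 p.2 i :=
  H.measurable_gagl.mul (H.uL2.measurable_comp i)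

lemma ae_lintegral_gaglMul_le (H : IsFlow T u₀ u w) (i : Fin n) :
    ∀ᵐ t ∂(volume.restrict (Set.Ioc 0 T)), ∫⁻ x in circ, ‖gagl (u t) x * u t x i‖ₑ
      ≤ ENNReal.ofReal (2 * π) ^ 2 * hHalf u₀ := by
  filter_upwards [H.ae_sphere, H.ae_isNice, H.decay] with t h1 h2 h3
  refine (enorm_gagl_mul_le h1 i).trans ((lintegral_gagl_le h2).trans ?_)
  gcongr

lemma ae_integrableOn_gaglMul (H : IsFlow T u₀ u w) (i : Fin n) :
    ∀ᵐ t ∂(volume.restrict (Set.Ioc 0 T)),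
      IntegrableOn (fun x => gagl (u t) x * u t x i) circ := by
  have hE := H.energy₀.ne
  filter_upwards [H.ae_lintegral_gaglMul_le i] with t ht
  refine ⟨((H.measurable_gaglMul i).comp measurable_prodMk_left).aestronglyMeasurable, ?_⟩
  exact lt_of_le_of_lt ht (lt_top_iff_ne_top.2 (by finiteness))

lemma integrableOn_fcR_gaglMul (H : IsFlow T u₀ u w) (k : ℤ) (i : Fin n) :
    IntegrableOn (fun t => fcR (fun x => gagl (u t) x * u t x i) k) (Set.Ioc 0 T) := by
  have hE := H.energy₀.ne
  have hfin : (volume.restrict (Set.Ioc 0 T)) Set.univ ≠ ⊤ := measure_ne_top _ _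
  refine ⟨(IsL2.measurable_fcR_slice (H.measurable_gaglMul i) k).aestronglyMeasurable, ?_⟩
  refine lt_of_le_of_lt (lintegral_mono_ae (g := fun _ => ENNReal.ofReal (1 / (2 * π)) *
    (ENNReal.ofReal (2 * π) ^ 2 * hHalf u₀)) ?_) ?_
  · filter_upwards [H.ae_lintegral_gaglMul_le i] with t ht
    refine (enorm_fcR_le _ k).trans ?_
    gcongr
  · rw [lintegral_const]
    exact lt_top_iff_ne_top.2 (by finiteness)

lemma flow_aux (H : IsFlow T u₀ u w) (k : ℤ) (i : Fin n) {θ : ℝ → ℝ} (hθ : IsTimeTest T θ) :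
    ∫ t in Set.Ioc 0 T, (θ t : ℂ) * (fcV (w t) k i + ((2 * π * k.natAbs : ℝ) : ℂ) * fcV (u t) k i
      - fcR (fun x => gagl (u t) x * u t x i) k) = 0 := by
  have hE := H.energy₀
  have i1 := hθ.integrableOn_mul (H.wL2.integrableOn_fcV k i)
  have i2 := hθ.integrableOn_mul (H.uL2.integrableOn_fcV k i)
  have i3 := hθ.integrableOn_mul (H.integrableOn_fcR_gaglMul k i)
  have i2' := i2.const_mul ((2 * π * k.natAbs : ℝ) : ℂ)
  have e : ∀ t, (θ t : ℂ) * (fcV (w t) k i + ((2 * π * k.natAbs : ℝ) : ℂ) * fcV (u t) k i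
      - fcR (fun x => gagl (u t) x * u t x i) k)
      = (θ t : ℂ) * fcV (w t) k i + ((2 * π * k.natAbs : ℝ) : ℂ) * ((θ t : ℂ) * fcV (u t) k i)
      - (θ t : ℂ) * fcR (fun x => gagl (u t) x * u t x i) k := fun t => by ring
  simp_rw [e]
  have i12 : IntegrableOn (fun t => (θ t : ℂ) * fcV (w t) k i
    + ((2 * π * k.natAbs : ℝ) : ℂ) * ((θ t : ℂ) * fcV (u t) k i)) (Set.Ioc 0 T) := i1.add i2'
  rw [integral_sub i12 i3, integral_add i1 i2', integral_const_mul]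
  refine complex_eq_zero_of_re fun ζ => ?_
  have h := H.flow _ (isSTTestOn_chrVec hθ i k ζ)
  have e1 : ∫ t in Set.Ioc 0 T, ∫ x in circ, ∑ j, w t x j * chrVec i k ζ (θ t) x j
      = ∫ t in Set.Ioc 0 T, θ t * (2 * π * (ζ * fcV (w t) k i).re) := by
    refine integral_congr_ae ?_
    filter_upwards [H.wL2.ae_memLp] with t ht
    exact integral_sum_mul_chrVec (integrableOn_of_memLp_ofReal (ht i)) _ _ _
  have e2 : ∫ t in Set.Ioc 0 T, pairing (u t) (chrVec i k ζ (θ t))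
      = ∫ t in Set.Ioc 0 T, θ t * ((2 * π) ^ 2 * k.natAbs * (ζ * fcV (u t) k i).re) := by
    refine integral_congr_ae ?_
    filter_upwards [H.ae_isNice, H.decay] with t h1 h2
    exact pairing_chrVec h1 (lt_of_le_of_lt h2 hE) _ _ _ _
  have e3 : ∫ t in Set.Ioc 0 T, ∫ x in circ, gagl (u t) x * ∑ j, u t x j * chrVec i k ζ (θ t) x j
      = ∫ t in Set.Ioc 0 T, θ t *
        (2 * π * (ζ * fcR (fun x => gagl (u t) x * u t x i) k).re) := by
    refine integral_congr_ae ?_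
    filter_upwards [H.ae_integrableOn_gaglMul i] with t ht
    rw [← integral_mul_chr ht, ← integral_const_mul (θ t)]
    congr 1; ext x
    rw [sum_mul_chrVec]; ring
  rw [e1, e2, e3, integral_mul_re hθ (H.wL2.integrableOn_fcV k i),
    integral_mul_re hθ (H.uL2.integrableOn_fcV k i),
    integral_mul_re hθ (H.integrableOn_fcR_gaglMul k i)] at h
  have hπ := two_pi_pos.ne'
  rw [show ∀ a b c : ℂ, ζ * (a + ((2 * π * k.natAbs : ℝ) : ℂ) * b - c)
    = ζ * a + ((2 * π * k.natAbs : ℝ) : ℂ) * (ζ * b) - ζ * c from fun a b c => by ring,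
    Complex.sub_re, Complex.add_re, Complex.re_ofReal_mul]
  refine mul_left_cancel₀ hπ ?_
  linear_combination h

/-- The flow equation on the Fourier side. -/
lemma ae_flow (H : IsFlow T u₀ u w) : ∀ᵐ t ∂(volume.restrict (Set.Ioc 0 T)), ∀ k i,
    fcV (w t) k i + ((2 * π * k.natAbs : ℝ) : ℂ) * fcV (u t) k i
      = fcR (fun x => gagl (u t) x * u t x i) k := by
  rw [ae_all_iff]; intro k
  rw [ae_all_iff]; intro i
  have hi : IntegrableOn (fun t => fcV (w t) k i + ((2 * π * k.natAbs : ℝ) : ℂ) * fcV (u t) k i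
      - fcR (fun x => gagl (u t) x * u t x i) k) (Set.Ioc 0 T) :=
    ((H.wL2.integrableOn_fcV k i).add ((H.uL2.integrableOn_fcV k i).const_mul _)).sub
      (H.integrableOn_fcR_gaglMul k i)
  filter_upwards [ae_eq_zero_of_timeTest H.pos hi fun θ hθ => H.flow_aux k i hθ] with t ht
  exact sub_eq_zero.1 ht

end IsFlow

end

section

variable {n : ℕ} {T : ℝ}

lemma IsL2.integrable_prod {v : ℝ → ℝ → E n} (hv : IsL2 T v) (i : Fin n) :
    Integrable (fun p : ℝ × ℝ => (v p.1 p.2 i : ℂ))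
      ((volume.restrict (Set.Ioc 0 T)).prod (volume.restrict circ)) := by
  have hm := hv.measurable_comp i
  have hm' : Measurable fun p : ℝ × ℝ => (v p.1 p.2 i : ℂ) := Complex.measurable_ofReal.comp hm
  have hfin : ∫⁻ p, ‖(v p.1 p.2 i : ℂ)‖ₑ ^ 2
      ∂((volume.restrict (Set.Ioc 0 T)).prod (volume.restrict circ)) ≠ ⊤ := by
    rw [lintegral_prod _ (hm'.enorm.pow_const 2).aemeasurable]
    refine ne_top_of_le_ne_top hv.fin (lintegral_mono fun t => lintegral_mono fun x => ?_)
    exact pow_le_pow_left' (enorm_comp_le _ _) 2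
  have hmem : MemLp (fun p : ℝ × ℝ => (v p.1 p.2 i : ℂ)) 2
      ((volume.restrict (Set.Ioc 0 T)).prod (volume.restrict circ)) :=
    memLp_two_of_lintegral hm'.aestronglyMeasurable hfin
  exact hmem.integrable one_le_two

/-- The primitive of `v` in time. -/
def timePrim (T : ℝ) (v : ℝ → ℝ → E n) (i : Fin n) (t x : ℝ) : ℝ :=
  ∫ r in Set.Ioc 0 T, if r ≤ t then v r x i else 0

lemma timePrim_eq (v : ℝ → ℝ → E n) (i : Fin n) {t : ℝ} (ht : t ∈ Set.Ioc 0 T) (x : ℝ) :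
    timePrim T v i t x = ∫ r in (0 : ℝ)..t, v r x i := by
  have e : ∀ r, (if r ≤ t then v r x i else 0) = (Set.Iic t).indicator (fun r => v r x i) r :=
    fun r => by simp [Set.indicator_apply]
  simp_rw [timePrim, e]
  rw [setIntegral_indicator measurableSet_Iic, intervalIntegral.integral_of_le ht.1.le]
  congr 2
  ext r
  simp only [Set.mem_inter_iff, Set.mem_Ioc, Set.mem_Iic]
  exact ⟨fun h => ⟨h.1.1, h.2⟩, fun h => ⟨⟨h.1, h.2.trans ht.2⟩, h.2⟩⟩

lemma measurable_timePrim {v : ℝ → ℝ → E n} (hv : IsL2 T v) (i : Fin n) :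
    Measurable fun p : ℝ × ℝ => timePrim T v i p.1 p.2 := by
  have hm : StronglyMeasurable fun q : (ℝ × ℝ) × ℝ => if q.2 ≤ q.1.1 then v q.2 q.1.2 i else 0 := by
    apply Measurable.stronglyMeasurable
    refine Measurable.ite (measurableSet_le (by fun_prop) (by fun_prop)) ?_ measurable_const
    exact (hv.measurable_comp i).comp (f := fun q : (ℝ × ℝ) × ℝ => (q.2, q.1.2)) (by fun_prop)
  exact (hm.integral_prod_right' (ν := volume.restrict (Set.Ioc 0 T))).measurable

lemma IsL2.mono {v : ℝ → ℝ → E n} (hv : IsL2 T v) {t : ℝ} (ht : t ≤ T) : IsL2 t v :=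
  ⟨hv.meas, ne_top_of_le_ne_top hv.fin
    (lintegral_mono_set (Set.Ioc_subset_Ioc_right ht))⟩

lemma integrableOn_timePrim {v : ℝ → ℝ → E n} (hv : IsL2 T v) (i : Fin n) {t : ℝ}
    (ht : t ∈ Set.Ioc 0 T) : IntegrableOn (fun x => (timePrim T v i t x : ℂ)) circ := by
  have h := (((hv.mono ht.2).integrable_prod i).swap).integral_prod_left
  refine h.congr (ae_of_all _ fun x => ?_)
  change ∫ r in Set.Ioc 0 t, (v r x i : ℂ) = (timePrim T v i t x : ℂ)
  rw [timePrim_eq v i ht, intervalIntegral.integral_of_le ht.1.le]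
  exact integral_complex_ofReal

lemma fc_timePrim {v : ℝ → ℝ → E n} (hv : IsL2 T v) (i : Fin n) (k : ℤ) {t : ℝ}
    (ht : t ∈ Set.Ioc 0 T) :
    fc (fun x => (timePrim T v i t x : ℂ)) k = ∫ r in (0 : ℝ)..t, fcV (v r) k i := by
  have hi : Integrable (fun p : ℝ × ℝ =>
      (v p.1 p.2 i : ℂ) * Complex.exp (-(Complex.I * (k : ℂ) * (p.2 : ℂ))))
      ((volume.restrict (Set.Ioc 0 t)).prod (volume.restrict circ)) := by
    refine ((hv.mono ht.2).integrable_prod i).mul_bdd (c := 1) ?_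
      (ae_of_all _ fun p => (norm_exp_neg k p.2).le)
    exact ((continuous_exp_neg k).comp continuous_snd).aestronglyMeasurable
  rw [intervalIntegral.integral_of_le ht.1.le]
  simp_rw [fcV_def, fc]
  rw [integral_const_mul, integral_integral_swap hi]
  congr 2
  ext x
  rw [timePrim_eq v i ht, integral_mul_const, intervalIntegral.integral_of_le ht.1.le]
  congr 1
  exact integral_complex_ofReal.symm

/-- A function all of whose primitives vanish is zero. -/
lemma ae_eq_zero_of_primitive_ae_eq_zero (hT : 0 < T) {f : ℝ → ℝ}
    (hf : IntegrableOn f (Set.Ioc 0 T))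
    (h : ∀ᵐ t ∂(volume.restrict (Set.Ioc 0 T)), ∫ r in (0 : ℝ)..t, f r = 0) :
    ∀ᵐ t ∂(volume.restrict (Set.Ioc 0 T)), f t = 0 := by
  have hc : IntegrableOn (fun t => (f t : ℂ)) (Set.Ioc 0 T) := hf.ofReal
  have key : ∀ᵐ t ∂(volume.restrict (Set.Ioc 0 T)), (f t : ℂ) = 0 := by
    refine ae_eq_zero_of_timeTest hT hc fun θ hθ => ?_
    have h1 := hθ.integral_deriv_mul hT hc
    rw [eq_neg_iff_add_eq_zero, add_comm, ← eq_neg_iff_add_eq_zero] at h1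
    rw [h1, neg_eq_zero]
    refine integral_eq_zero_of_ae ?_
    filter_upwards [h] with t ht
    rw [intervalIntegral.integral_ofReal, ht]
    simp
  filter_upwards [key] with t ht using by exact_mod_cast ht

namespace IsFlow

variable {u₀ : ℝ → E n} {u w : ℝ → ℝ → E n}

lemma ae_eq_timePrim (H : IsFlow T u₀ u w) : ∀ᵐ t ∂(volume.restrict (Set.Ioc 0 T)),
    ∀ᵐ x ∂(volume.restrict circ), ∀ i, u t x i - u₀ x i = timePrim T w i t x := by
  filter_upwards [H.ae_fcV_eq, H.ae_isNice, ae_restrict_mem measurableSet_Ioc] with t h1 h2 ht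
  rw [ae_all_iff]; intro i
  have i1 : IntegrableOn (fun x => (u t x i : ℂ)) circ := (h2.memLp i).integrable one_le_two
  have i2 : IntegrableOn (fun x => (u₀ x i : ℂ)) circ := (H.isNice₀.memLp i).integrable one_le_two
  have h3 := ae_eq_of_fc_eq (i1.sub i2) (integrableOn_timePrim H.wL2 i ht) fun k => by
    rw [fc_timePrim H.wL2 i k ht]
    refine (fc_sub i1 i2 k).trans ?_
    have := h1 k i
    rw [fcV_def, fcV_def] at this
    rw [this]; ring
  filter_upwards [h3] with x hx
  have : (u t x i : ℂ) - (u₀ x i : ℂ) = (timePrim T w i t x : ℂ) := hx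
  exact_mod_cast this

lemma ae_slice_integrable (H : IsFlow T u₀ u w) : ∀ᵐ x ∂(volume.restrict circ), ∀ i,
    IntegrableOn (fun t => w t x i) (Set.Ioc 0 T) := by
  rw [ae_all_iff]; intro i
  filter_upwards [((H.wL2.integrable_prod i).swap).prod_right_ae] with x hx
  have := hx.re
  exact this.congr (ae_of_all _ fun t => by simp)

lemma swap_ae {p : ℝ → ℝ → Prop} (hp : MeasurableSet {q : ℝ × ℝ | p q.1 q.2})
    {μ ν : Measure ℝ} [SFinite μ] [SFinite ν] (h : ∀ᵐ t ∂μ, ∀ᵐ x ∂ν, p t x) :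
    ∀ᵐ x ∂ν, ∀ᵐ t ∂μ, p t x := by
  have h1 : ∀ᵐ q ∂(μ.prod ν), p q.1 q.2 := (Measure.ae_prod_iff_ae_ae hp).2 h
  have h2 : ∀ᵐ q ∂(ν.prod μ), p q.2 q.1 := by
    rw [← Measure.prod_swap] at h1
    exact ae_of_ae_map measurable_swap.aemeasurable h1
  exact Measure.ae_ae_of_ae_prod h2

/-- The velocity is tangential. -/
lemma ae_orthogonal (H : IsFlow T u₀ u w) : ∀ᵐ t ∂(volume.restrict (Set.Ioc 0 T)),
    ∀ᵐ x ∂(volume.restrict circ), ∑ i, w t x i * u t x i = 0 := by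
  have mu := H.uL2.measurable_comp
  have mw := H.wL2.measurable_comp
  have mu' : ∀ i, Measurable fun p : ℝ × ℝ => u p.2 p.1 i := fun i => (mu i).comp measurable_swap
  have mw' : ∀ i, Measurable fun p : ℝ × ℝ => w p.2 p.1 i := fun i => (mw i).comp measurable_swap
  have mu₀ : ∀ i, Measurable fun x => u₀ x i := fun i => by have := H.meas₀; fun_prop
  have mun : Measurable fun p : ℝ × ℝ => ‖u p.1 p.2‖ := H.meas.norm
  refine swap_ae (p := fun x t => ∑ i, w t x i * u t x i = 0) ?_ ?_
  · exact measurableSet_eq_fun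
      (Finset.measurable_sum _ fun i _ => (mw' i).mul (mu' i)) measurable_const
  have s1 : ∀ᵐ x ∂(volume.restrict circ), ∀ᵐ t ∂(volume.restrict (Set.Ioc 0 T)),
      ∀ i, u t x i - u₀ x i = timePrim T w i t x := by
    refine swap_ae ?_ H.ae_eq_timePrim
    have : {q : ℝ × ℝ | ∀ i, u q.1 q.2 i - u₀ q.2 i = timePrim T w i q.1 q.2}
        = ⋂ i, {q : ℝ × ℝ | u q.1 q.2 i - u₀ q.2 i = timePrim T w i q.1 q.2} := by
      ext q; simp
    rw [this]
    refine MeasurableSet.iInter fun i => measurableSet_eq_fun ?_ (measurable_timePrim H.wL2 i)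
    exact (mu i).sub ((mu₀ i).comp measurable_snd)
  have s2 : ∀ᵐ x ∂(volume.restrict circ), ∀ᵐ t ∂(volume.restrict (Set.Ioc 0 T)), ‖u t x‖ = 1 :=
    swap_ae (p := fun t x => ‖u t x‖ = 1) (measurableSet_eq_fun mun measurable_const) H.ae_sphere
  filter_upwards [s1, s2, H.ae_slice_integrable] with x h1 h2 h3
  have hprod : ∀ᵐ t ∂(volume.restrict (Set.Ioc 0 T)), t ∈ Set.Ioc 0 T ∧ ∀ i,
      u t x i = u₀ x i + ∫ r in (0 : ℝ)..t, w r x i := by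
    filter_upwards [h1, ae_restrict_mem measurableSet_Ioc] with t h ht
    refine ⟨ht, fun i => ?_⟩
    rw [← timePrim_eq w i ht, ← h i]; ring
  set P : Fin n → ℝ → ℝ := fun i r => w r x i * (u₀ x i + ∫ s in (0 : ℝ)..r, w s x i)
      + (u₀ x i + ∫ s in (0 : ℝ)..r, w s x i) * w r x i with hP
  have hPi : ∀ i, IntegrableOn (P i) (Set.Ioc 0 T) := fun i =>
    (primitive_mul_primitive H.pos.le (h3 i) (h3 i) (u₀ x i) (u₀ x i)).1
  have hz := ae_eq_zero_of_primitive_ae_eq_zero H.pos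
    (f := fun r => ∑ i, P i r) (integrable_finsetSum _ fun i _ => hPi i) (by
      filter_upwards [hprod, h2] with t ht h2t
      have hsub : ∀ i, IntegrableOn (fun r => w r x i) (Set.Ioc 0 t) := fun i =>
        (h3 i).mono_set (Set.Ioc_subset_Ioc_right ht.1.2)
      have hsubP : ∀ i ∈ Finset.univ, IntegrableOn (P i) (Set.Ioc 0 t) := fun i _ =>
        (hPi i).mono_set (Set.Ioc_subset_Ioc_right ht.1.2)
      rw [intervalIntegral.integral_of_le ht.1.1.le, integral_finsetSum _ hsubP]
      have e : ∀ i, ∫ r in Set.Ioc 0 t, P i r = u t x i * u t x i - u₀ x i * u₀ x i := fun i => by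
        rw [← (primitive_mul_primitive ht.1.1.le (hsub i) (hsub i) (u₀ x i) (u₀ x i)).2, ht.2 i]
      simp_rw [e]
      rw [Finset.sum_sub_distrib, sub_eq_zero]
      have hn : ∀ a : E n, ∑ i, a i * a i = ‖a‖ ^ 2 := fun a => by
        rw [EuclideanSpace.real_norm_sq_eq]
        exact Finset.sum_congr rfl fun i _ => (sq _).symm
      rw [hn, hn, h2t, H.sphere₀])
  filter_upwards [hz, hprod] with t h4 h5
  have e : ∀ i, P i t = 2 * (w t x i * u t x i) := fun i => by
    simp only [hP, ← h5.2 i]; ring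
  simp_rw [e] at h4
  rw [← Finset.mul_sum] at h4
  linarith

end IsFlow

end

section

variable {n : ℕ} {T : ℝ}

lemma tsum_absMul_fcV_le (v : ℝ → E n) (i : Fin n) :
    ∑' k, ‖absMul (fun k => fcV v k i) k‖ₑ ^ 2 ≤ hSob 1 v := by
  refine ENNReal.tsum_le_tsum fun k => ?_
  rw [enorm_absMul_sq]
  refine mul_le_mul' ?_ ?_
  · rw [← ENNReal.ofReal_natCast, ← ENNReal.ofReal_pow (by positivity), rpow_one]
    refine ENNReal.ofReal_le_ofReal ?_
    rw [Nat.cast_natAbs, Int.cast_abs, sq_abs]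
    linarith
  · exact Finset.single_le_sum (f := fun i => ‖fcV v k i‖ₑ ^ 2) (fun _ _ => zero_le) (Finset.mem_univ i)

lemma integrable_mul_of_memLp {m f g : ℝ → ℝ} (hm : Continuous m) (h01 : ∀ x, 0 ≤ m x ∧ m x ≤ 1)
    (hf : MemLp (fun x => (f x : ℂ)) 2 (volume.restrict circ))
    (hg : MemLp (fun x => (g x : ℂ)) 2 (volume.restrict circ)) :
    IntegrableOn (fun x => m x * (f x * g x)) circ := by
  have h1 : Integrable (fun x => f x * g x) (volume.restrict circ) := by
    have := (hf.integrable_mul hg).re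
    refine this.congr (Eventually.of_forall fun x => ?_)
    simp [← Complex.ofReal_mul]
  refine h1.bdd_mul (c := 1) hm.aestronglyMeasurable (Eventually.of_forall fun x => ?_)
  rw [norm_of_nonneg (h01 x).1]
  exact (h01 x).2

lemma tsum_toep_ofReal {c : ℤ → ℂ} {m f g : ℝ → ℝ} (hc : ∑' j, ‖c j‖ₑ ≠ ⊤)
    (hm : ∀ x : ℝ, HasSum (fun j : ℤ => c j * Complex.exp (Complex.I * j * x)) (m x : ℂ))
    (hf : MemLp (fun x => (f x : ℂ)) 2 (volume.restrict circ))
    (hg : MemLp (fun x => (g x : ℂ)) 2 (volume.restrict circ)) :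
    ∑' p, toep c (fcR f) (fcR g) p
      = ((1 / (2 * π) * ∫ x in circ, m x * (f x * g x) : ℝ) : ℂ) := by
  have h := (hasSum_toep_fc (m := fun x => (m x : ℂ)) hc hm hf hg).tsum_eq
  have e : ∫ x in circ, (m x : ℂ) * ((f x : ℂ) * conj (g x : ℂ))
      = ((∫ x in circ, m x * (f x * g x) : ℝ) : ℂ) := by
    rw [← integral_complex_ofReal]
    refine integral_congr_ae (Eventually.of_forall fun x => ?_)
    simp [Complex.conj_ofReal]
  rw [e, ← Complex.ofReal_mul] at h
  exact h

/-- `c` is the summable Fourier series of a continuous multiplier `m` with values in `[0, 1]`,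
with `1/2` derivative in the Wiener algebra. -/
structure IsMultiplier (c : ℤ → ℂ) (m : ℝ → ℝ) : Prop where
  summ : ∑' j, ‖c j‖ₑ ≠ ⊤
  summ_qs : ∑' j, ‖c j‖ₑ * ENNReal.ofReal (qs j) ≠ ⊤
  hasSum : ∀ x : ℝ, HasSum (fun j : ℤ => c j * Complex.exp (Complex.I * j * x)) (m x : ℂ)
  continuous : Continuous m
  mem : ∀ x, 0 ≤ m x ∧ m x ≤ 1

/-- A time slice `v` of a solution together with its time derivative `ω`. -/
structure IsFlowSlice (v ω : ℝ → E n) : Prop where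
  memLp : ∀ i, MemLp (fun x => (ω x i : ℂ)) 2 (volume.restrict circ)
  integrable : ∀ i, IntegrableOn (fun x => gagl v x * v x i) circ
  flow : ∀ k i, fcV ω k i + ((2 * π * k.natAbs : ℝ) : ℂ) * fcV v k i
    = fcR (fun x => gagl v x * v x i) k
  sob : hSob 1 v ≠ ⊤
  orth : ∀ᵐ x ∂(volume.restrict circ), ∑ i, ω x i * v x i = 0

/-- The half-Laplacian of a solution slice, read off from the flow equation. -/
def flowLap (v ω : ℝ → E n) (i : Fin n) (x : ℝ) : ℝ :=
  1 / (2 * π) * (gagl v x * v x i - ω x i)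

namespace IsFlowSlice

variable {v ω : ℝ → E n}

lemma fcR_flowLap (h : IsFlowSlice v ω) (i : Fin n) :
    fcR (flowLap v ω i) = absMul (fun k => fcV v k i) := by
  funext k
  have h1 := fc_sub (f := fun x => ((gagl v x * v x i : ℝ) : ℂ)) (h.integrable i).ofReal
    ((h.memLp i).integrable one_le_two) k
  have h2 : fcR (flowLap v ω i) k = ((1 / (2 * π) : ℝ) : ℂ) *
      fc (fun x => ((gagl v x * v x i : ℝ) : ℂ) - (ω x i : ℂ)) k := by
    simp only [fcR, fc, flowLap]
    congr 1
    rw [← integral_const_mul]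
    congr 1
    funext x
    push_cast
    ring
  have h3 : fc (fun x => ((gagl v x * v x i : ℝ) : ℂ)) k = fcR (fun x => gagl v x * v x i) k := rfl
  have h4 : fc (fun x => (ω x i : ℂ)) k = fcV ω k i := rfl
  rw [h2, h1, h3, h4, ← h.flow, absMul]
  have : (π : ℂ) ≠ 0 := by exact_mod_cast pi_ne_zero
  push_cast
  field_simp
  ring

lemma integrableOn_flowLap (h : IsFlowSlice v ω) (i : Fin n) :
    IntegrableOn (flowLap v ω i) circ :=
  ((h.integrable i).sub (integrableOn_of_memLp_ofReal (h.memLp i))).const_mul _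

lemma tsum_absMul_ne_top (h : IsFlowSlice v ω) (i : Fin n) :
    ∑' k, ‖absMul (fun k => fcV v k i) k‖ₑ ^ 2 ≠ ⊤ :=
  ne_top_of_le_ne_top h.sob (tsum_absMul_fcV_le v i)

lemma memLp_flowLap (h : IsFlowSlice v ω) (i : Fin n) :
    MemLp (fun x => (flowLap v ω i x : ℂ)) 2 (volume.restrict circ) := by
  refine memLp_two_of_summable_fc (h.integrableOn_flowLap i).ofReal ?_
  have h1 : (fun k => fc (fun x => (flowLap v ω i x : ℂ)) k) = absMul (fun k => fcV v k i) :=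
    h.fcR_flowLap i
  have h2 := h.tsum_absMul_ne_top i
  rw [← h1] at h2
  refine (ENNReal.summable_toReal h2).congr fun k => ?_
  simp

lemma sum_tsum_toep {c : ℤ → ℂ} {m : ℝ → ℝ} (hc : IsMultiplier c m) (h : IsFlowSlice v ω) :
    ∑ i, (∑' p, toep c (fun k => fcV ω k i) (absMul fun k => fcV v k i) p
        + ∑' p, toep c (absMul fun k => fcV v k i) (fun k => fcV ω k i) p)
      = ((-(1 / (2 * π ^ 2)) * ∫ x in circ, m x * ∑ i, ω x i * ω x i : ℝ) : ℂ) := by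
  have hl := h.memLp_flowLap
  have h1 : ∀ i, ∑' p, toep c (fun k => fcV ω k i) (absMul fun k => fcV v k i) p
        + ∑' p, toep c (absMul fun k => fcV v k i) (fun k => fcV ω k i) p
      = ((∫ x in circ, 1 / π * (m x * (ω x i * flowLap v ω i x)) : ℝ) : ℂ) := by
    intro i
    rw [← h.fcR_flowLap i]
    have e1 := tsum_toep_ofReal hc.summ hc.hasSum (h.memLp i) (hl i)
    have e2 := tsum_toep_ofReal hc.summ hc.hasSum (hl i) (h.memLp i)
    have e3 : (fun k => fcV ω k i) = fcR (fun x => ω x i) := rfl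
    rw [e3, e1, e2, integral_const_mul]
    simp only [mul_comm (flowLap v ω i _)]
    push_cast
    field_simp
    ring
  simp only [h1]
  rw [← Complex.ofReal_sum]
  congr 1
  rw [← integral_finsetSum _ fun i _ =>
    (integrable_mul_of_memLp hc.continuous hc.mem (h.memLp i) (hl i)).const_mul _,
    ← integral_const_mul]
  refine integral_congr_ae ?_
  filter_upwards [h.orth] with x hx
  have e : ∀ i, 1 / π * (m x * (ω x i * flowLap v ω i x))
      = 1 / (2 * π ^ 2) * m x * gagl v x * (ω x i * v x i)
        - 1 / (2 * π ^ 2) * m x * (ω x i * ω x i) := by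
    intro i
    rw [flowLap]
    field_simp
  simp only [e]
  rw [Finset.sum_sub_distrib, ← Finset.mul_sum, ← Finset.mul_sum, hx]
  ring

lemma tsum_fcV_ne_top (h : IsFlowSlice v ω) (i : Fin n) : ∑' k, ‖fcV ω k i‖ₑ ^ 2 ≠ ⊤ :=
  tsum_enorm_sq_fc_ne_top (h.memLp i)

lemma exists_sum_toepDeriv_eq {c : ℤ → ℂ} {m : ℝ → ℝ} (hc : IsMultiplier c m)
    (h : IsFlowSlice v ω) {e : ℝ≥0∞} (h0 : e ≠ 0) (ht : e ≠ ⊤) :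
    ∃ err : ℂ, ‖err‖ₑ ≤ 2 * (∑' j, ‖c j‖ₑ * ENNReal.ofReal (qs j)) *
        (e * ∑ i, ∑' k, ‖fcV ω k i‖ₑ ^ 2 + e⁻¹ * hHalf v) ∧
      ∑ i, ∑' p, toepDeriv c (fun k => fcV v k i) (fun k => fcV ω k i) p
        = ((-(1 / (2 * π ^ 2)) * ∫ x in circ, m x * ∑ i, ω x i * ω x i : ℝ) : ℂ) + err := by
  choose err h1 h2 using fun i => exists_tsum_toepDeriv_eq hc.summ hc.summ_qs
    (h.tsum_fcV_ne_top i) (h.tsum_absMul_ne_top i) h0 ht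
  refine ⟨∑ i, err i, ?_, ?_⟩
  · refine (enorm_sum_le _ _).trans ((Finset.sum_le_sum fun i _ => h1 i).trans_eq ?_)
    rw [← Finset.mul_sum, Finset.sum_add_distrib, ← Finset.mul_sum, ← Finset.mul_sum, hHalf_eq]
  · simp only [h2]
    rw [Finset.sum_add_distrib, h.sum_tsum_toep hc]

end IsFlowSlice

variable {u₀ : ℝ → E n} {u w : ℝ → ℝ → E n}

lemma IsFlow.ae_isFlowSlice (H : IsFlow T u₀ u w) :
    ∀ᵐ t ∂(volume.restrict (Set.Ioc 0 T)), IsFlowSlice (u t) (w t) := by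
  filter_upwards [H.wL2.ae_memLp, ae_all_iff.2 H.ae_integrableOn_gaglMul, H.ae_flow, H.ae_sob,
    H.ae_orthogonal] with t h1 h2 h3 h4 h5
  exact ⟨h1, h2, h3, h4.ne, h5⟩

end

section

variable {n : ℕ} {T : ℝ}

/-- The localised Dirichlet energy `(1/2π) ∫ m |(-Δ)^{1/4} v|²` in Fourier variables. -/
def locEnergy (c : ℤ → ℂ) (v : ℝ → E n) : ℂ :=
  ∑ i, ∑' p, toep c (qsMul fun k => fcV v k i) (qsMul fun k => fcV v k i) p

namespace IsFlow

variable {u₀ : ℝ → E n} {u w : ℝ → ℝ → E n}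

lemma ae_locEnergy_sub (H : IsFlow T u₀ u w) : ∀ᵐ t ∂(volume.restrict (Set.Ioc 0 T)),
    ∀ c m, IsMultiplier c m →
      IntegrableOn (fun r => ∑ i, ∑' p, toepDeriv c (fun k => fcV (u r) k i)
        (fun k => fcV (w r) k i) p) (Set.Ioc 0 t) ∧
      locEnergy c (u t) - locEnergy c u₀ = ∫ r in Set.Ioc 0 t, ∑ i, ∑' p,
        toepDeriv c (fun k => fcV (u r) k i) (fun k => fcV (w r) k i) p := by
  filter_upwards [H.ae_fcV_eq, H.decay, ae_restrict_mem measurableSet_Ioc] with t h1 h2 htT c m hc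
  have hsub : Set.Ioc 0 t ⊆ Set.Ioc 0 T := Set.Ioc_subset_Ioc_right htT.2
  have hae : ∀ᵐ r ∂(volume.restrict (Set.Ioc 0 t)), ∀ k i,
      fcV (u r) k i = fcV u₀ k i + ∫ x in (0 : ℝ)..r, fcV (w x) k i :=
    ae_restrict_of_ae_restrict_of_subset hsub H.ae_fcV_eq
  have hlow : ∀ {v : ℝ → E n}, hHalf v ≤ hHalf u₀ → ∀ i,
      ∑' k, ‖qsMul (fun k => fcV v k i) k‖ₑ ^ 2 ≠ ⊤ := fun hv i =>
    ne_top_of_le_ne_top (hv.trans_lt H.energy₀).ne (tsum_qsMul_le_hHalf _ i)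
  have key : ∀ i, IntegrableOn (fun r => ∑' p, toepDeriv c (fun k => fcV (u r) k i)
        (fun k => fcV (w r) k i) p) (Set.Ioc 0 t) ∧
      ∑' p, toep c (qsMul fun k => fcV (u t) k i) (qsMul fun k => fcV (u t) k i) p
        - ∑' p, toep c (qsMul fun k => fcV u₀ k i) (qsMul fun k => fcV u₀ k i) p
      = ∫ r in Set.Ioc 0 t, ∑' p,
        toepDeriv c (fun k => fcV (u r) k i) (fun k => fcV (w r) k i) p := by
    intro i
    set A : ℝ → ℤ → ℂ := fun r k => fcV u₀ k i + ∫ x in (0 : ℝ)..r, fcV (w x) k i with hA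
    have hAt : A t = fun k => fcV (u t) k i := by funext k; exact (h1 k i).symm
    have hAr : ∀ᵐ r ∂(volume.restrict (Set.Ioc 0 t)), A r = fun k => fcV (u r) k i := by
      filter_upwards [hae] with r hr
      funext k; exact (hr k i).symm
    have hN : ∫⁻ r in Set.Ioc 0 t, ∑' k, ‖absMul (A r) k‖ₑ ^ 2 ≠ ⊤ := by
      refine ne_top_of_le_ne_top H.sob.ne (le_trans (lintegral_mono_ae ?_)
        (lintegral_mono_set hsub))
      filter_upwards [hAr] with r hr
      rw [hr]
      exact tsum_absMul_fcV_le _ _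
    have := toep_evolution hc.summ hc.summ_qs htT.1.le (a0 := fun k => fcV u₀ k i) (A := A)
      (b := fun r k => fcV (w r) k i) (fun k => (H.wL2.mono htT.2).integrableOn_fcV k i)
      (fun _ _ => rfl) ((H.wL2.mono htT.2).lintegral_tsum_fcV i) hN (hlow le_rfl i)
      (by rw [hAt]; exact hlow h2 i)
    have hcongr : (fun r => ∑' p, toepDeriv c (A r) (fun k => fcV (w r) k i) p)
        =ᵐ[volume.restrict (Set.Ioc 0 t)] fun r => ∑' p, toepDeriv c (fun k => fcV (u r) k i)
          (fun k => fcV (w r) k i) p := by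
      filter_upwards [hAr] with r hr
      rw [hr]
    rw [hAt] at this
    refine ⟨this.1.congr hcongr, this.2.trans (integral_congr_ae hcongr)⟩
  refine ⟨integrable_finsetSum _ fun i _ => (key i).1, ?_⟩
  rw [integral_finsetSum _ fun i _ => (key i).1, locEnergy, locEnergy, ← Finset.sum_sub_distrib]
  exact Finset.sum_congr rfl fun i _ => (key i).2

end IsFlow

lemma isMultiplier_one : IsMultiplier (Pi.single 0 1) (fun _ => 1) where
  summ := by
    rw [tsum_eq_single 0 fun j hj => by simp [Pi.single_eq_of_ne hj]]
    simp
  summ_qs := by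
    rw [tsum_eq_single 0 fun j hj => by simp [Pi.single_eq_of_ne hj]]
    simp
  hasSum x := by
    have := hasSum_single (f := fun j : ℤ => (Pi.single 0 1 : ℤ → ℂ) j *
      Complex.exp (Complex.I * j * x)) 0 fun j hj => by simp [Pi.single_eq_of_ne hj]
    simpa using this
  continuous := continuous_const
  mem _ := ⟨zero_le_one, le_rfl⟩

lemma tsum_single_mul_qs :
    ∑' j, ‖(Pi.single 0 1 : ℤ → ℂ) j‖ₑ * ENNReal.ofReal (qs j) = 0 := by
  rw [ENNReal.tsum_eq_zero]
  intro j
  by_cases hj : j = 0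
  · simp [hj, qs]
  · simp [Pi.single_eq_of_ne hj]

lemma tsum_toep_single {α : ℤ → ℂ} (hα : ∑' k, ‖α k‖ₑ ^ 2 ≠ ⊤) :
    ∑' p, toep (Pi.single 0 1) α α p = ((∑' k, ‖α k‖ ^ 2 : ℝ) : ℂ) := by
  rw [(summable_toep isMultiplier_one.summ hα hα).tsum_prod, tsum_eq_single 0, Complex.ofReal_tsum]
  · refine tsum_congr fun k => ?_
    simp [toep, Complex.mul_conj, Complex.normSq_eq_norm_sq]
  · intro j hj
    simp [toep, Pi.single_eq_of_ne hj]

lemma locEnergy_single {v : ℝ → E n} (hv : hHalf v ≠ ⊤) :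
    locEnergy (Pi.single 0 1) v = (((hHalf v).toReal : ℝ) : ℂ) := by
  have hi : ∀ i, ∑' k, ‖qsMul (fun k => fcV v k i) k‖ₑ ^ 2 ≠ ⊤ := fun i =>
    ne_top_of_le_ne_top hv (tsum_qsMul_le_hHalf _ i)
  rw [locEnergy, hHalf_eq, ENNReal.toReal_sum fun i _ => hi i, Complex.ofReal_sum]
  refine Finset.sum_congr rfl fun i _ => ?_
  rw [tsum_toep_single (hi i), ENNReal.tsum_toReal_eq fun k => by finiteness]
  simp

namespace IsFlow

variable {u₀ : ℝ → E n} {u w : ℝ → ℝ → E n}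

lemma lintegral_sum_sq {ω : ℝ → E n} (h : ∀ i, MemLp (fun x => (ω x i : ℂ)) 2 (volume.restrict circ)) :
    ENNReal.ofReal (∫ x in circ, ∑ i, ω x i * ω x i)
      = ENNReal.ofReal (2 * π) * ∑ i, ∑' k, ‖fcV ω k i‖ₑ ^ 2 := by
  have hint : ∀ i, IntegrableOn (fun x => ω x i * ω x i) circ := fun i => by
    simpa using integrable_mul_of_memLp (m := fun _ => 1) continuous_const
      (fun _ => ⟨zero_le_one, le_rfl⟩) (h i) (h i)
  rw [integral_finsetSum _ fun i _ => hint i, ENNReal.ofReal_sum_of_nonneg fun i _ =>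
    integral_nonneg fun x => mul_self_nonneg _, Finset.mul_sum]
  refine Finset.sum_congr rfl fun i _ => ?_
  refine Eq.trans ?_ (lintegral_parseval (h i))
  rw [ofReal_integral_eq_lintegral_ofReal (hint i) (Eventually.of_forall fun x => mul_self_nonneg _)]
  refine lintegral_congr fun x => ?_
  rw [← ofReal_norm, Complex.norm_real, ← ENNReal.ofReal_pow (norm_nonneg _), norm_eq_abs, sq_abs,
    sq]

lemma ae_lintegral_le (H : IsFlow T u₀ u w) : ∀ᵐ t ∂(volume.restrict (Set.Ioc 0 T)),
    ∫⁻ r in Set.Ioc 0 t, ∑ i, ∑' k, ‖fcV (w r) k i‖ₑ ^ 2 ≤ ENNReal.ofReal π * hHalf u₀ := by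
  filter_upwards [H.ae_locEnergy_sub, H.decay, ae_restrict_mem measurableSet_Ioc]
    with t h1 h2 htT
  have hsub : Set.Ioc 0 t ⊆ Set.Ioc 0 T := Set.Ioc_subset_Ioc_right htT.2
  obtain ⟨hi, he⟩ := h1 _ _ isMultiplier_one
  rw [locEnergy_single H.energy₀.ne, locEnergy_single (h2.trans_lt H.energy₀).ne] at he
  have hs : ∀ᵐ r ∂(volume.restrict (Set.Ioc 0 t)), IsFlowSlice (u r) (w r) :=
    ae_restrict_of_ae_restrict_of_subset hsub H.ae_isFlowSlice
  set J : ℝ → ℝ := fun r => ∫ x in circ, ∑ i, w r x i * w r x i with hJ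
  have hD : (fun r => ∑ i, ∑' p, toepDeriv (Pi.single 0 1) (fun k => fcV (u r) k i)
        (fun k => fcV (w r) k i) p) =ᵐ[volume.restrict (Set.Ioc 0 t)]
      fun r => ((-(1 / (2 * π ^ 2)) * J r : ℝ) : ℂ) := by
    filter_upwards [hs] with r hr
    obtain ⟨err, h3, h4⟩ := hr.exists_sum_toepDeriv_eq isMultiplier_one one_ne_zero
      ENNReal.one_ne_top
    rw [tsum_single_mul_qs] at h3
    have : err = 0 := by simpa using h3
    rw [h4, this, add_zero]
    simp [hJ]
  have hJi : IntegrableOn J (Set.Ioc 0 t) := by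
    have h3 : IntegrableOn (fun r => -(1 / (2 * π ^ 2)) * J r) (Set.Ioc 0 t) :=
      (hi.congr hD).re.congr (Eventually.of_forall fun r => Complex.ofReal_re _)
    refine (h3.const_mul (-(2 * π ^ 2))).congr (Eventually.of_forall fun r => ?_)
    have := pi_ne_zero
    simp only
    field_simp
  have hJ0 : ∀ r, 0 ≤ J r := fun r =>
    integral_nonneg fun x => Finset.sum_nonneg fun i _ => mul_self_nonneg _
  rw [integral_congr_ae hD, integral_complex_ofReal, ← Complex.ofReal_sub, Complex.ofReal_inj,
    integral_const_mul] at he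
  have hle : ∫ r in Set.Ioc 0 t, J r ≤ 2 * π * (π * (hHalf u₀).toReal) := by
    have h3 : (0 : ℝ) ≤ (hHalf (u t)).toReal := ENNReal.toReal_nonneg
    have h4 : 1 / (2 * π ^ 2) * ∫ r in Set.Ioc 0 t, J r ≤ (hHalf u₀).toReal := by linarith
    have hpi := pi_pos
    rw [one_div, inv_mul_le_iff₀ (by positivity)] at h4
    linarith
  have h5 : ENNReal.ofReal (2 * π) * ∫⁻ r in Set.Ioc 0 t, ∑ i, ∑' k, ‖fcV (w r) k i‖ₑ ^ 2
      ≤ ENNReal.ofReal (2 * π) * (ENNReal.ofReal π * hHalf u₀) := by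
    rw [← lintegral_const_mul' _ _ (by finiteness)]
    have h6 : ∫⁻ r in Set.Ioc 0 t, ENNReal.ofReal (2 * π) * ∑ i, ∑' k, ‖fcV (w r) k i‖ₑ ^ 2
        = ENNReal.ofReal (∫ r in Set.Ioc 0 t, J r) := by
      rw [ofReal_integral_eq_lintegral_ofReal hJi (Eventually.of_forall hJ0)]
      refine lintegral_congr_ae ?_
      filter_upwards [hs] with r hr
      exact (lintegral_sum_sq hr.memLp).symm
    rw [h6]
    refine (ENNReal.ofReal_le_ofReal hle).trans_eq ?_
    rw [ENNReal.ofReal_mul two_pi_pos.le, ENNReal.ofReal_mul pi_pos.le,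
      ENNReal.ofReal_toReal H.energy₀.ne]
  exact (ENNReal.mul_le_mul_iff_right ofReal_two_pi_ne_zero (by finiteness)).1 h5

lemma ofReal_integral_le (μ : Measure ℝ) (f : ℝ → ℝ) :
    ENNReal.ofReal (∫ x, f x ∂μ) ≤ ∫⁻ x, ENNReal.ofReal (f x) ∂μ := by
  by_cases hf : Integrable f μ
  · rw [integral_eq_lintegral_pos_part_sub_lintegral_neg_part hf]
    exact (ENNReal.ofReal_le_ofReal (sub_le_self _ ENNReal.toReal_nonneg)).trans
      ENNReal.ofReal_toReal_le
  · simp [integral_undef hf]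

lemma ae_locEnergy_le (H : IsFlow T u₀ u w) : ∀ᵐ t ∂(volume.restrict (Set.Ioc 0 T)),
    ∀ c m, IsMultiplier c m → ENNReal.ofReal (locEnergy c (u t)).re
      ≤ ENNReal.ofReal (locEnergy c u₀).re
        + 2 * (∑' j, ‖c j‖ₑ * ENNReal.ofReal (qs j)) *
          (ENNReal.ofReal ((π + 1) * √t) * hHalf u₀) := by
  filter_upwards [H.ae_locEnergy_sub, H.ae_lintegral_le, ae_restrict_mem measurableSet_Ioc]
    with t h1 h2 htT c m hc
  have hsub : Set.Ioc 0 t ⊆ Set.Ioc 0 T := Set.Ioc_subset_Ioc_right htT.2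
  obtain ⟨hi, he⟩ := h1 c m hc
  set K := ∑' j, ‖c j‖ₑ * ENNReal.ofReal (qs j)
  set D : ℝ → ℂ := fun r => ∑ i, ∑' p, toepDeriv c (fun k => fcV (u r) k i)
    (fun k => fcV (w r) k i) p with hDdef
  have hK : K ≠ ⊤ := hc.summ_qs
  have hst : 0 < √t := sqrt_pos.2 htT.1
  set e := ENNReal.ofReal (√t) with hedef
  have h0 : e ≠ 0 := by rw [hedef, Ne, ENNReal.ofReal_eq_zero, not_le]; exact hst
  have htop : e ≠ ⊤ := ENNReal.ofReal_ne_top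
  have hre : (locEnergy c (u t)).re = (locEnergy c u₀).re + ∫ r in Set.Ioc 0 t, (D r).re := by
    have h3 : ∫ r in Set.Ioc 0 t, (D r).re = (∫ r in Set.Ioc 0 t, D r).re :=
      integral_re (𝕜 := ℂ) hi
    rw [h3, ← he, Complex.sub_re]
    ring
  have hD : ∀ᵐ r ∂(volume.restrict (Set.Ioc 0 t)), ENNReal.ofReal (D r).re
      ≤ 2 * K * (e * ∑ i, ∑' k, ‖fcV (w r) k i‖ₑ ^ 2 + e⁻¹ * hHalf u₀) := by
    filter_upwards [ae_restrict_of_ae_restrict_of_subset hsub H.ae_isFlowSlice,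
      ae_restrict_of_ae_restrict_of_subset hsub H.decay] with r hr hr2
    obtain ⟨err, h3, h4⟩ := hr.exists_sum_toepDeriv_eq hc h0 htop
    have h5 : D r = _ := h4
    have h6 : (0 : ℝ) ≤ ∫ x in circ, m x * ∑ i, w r x i * w r x i :=
      integral_nonneg fun x => mul_nonneg (hc.mem x).1
        (Finset.sum_nonneg fun i _ => mul_self_nonneg _)
    have h7 : (D r).re ≤ ‖err‖ := by
      rw [h5, Complex.add_re, Complex.ofReal_re]
      have := Complex.re_le_norm err
      have h8 : 0 ≤ 1 / (2 * π ^ 2) * ∫ x in circ, m x * ∑ i, w r x i * w r x i := by positivity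
      linarith
    refine (ENNReal.ofReal_le_ofReal h7).trans ?_
    rw [ofReal_norm]
    refine h3.trans ?_
    gcongr
  rw [hre]
  refine ENNReal.ofReal_add_le.trans (add_le_add le_rfl ?_)
  refine (ofReal_integral_le _ _).trans ((lintegral_mono_ae hD).trans ?_)
  rw [lintegral_const_mul' _ _ (by finiteness)]
  gcongr
  have hE := H.energy₀.ne
  have hi' : e⁻¹ ≠ ⊤ := ENNReal.inv_ne_top.2 h0
  rw [lintegral_add_right _ measurable_const, lintegral_const_mul' _ _ htop, lintegral_const,
    Measure.restrict_apply_univ, Real.volume_Ioc, sub_zero]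
  have h3 : e⁻¹ * hHalf u₀ * ENNReal.ofReal t = e * hHalf u₀ := by
    have : ENNReal.ofReal t = e * e := by
      rw [hedef, ← ENNReal.ofReal_mul hst.le, mul_self_sqrt htT.1.le]
    calc e⁻¹ * hHalf u₀ * ENNReal.ofReal t = e⁻¹ * e * (e * hHalf u₀) := by rw [this]; ring
      _ = e * hHalf u₀ := by rw [ENNReal.inv_mul_cancel h0 htop, one_mul]
  rw [h3]
  refine (add_le_add (mul_le_mul_right h2 e) le_rfl).trans_eq ?_
  rw [ENNReal.ofReal_mul (by positivity), ENNReal.ofReal_add pi_pos.le zero_le_one,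
    ENNReal.ofReal_one]
  ring

end IsFlow

end

section

variable {n : ℕ}

lemma isMultiplier_cut {R : ℝ} (hR : 0 < R) (hR2 : R < 1 / 2) (x₀ : ℝ) :
    IsMultiplier (fourierCoeff (cutC R x₀)) (cut R x₀) where
  summ := ENNReal.tsum_coe_ne_top_iff_summable.2
    (NNReal.summable_coe.1 (summable_cutC hR hR2 x₀).norm)
  summ_qs := ne_top_of_le_ne_top ENNReal.ofReal_ne_top (tsum_cutC_qs_le hR hR2 x₀)
  hasSum := hasSum_cut hR hR2 x₀
  continuous := continuous_cut R x₀
  mem := cut_mem hR x₀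

lemma lintegral_mul_sq_eq {c : ℤ → ℂ} {m : ℝ → ℝ} (hc : IsMultiplier c m) {v g : ℝ → E n}
    (hg : IsQuarterLapRep v g) :
    ∫⁻ x in circ, ENNReal.ofReal (m x) * ‖g x‖ₑ ^ 2
      = ENNReal.ofReal (2 * π) * ENNReal.ofReal (locEnergy c v).re := by
  obtain ⟨hgm, -, hg2, hgf⟩ := hg
  have hmem := memLp_two_comp hgm hg2.ne
  have hint : ∀ i, IntegrableOn (fun x => m x * (g x i * g x i)) circ := fun i =>
    integrable_mul_of_memLp hc.continuous hc.mem (hmem i) (hmem i)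
  have h0 : ∀ i x, 0 ≤ m x * (g x i * g x i) := fun i x =>
    mul_nonneg (hc.mem x).1 (mul_self_nonneg _)
  have hq : ∀ i, (qsMul fun k => fcV v k i) = fcR fun x => g x i := fun i => by
    funext k; exact (hgf k i).symm
  have h1 : (locEnergy c v).re = 1 / (2 * π) * ∑ i, ∫ x in circ, m x * (g x i * g x i) := by
    rw [locEnergy, Complex.re_sum, Finset.mul_sum]
    refine Finset.sum_congr rfl fun i _ => ?_
    rw [hq, tsum_toep_ofReal hc.summ hc.hasSum (hmem i) (hmem i), Complex.ofReal_re]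
  have hpi := pi_ne_zero
  rw [h1, ← ENNReal.ofReal_mul two_pi_pos.le, ← mul_assoc, mul_one_div_cancel two_pi_pos.ne',
    one_mul, ENNReal.ofReal_sum_of_nonneg fun i _ => integral_nonneg (h0 i)]
  have h2 : ∀ i, ENNReal.ofReal (∫ x in circ, m x * (g x i * g x i))
      = ∫⁻ x in circ, ENNReal.ofReal (m x * (g x i * g x i)) := fun i =>
    ofReal_integral_eq_lintegral_ofReal (hint i) (Eventually.of_forall (h0 i))
  simp only [h2]
  rw [← lintegral_finsetSum' _ fun i _ => (hint i).1.aemeasurable.ennreal_ofReal]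
  refine lintegral_congr fun x => ?_
  rw [← ENNReal.ofReal_sum_of_nonneg fun i _ => h0 i x, ← Finset.mul_sum,
    ENNReal.ofReal_mul (hc.mem x).1, ← ofReal_norm, ← ENNReal.ofReal_pow (norm_nonneg _),
    EuclideanSpace.real_norm_sq_eq]
  simp only [sq]

lemma lintegral_cut_eq {R x₀ : ℝ} {g : ℝ → E n} (hg : Function.Periodic g (2 * π)) :
    ∫⁻ x in circ, ENNReal.ofReal (cut R x₀ x) * ‖g x‖ₑ ^ 2
      = ∫⁻ x in Set.Ioc (x₀ - π) (x₀ + π), ENNReal.ofReal (cut R x₀ x) * ‖g x‖ₑ ^ 2 := by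
  have hp : Function.Periodic (fun x => ENNReal.ofReal (cut R x₀ x) * ‖g x‖ₑ ^ 2) (2 * π) := by
    intro x
    simp only [cut_periodic R x₀ x, hg x]
  rw [circ_eq, lintegral_period_eq hp (-π) (x₀ - π)]
  congr 3
  ring

lemma lintegral_ball_le_cut {R x₀ : ℝ} (hR : 0 < R) (hR2 : R < 1 / 2) {g : ℝ → E n}
    (hg : Function.Periodic g (2 * π)) :
    ∫⁻ x in Set.Ioo (x₀ - R) (x₀ + R), ‖g x‖ₑ ^ 2
      ≤ ∫⁻ x in circ, ENNReal.ofReal (cut R x₀ x) * ‖g x‖ₑ ^ 2 := by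
  have := pi_gt_three
  rw [lintegral_cut_eq hg]
  refine le_trans (setLIntegral_mono' measurableSet_Ioo fun x hx => ?_)
    (lintegral_mono_set (s := Set.Ioo (x₀ - R) (x₀ + R)) fun x hx => ?_)
  · rw [cut_eq_one hR hR2 (abs_le.2 ⟨by linarith [hx.1], by linarith [hx.2]⟩), ENNReal.ofReal_one,
      one_mul]
  · exact ⟨by linarith [hx.1], by linarith [hx.2]⟩

lemma lintegral_cut_le_ball {R x₀ : ℝ} (hR : 0 < R) {g : ℝ → E n}
    (hg : Function.Periodic g (2 * π)) :
    ∫⁻ x in circ, ENNReal.ofReal (cut R x₀ x) * ‖g x‖ₑ ^ 2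
      ≤ ∫⁻ x in Set.Ioo (x₀ - 2 * R) (x₀ + 2 * R), ‖g x‖ₑ ^ 2 := by
  rw [lintegral_cut_eq hg, ← lintegral_indicator measurableSet_Ioo]
  refine le_trans (setLIntegral_mono' measurableSet_Ioc fun x hx => ?_) (setLIntegral_le_lintegral _ _)
  by_cases h : x ∈ Set.Ioo (x₀ - 2 * R) (x₀ + 2 * R)
  · rw [Set.indicator_of_mem h]
    refine mul_le_of_le_one_left' ?_
    rw [← ENNReal.ofReal_one]
    exact ENNReal.ofReal_le_ofReal (cut_mem hR _ _).2
  · rw [cut_eq_zero hR (abs_le.2 ⟨by linarith [hx.1], by linarith [hx.2]⟩)]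
    · simp
    · by_contra! hlt
      rw [abs_lt] at hlt
      exact h ⟨by linarith [hlt.1], by linarith [hlt.2]⟩

/-- The constant in the local energy inequality. -/
def localConst : ℝ := 4 * π * cutConst * (π + 1) + 1

lemma IsFlow.local_energy {T : ℝ} {u₀ : ℝ → E n} {u w : ℝ → ℝ → E n} (H : IsFlow T u₀ u w) :
    ∀ᵐ t ∂(volume.restrict (Set.Ioc 0 T)), ∀ R : ℝ, 0 < R → R < 1 / 2 → ∀ x₀ : ℝ,
      ∀ g g₀ : ℝ → E n, IsQuarterLapRep (u t) g → IsQuarterLapRep u₀ g₀ →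
        ∫⁻ x in Set.Ioo (x₀ - R) (x₀ + R), ‖g x‖ₑ ^ 2
          ≤ (∫⁻ x in Set.Ioo (x₀ - 2 * R) (x₀ + 2 * R), ‖g₀ x‖ₑ ^ 2)
            + ENNReal.ofReal (localConst * (t / R ^ 2 + √t / R)) * hHalf u₀ := by
  filter_upwards [H.ae_locEnergy_le, ae_restrict_mem measurableSet_Ioc]
    with t ht htT R hR hR2 x₀ g g₀ hg hg₀
  have hc := isMultiplier_cut hR hR2 x₀
  have h1 := mul_le_mul_right (ht _ _ hc) (ENNReal.ofReal (2 * π))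
  rw [← lintegral_mul_sq_eq hc hg, mul_add, ← lintegral_mul_sq_eq hc hg₀] at h1
  refine (lintegral_ball_le_cut hR hR2 hg.2.1).trans (h1.trans
    (add_le_add (lintegral_cut_le_ball hR hg₀.2.1) ?_))
  have hC := cutConst_nonneg
  have hpi := pi_pos
  have htp := htT.1
  calc ENNReal.ofReal (2 * π) * (2 * (∑' j, ‖fourierCoeff (cutC R x₀) j‖ₑ * ENNReal.ofReal (qs j)) *
          (ENNReal.ofReal ((π + 1) * √t) * hHalf u₀))
      ≤ ENNReal.ofReal (2 * π) * (ENNReal.ofReal 2 * ENNReal.ofReal (cutConst / R) *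
          (ENNReal.ofReal ((π + 1) * √t) * hHalf u₀)) := by
        rw [ENNReal.ofReal_ofNat]
        gcongr
        exact tsum_cutC_qs_le hR hR2 x₀
    _ = ENNReal.ofReal (2 * π * (2 * (cutConst / R) * ((π + 1) * √t))) * hHalf u₀ := by
        rw [ENNReal.ofReal_mul (p := 2 * π) two_pi_pos.le,
          ENNReal.ofReal_mul (p := 2 * (cutConst / R)) (by positivity),
          ENNReal.ofReal_mul (p := 2) (q := cutConst / R) zero_le_two]
        ring
    _ ≤ _ := by
        refine mul_le_mul_left (ENNReal.ofReal_le_ofReal ?_) _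
        have h2 : 2 * π * (2 * (cutConst / R) * ((π + 1) * √t))
            = (4 * π * cutConst * (π + 1)) * (√t / R) := by ring
        rw [h2]
        refine mul_le_mul (by unfold localConst; linarith) ?_ (by positivity)
          (by unfold localConst; positivity)
        have : 0 ≤ t / R ^ 2 := by positivity
        linarith

end

end

/-- Struwe-type local energy inequality for weak solutions of the
half-harmonic gradient flow on `[0,T] × S¹` with nonincreasing energy:
`E_R(u;x₀,t) ≤ E_{2R}(u₀;x₀) + C (t/R² + √t/R) E(u₀)`. -/
theorem local_energy_inequality :
    ∃ C : ℝ, 0 < C ∧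
      ∀ n : ℕ, 2 ≤ n → ∀ T : ℝ, 0 < T →
      ∀ u₀ : ℝ → E n, Measurable u₀ → Function.Periodic u₀ (2 * π) →
        (∀ x, ‖u₀ x‖ = 1) → (∫⁻ x in circ, (‖u₀ x‖₊ : ℝ≥0∞) ^ 2) < ⊤ → hHalf u₀ < ⊤ →
      ∀ u w : ℝ → ℝ → E n,
        Measurable (Function.uncurry u) → Measurable (Function.uncurry w) →
        (∀ t, Function.Periodic (u t) (2 * π)) →
        (∀ᵐ p ∂((volume.restrict (Set.Ioc (0 : ℝ) T)).prod (volume.restrict circ)),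
          ‖u p.1 p.2‖ = 1) →
        (∀ᵐ t ∂(volume.restrict (Set.Ioc (0 : ℝ) T)), hSob 1 (u t) < ⊤) →
        (∫⁻ t in Set.Ioc (0 : ℝ) T, hSob 1 (u t)) < ⊤ →
        (∫⁻ t in Set.Ioc (0 : ℝ) T, ∫⁻ x in circ, (‖w t x‖₊ : ℝ≥0∞) ^ 2) < ⊤ →
        (∀ φ : ℝ → ℝ → E n, IsSTTestOn n T φ →
          (∫ t in Set.Ioc (0 : ℝ) T, ∫ x in circ, ∑ i, u t x i * deriv (fun s => φ s x i) t)
            = - ∫ t in Set.Ioc (0 : ℝ) T, ∫ x in circ, ∑ i, w t x i * φ t x i) →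
        (∀ φ : ℝ → ℝ → E n, IsSTTestOn n T φ →
          (∫ t in Set.Ioc (0 : ℝ) T, ∫ x in circ, ∑ i, w t x i * φ t x i)
            + (∫ t in Set.Ioc (0 : ℝ) T, pairing (u t) (φ t))
            = ∫ t in Set.Ioc (0 : ℝ) T, ∫ x in circ,
                gagl (u t) x * ∑ i, u t x i * φ t x i) →
        Tendsto (fun t => ∫⁻ x in circ, (‖u t x - u₀ x‖₊ : ℝ≥0∞) ^ 2)
          (nhdsWithin 0 (Set.Ioi 0)) (nhds 0) →
        (∀ᵐ t ∂(volume.restrict (Set.Ioc (0 : ℝ) T)), hHalf (u t) ≤ hHalf u₀) →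
        ∀ᵐ t ∂(volume.restrict (Set.Icc (0 : ℝ) T)),
          ∀ R : ℝ, 0 < R → R < 1 / 2 → ∀ x₀ : ℝ,
          ∀ g g₀ : ℝ → E n, IsQuarterLapRep (u t) g → IsQuarterLapRep u₀ g₀ →
            (1 / 2 : ℝ≥0∞) * (∫⁻ x in Set.Ioo (x₀ - R) (x₀ + R), (‖g x‖₊ : ℝ≥0∞) ^ 2)
              ≤ (1 / 2 : ℝ≥0∞) *
                  (∫⁻ x in Set.Ioo (x₀ - 2 * R) (x₀ + 2 * R), (‖g₀ x‖₊ : ℝ≥0∞) ^ 2)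
                + ENNReal.ofReal (C * (t / R ^ 2 + Real.sqrt t / R)) *
                    ((1 / 2 : ℝ≥0∞) * hHalf u₀) := by
  have hC := cutConst_nonneg
  refine ⟨localConst, by unfold localConst; positivity, ?_⟩
  intro n _ T hT u₀ hm₀ hp₀ hs₀ _ he₀ u w hmu hmw hpu hsu hae hsob hw2 hweak hflow hinit hdecay
  have H : IsFlow T u₀ u w := ⟨hT, hm₀, hp₀, hs₀, he₀, hmu, ⟨hmw, hw2.ne⟩, hpu, hsu, hsob, hae,
    hweak, hflow, hinit, hdecay⟩
  rw [← restrict_Ioc_eq_restrict_Icc]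
  filter_upwards [H.local_energy] with t ht R hR hR2 x₀ g g₀ hg hg₀
  have h := mul_le_mul_right (ht R hR hR2 x₀ g g₀ hg hg₀) (1 / 2 : ℝ≥0∞)
  rw [mul_add, mul_left_comm (1 / 2 : ℝ≥0∞) (ENNReal.ofReal _)] at h
  exact h
end
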